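/- arXiv:1508.01500 — 2 statements merged into one kernel-verified Lean document; each statement's English description precedes it below -/
import Mathlib

section
/- Let α < 0, let N ≥ 1 be an integer, and let u₀ ∈ ℒ(N). Then the solution u of the α-Szegő equation i∂ₜu = Π(|u|²u) + α(u|1) with u(0) = u₀ stays for all time in a compact subset of ℒ(N); in particular, for every s ≥ 0 there is a constant C = C(s, u₀, α), independent of time, such that ‖u(t)‖_{H^s} ≤ C for all t ∈ ℝ. -/
open Complex Filter
open scoped ComplexConjugate Topology ENNReal

noncomputable section

/-- ℓ²(ℕ, ℂ): the sequence model of the Hardy space L²₊(S¹), identifying a function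
with its sequence of nonnegative Fourier coefficients. -/
abbrev Hardy : Type := lp (fun _ : ℕ => ℂ) 2

/-- A coefficient sequence belongs to L²₊. -/
def MemL2 (u : ℕ → ℂ) : Prop := Memℓp u 2

/-- A coefficient sequence belongs to the Sobolev space H^s₊. -/
def MemHs (s : ℝ) (u : ℕ → ℂ) : Prop :=
  Summable fun n : ℕ => ((1 : ℝ) + (n : ℝ) ^ 2) ^ s * ‖u n‖ ^ 2

/-- The squared H^s norm of a coefficient sequence. -/
def hsNormSq (s : ℝ) (u : ℕ → ℂ) : ℝ :=
  ∑' n : ℕ, ((1 : ℝ) + (n : ℝ) ^ 2) ^ s * ‖u n‖ ^ 2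

/-- The L² inner product (f|g), ℂ-linear in the first argument. -/
def hinner (f g : ℕ → ℂ) : ℂ := ∑' n : ℕ, f n * conj (g n)

/-- The squared L² norm. -/
def l2normSq (f : ℕ → ℂ) : ℝ := ∑' n : ℕ, ‖f n‖ ^ 2

/-- Coefficients of the constant function 1. -/
def oneSeq : ℕ → ℂ := fun n => if n = 0 then 1 else 0

/-- The Hankel operator H_u(h) = Π(u ⬝ conj h) in Fourier coefficients. -/
def hankel (u h : ℕ → ℂ) : ℕ → ℂ := fun k => ∑' ℓ : ℕ, u (k + ℓ) * conj (h ℓ)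

/-- The shifted Hankel operator K_u = T_z^* ∘ H_u in Fourier coefficients. -/
def khankel (u h : ℕ → ℂ) : ℕ → ℂ := fun k => ∑' ℓ : ℕ, u (k + 1 + ℓ) * conj (h ℓ)

/-- H_u². -/
def hu2 (u h : ℕ → ℂ) : ℕ → ℂ := hankel u (hankel u h)

/-- K_u². -/
def ku2 (u h : ℕ → ℂ) : ℕ → ℂ := khankel u (khankel u h)

/-- The m-th Fourier coefficient of |u|², m ∈ ℤ. -/
def absSqCoeff (u : ℕ → ℂ) (m : ℤ) : ℂ :=
  ∑' q : ℕ × ℕ, if ((q.1 : ℤ) - (q.2 : ℤ) = m) then u q.1 * conj (u q.2) else 0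

/-- The Toeplitz operator T_{|u|²} in Fourier coefficients. -/
def toeplitzAbsSq (u h : ℕ → ℂ) : ℕ → ℂ :=
  fun k => ∑' ℓ : ℕ, absSqCoeff u ((k : ℤ) - (ℓ : ℤ)) * h ℓ

/-- Fourier coefficients of Π(|u|²u). -/
def cubic (u : ℕ → ℂ) : ℕ → ℂ := fun n =>
  ∑' q : ℕ × ℕ × ℕ, if q.1 + q.2.2 = q.2.1 + n then u q.1 * conj (u q.2.1) * u q.2.2 else 0

/-- `u : ℝ → (ℕ → ℂ)` solves the α-Szegő equation i ∂ₜ u = Π(|u|²u) + α(u|1),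
written coefficientwise on nonnegative Fourier modes. -/
def SolvesSzego (α : ℝ) (u : ℝ → ℕ → ℂ) : Prop :=
  ∀ n t, HasDerivAt (fun τ => u τ n)
    (-Complex.I * (cubic (u t) n + (α : ℂ) * u t 0 * oneSeq n)) t

/-- `u` is a smooth curve valued in H^s₊. -/
def SmoothHsCurve (s : ℝ) (u : ℝ → ℕ → ℂ) : Prop :=
  (∀ t, MemHs s (u t)) ∧ ∀ n, ContDiff ℝ (⊤ : ℕ∞) fun t => u t n

/-- `u` is a continuous curve valued in H^s₊. -/
def ContHsCurve (s : ℝ) (u : ℝ → ℕ → ℂ) : Prop :=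
  (∀ t, MemHs s (u t)) ∧
    ∀ t₀ : ℝ, Tendsto (fun t => hsNormSq s (fun n => u t n - u t₀ n)) (𝓝 t₀) (𝓝 0)

/-- E_u(τ) = ker(H_u² − τ² I) as a subset of ℓ². -/
def Espace (u : ℕ → ℂ) (τ : ℝ) : Set (ℕ → ℂ) :=
  {h | MemL2 h ∧ hu2 u h = ((τ : ℂ) ^ 2) • h}

/-- F_u(τ) = ker(K_u² − τ² I) as a subset of ℓ². -/
def Fspace (u : ℕ → ℂ) (τ : ℝ) : Set (ℕ → ℂ) :=
  {h | MemL2 h ∧ ku2 u h = ((τ : ℂ) ^ 2) • h}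

/-- Σ_H(u): τ > 0 such that E_u(τ) is not orthogonal to u. -/
def SigmaH (u : ℕ → ℂ) : Set ℝ :=
  {τ : ℝ | 0 < τ ∧ ∃ v ∈ Espace u τ, hinner u v ≠ 0}

/-- Σ_K(u): τ ≥ 0 such that F_u(τ) is not orthogonal to u. -/
def SigmaK (u : ℕ → ℂ) : Set ℝ :=
  {τ : ℝ | 0 ≤ τ ∧ ∃ v ∈ Fspace u τ, hinner u v ≠ 0}

/-- `p` is the orthogonal projection of `w` on the subspace `V` of ℓ². -/
def IsOrthProj (V : Set (ℕ → ℂ)) (w p : ℕ → ℂ) : Prop :=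
  p ∈ V ∧ ∀ v ∈ V, hinner (w - p) v = 0

/-- The rank of the shifted Hankel operator K_u. -/
def kuRank (u : ℕ → ℂ) : Cardinal :=
  Module.rank ℂ (Submodule.span ℂ (khankel u '' {h | MemL2 h}))

/-- The rank of the Hankel operator H_u. -/
def huRank (u : ℕ → ℂ) : Cardinal :=
  Module.rank ℂ (Submodule.span ℂ (hankel u '' {h | MemL2 h}))

/-- ℒ(N) : rank K_u = N. -/
def InLN (N : ℕ) (u : ℕ → ℂ) : Prop := MemL2 u ∧ kuRank u = N

/-- The constant function 1 as an element of ℓ². -/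
def oneH : Hardy := lp.single 2 0 1


namespace Szego

section LinearODE

open MeasureTheory

variable {E : Type*} [NormedAddCommGroup E] [NormedSpace ℝ E] [CompleteSpace E]

/-- A linear ODE with continuous, bounded coefficients in a Banach space has a global solution. -/
theorem exists_linear_ode_solution {C : ℝ → E →L[ℝ] E} (hC : Continuous C) {b : ℝ}
    (hb : ∀ t, ‖C t‖ ≤ b) (t₀ : ℝ) (x₀ : E) :
    ∃ x : ℝ → E, x t₀ = x₀ ∧ ∀ t, HasDerivAt x (C t (x t)) t := by
  have hb0 : 0 ≤ b := (norm_nonneg _).trans (hb 0)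
  set m : ℝ := 2 * (b + 1) with hm
  have hm0 : 0 < m := by positivity
  set W : ℝ → ℝ := fun s => Real.cosh (m * (s - t₀)) with hW
  have hWc : Continuous W := by fun_prop
  have hW1 : ∀ s, 1 ≤ W s := fun s => Real.one_le_cosh _
  have hW0 : ∀ s, 0 < W s := fun s => zero_lt_one.trans_le (hW1 s)
  have integral_cosh_eq : ∀ t, ∫ s in t₀..t, W s = Real.sinh (m * (t - t₀)) / m := by
    intro t
    have hd : ∀ s ∈ Set.uIcc t₀ t,
        HasDerivAt (fun s => Real.sinh (m * (s - t₀)) / m) (W s) s := by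
      intro s _
      have h1 : HasDerivAt (fun s : ℝ => m * (s - t₀)) m s := by
        simpa using ((hasDerivAt_id s).sub_const t₀).const_mul m
      have h2 := ((Real.hasDerivAt_sinh _).comp s h1).div_const m
      simpa [hW, hm0.ne'] using h2
    rw [intervalIntegral.integral_eq_sub_of_hasDerivAt hd (hWc.intervalIntegrable _ _)]
    simp
  have hintle : ∀ t, |∫ s in t₀..t, W s| ≤ W t / m := by
    intro t
    rw [integral_cosh_eq, abs_div, abs_of_pos hm0]
    gcongr
    rw [abs_le]
    constructor
    · have := Real.sinh_lt_cosh (-(m * (t - t₀)))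
      rw [Real.sinh_neg, Real.cosh_neg] at this
      simp only [hW]
      linarith
    · exact (Real.sinh_lt_cosh _).le
  have hcont : ∀ y : BoundedContinuousFunction ℝ E, Continuous fun s => W s • C s (y s) :=
    fun y => hWc.smul (hC.clm_apply y.continuous)
  have hest : ∀ (y : BoundedContinuousFunction ℝ E) (t : ℝ),
      ‖∫ s in t₀..t, W s • C s (y s)‖ ≤ ‖y‖ / 2 * W t := by
    intro y t
    have h1 : ‖∫ s in t₀..t, W s • C s (y s)‖ ≤ |∫ s in t₀..t, b * ‖y‖ * W s| := by
      refine intervalIntegral.norm_integral_le_abs_of_norm_le (Eventually.of_forall fun s => ?_)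
        ((continuous_const.mul hWc).intervalIntegrable _ _)
      rw [norm_smul, Real.norm_of_nonneg (hW0 s).le, mul_comm]
      have := (C s).le_of_opNorm_le (hb s) (y s)
      have h3 := y.norm_coe_le_norm s
      have h4 := (hW0 s).le
      gcongr
      exact this.trans (by gcongr)
    rw [intervalIntegral.integral_const_mul, abs_mul, abs_of_nonneg (by positivity)] at h1
    refine h1.trans ?_
    have h2 : b * ‖y‖ * |∫ s in t₀..t, W s| ≤ b * ‖y‖ * (W t / m) := by gcongr; exact hintle t
    refine h2.trans ?_
    have h5 : b / m ≤ 1 / 2 := by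
      rw [div_le_div_iff₀ hm0 two_pos]
      linarith
    have h6 := (hW0 t).le
    calc b * ‖y‖ * (W t / m) = b / m * (‖y‖ * W t) := by ring
      _ ≤ 1 / 2 * (‖y‖ * W t) := by gcongr
      _ = ‖y‖ / 2 * W t := by ring
  have hderiv : ∀ (y : BoundedContinuousFunction ℝ E) (t : ℝ),
      HasDerivAt (fun t => ∫ s in t₀..t, W s • C s (y s)) (W t • C t (y t)) t := by
    intro y t
    exact intervalIntegral.integral_hasDerivAt_right ((hcont y).intervalIntegrable _ _)
      ((hcont y).stronglyMeasurableAtFilter _ _) (hcont y).continuousAt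
  let Φ : BoundedContinuousFunction ℝ E → BoundedContinuousFunction ℝ E := fun y =>
    BoundedContinuousFunction.ofNormedAddCommGroup
      (fun t => (W t)⁻¹ • (x₀ + ∫ s in t₀..t, W s • C s (y s)))
      ((hWc.inv₀ fun t => (hW0 t).ne').smul (continuous_const.add
        (continuous_iff_continuousAt.2 fun t => (hderiv y t).continuousAt)))
      (‖x₀‖ + ‖y‖ / 2) (by
        intro t
        rw [norm_smul, norm_inv, Real.norm_of_nonneg (hW0 t).le, inv_mul_le_iff₀ (hW0 t)]
        refine (norm_add_le _ _).trans ?_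
        have := hest y t
        have h8 : ‖x₀‖ ≤ W t * ‖x₀‖ := le_mul_of_one_le_left (norm_nonneg _) (hW1 t)
        linarith)
  have hΦ : ContractingWith (1 / 2) Φ := by
    refine ⟨by rw [← NNReal.coe_lt_coe]; norm_num, LipschitzWith.of_dist_le_mul fun y z => ?_⟩
    rw [BoundedContinuousFunction.dist_le (by positivity)]
    intro t
    have h1 : Φ y t - Φ z t = (W t)⁻¹ • ∫ s in t₀..t, W s • C s ((y - z) s) := by
      have h2 : ∫ s in t₀..t, W s • C s ((y - z) s) =
          (∫ s in t₀..t, W s • C s (y s)) - ∫ s in t₀..t, W s • C s (z s) := by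
        rw [← intervalIntegral.integral_sub ((hcont y).intervalIntegrable _ _)
          ((hcont z).intervalIntegrable _ _)]
        simp [smul_sub]
      rw [h2]
      simp only [Φ, BoundedContinuousFunction.coe_ofNormedAddCommGroup, ← smul_sub]
      congr 1
      abel
    rw [dist_eq_norm, h1, norm_smul, norm_inv, Real.norm_of_nonneg (hW0 t).le,
      inv_mul_le_iff₀ (hW0 t), dist_eq_norm]
    refine (hest (y - z) t).trans (le_of_eq ?_)
    push_cast
    ring
  have hfix := hΦ.fixedPoint_isFixedPt
  set y := ContractingWith.fixedPoint Φ hΦ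
  have hy : ∀ t, W t • y t = x₀ + ∫ s in t₀..t, W s • C s (y s) := by
    intro t
    have : y t = Φ y t := by rw [hfix.eq]
    conv_lhs => rw [this]
    simp only [Φ, BoundedContinuousFunction.coe_ofNormedAddCommGroup]
    rw [smul_inv_smul₀ (hW0 t).ne']
  refine ⟨fun t => W t • y t, by simp [hy], fun t => ?_⟩
  have h1 := (hderiv y t).const_add x₀
  simp only [map_smul]
  exact h1.congr_of_eventuallyEq (Eventually.of_forall hy)

/-- Solutions of a bounded linear ODE are determined by one value. -/
theorem linear_ode_solution_unique {C : ℝ → E →L[ℝ] E} {b : ℝ}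
    (hb : ∀ t, ‖C t‖ ≤ b) {t₀ : ℝ} {x y : ℝ → E} (hx : ∀ t, HasDerivAt x (C t (x t)) t)
    (hy : ∀ t, HasDerivAt y (C t (y t)) t) (h : x t₀ = y t₀) : x = y := by
  refine ODE_solution_unique_univ (v := fun t x => C t x) (s := fun _ => Set.univ)
    (K := ⟨b, (norm_nonneg _).trans (hb 0)⟩) (fun t => ?_)
    (fun t => ⟨hx t, trivial⟩) (fun t => ⟨hy t, trivial⟩) h
  exact ((C t).lipschitz.weaken (hb t)).lipschitzOnWith

end LinearODE

end Szego

namespace Szego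

/-- Absolutely summable coefficient sequences. -/
def Wiener : Type := lp (fun _ : ℕ => ℂ) 1

namespace Wiener

instance : NormedAddCommGroup Wiener := inferInstanceAs (NormedAddCommGroup (lp (fun _ : ℕ => ℂ) 1))

instance : NormedSpace ℂ Wiener := inferInstanceAs (NormedSpace ℂ (lp (fun _ : ℕ => ℂ) 1))

instance : CompleteSpace Wiener := inferInstanceAs (CompleteSpace (lp (fun _ : ℕ => ℂ) 1))

/-- The coefficients of an element of the Wiener space. -/
@[coe] def toFun (u : Wiener) : ℕ → ℂ := fun n => (show lp (fun _ : ℕ => ℂ) 1 from u) n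

instance : CoeFun Wiener (fun _ => ℕ → ℂ) := ⟨toFun⟩

theorem ext {u v : Wiener} (h : ∀ n, u n = v n) : u = v := lp.ext (funext h)

@[simp] theorem add_apply (u v : Wiener) (n : ℕ) : (u + v) n = u n + v n := rfl

@[simp] theorem sub_apply (u v : Wiener) (n : ℕ) : (u - v) n = u n - v n := rfl

@[simp] theorem zero_apply (n : ℕ) : (0 : Wiener) n = 0 := rfl

@[simp] theorem smul_apply (c : ℂ) (u : Wiener) (n : ℕ) : (c • u) n = c * u n := rfl

@[simp] theorem real_smul_apply (c : ℝ) (u : Wiener) (n : ℕ) : (c • u) n = c * u n := rfl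

theorem summable_norm (u : Wiener) : Summable fun n => ‖u n‖ := by
  have := (lp.memℓp (show lp (fun _ : ℕ => ℂ) 1 from u)).summable (by simp)
  simp only [ENNReal.toReal_one, Real.rpow_one] at this
  exact this

theorem norm_eq (u : Wiener) : ‖u‖ = ∑' n, ‖u n‖ := by
  have := lp.norm_eq_tsum_rpow (p := 1) (by simp) (show lp (fun _ : ℕ => ℂ) 1 from u)
  simp only [ENNReal.toReal_one, Real.rpow_one, ne_eq, one_ne_zero, not_false_eq_true, div_self] at this
  exact this

/-- The element of the Wiener space with given absolutely summable coefficients. -/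
def mk (f : ℕ → ℂ) (hf : Summable fun n => ‖f n‖) : Wiener :=
  (⟨f, memℓp_gen (by simpa using hf)⟩ : lp (fun _ : ℕ => ℂ) 1)

@[simp] theorem mk_apply (f : ℕ → ℂ) (hf) (n : ℕ) : mk f hf n = f n := rfl

theorem norm_apply_le (u : Wiener) (n : ℕ) : ‖u n‖ ≤ ‖u‖ := by
  rw [norm_eq]
  exact u.summable_norm.le_tsum n fun _ _ => norm_nonneg _

/-- The `n`-th coefficient as a continuous linear functional. -/
def coeff (n : ℕ) : Wiener →L[ℂ] ℂ :=
  LinearMap.mkContinuous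
    { toFun := fun u => u n, map_add' := fun _ _ => rfl, map_smul' := fun _ _ => rfl } 1
    (fun u => by rw [one_mul]; exact u.norm_apply_le n)

@[simp] theorem coeff_apply (n : ℕ) (u : Wiener) : coeff n u = u n := rfl

/-- The monomial of degree `n`. -/
def mono (n : ℕ) : Wiener := (lp.single 1 n 1 : lp (fun _ : ℕ => ℂ) 1)

theorem mono_apply (n k : ℕ) : mono n k = if k = n then 1 else 0 := by
  have := lp.single_apply (E := fun _ : ℕ => ℂ) 1 n 1 k
  simp only [Pi.single_apply] at this
  exact this

theorem norm_mono (n : ℕ) : ‖mono n‖ = 1 := by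
  have := lp.norm_single (E := fun _ : ℕ => ℂ) (p := 1) (by simp) n 1
  exact this.trans (by simp)

theorem hasSum_mono (u : Wiener) : HasSum (fun n => u n • mono n) u := by
  have h : (fun n => u n • mono n) =
      fun n => (show Wiener from lp.single (E := fun _ : ℕ => ℂ) 1 n (u n)) := by
    funext n
    have h := lp.single_smul (E := fun _ : ℕ => ℂ) 1 n (u n) (1 : ℂ)
    simp only [smul_eq_mul, mul_one] at h
    exact h.symm
  rw [h]
  exact lp.hasSum_single (p := 1) (by simp) (show lp (fun _ : ℕ => ℂ) 1 from u)

end Wiener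

section Synthesis

variable {F G : Type*} [NormedAddCommGroup F] [NormedSpace ℝ F] [CompleteSpace F]
  [NormedAddCommGroup G] [NormedSpace ℝ G] [CompleteSpace G]

theorem summable_synthesis {x : ℕ → ℂ →ₗ[ℝ] F} (hx : ∀ n c, ‖x n c‖ ≤ ‖c‖) (u : Wiener) :
    Summable fun n => x n (u n) :=
  Summable.of_norm_bounded u.summable_norm fun n => hx n (u n)

/-- The map `u ↦ ∑ₙ xₙ(uₙ)` for a sequence of contractions `xₙ`. -/
def synthesis (x : ℕ → ℂ →ₗ[ℝ] F) (hx : ∀ n c, ‖x n c‖ ≤ ‖c‖) : Wiener →L[ℝ] F :=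
  LinearMap.mkContinuous
    { toFun := fun u => ∑' n, x n (u n)
      map_add' := fun u v => by
        simp only [Wiener.add_apply, map_add]
        exact (summable_synthesis hx u).tsum_add (summable_synthesis hx v)
      map_smul' := fun c u => by
        simp only [Wiener.real_smul_apply, ← Complex.real_smul, map_smul, RingHom.id_apply]
        exact (summable_synthesis hx u).tsum_const_smul c } 1
    (fun u => by
      rw [one_mul, Wiener.norm_eq]
      exact tsum_of_norm_bounded u.summable_norm.hasSum fun n => hx n (u n))

theorem hasSum_synthesis (x : ℕ → ℂ →ₗ[ℝ] F) (hx : ∀ n c, ‖x n c‖ ≤ ‖c‖) (u : Wiener) :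
    HasSum (fun n => x n (u n)) (synthesis x hx u) :=
  (summable_synthesis hx u).hasSum

theorem norm_synthesis_le (x : ℕ → ℂ →ₗ[ℝ] F) (hx : ∀ n c, ‖x n c‖ ≤ ‖c‖) (u : Wiener) :
    ‖synthesis x hx u‖ ≤ ‖u‖ := by
  have := (LinearMap.mkContinuous_norm_le _ zero_le_one _ : ‖synthesis x hx‖ ≤ 1)
  simpa using (synthesis x hx).le_of_opNorm_le this u

end Synthesis

section PowerSeries

variable {F G : Type*} [NormedAddCommGroup F] [NormedSpace ℂ F] [CompleteSpace F]
  [NormedAddCommGroup G] [NormedSpace ℂ G] [CompleteSpace G]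

theorem norm_pow_apply_le {R : F →L[ℝ] F} (hR : ∀ x, ‖R x‖ ≤ ‖x‖) (n : ℕ) (x : F) :
    ‖(R ^ n) x‖ ≤ ‖x‖ := by
  induction n with
  | zero => simp
  | succ n ih => rw [pow_succ']; exact (hR _).trans ih

/-- Multiplication of an operator by a complex scalar, as a real-linear map. -/
def scalarMul (R : F →L[ℝ] F) : ℂ →ₗ[ℝ] F →L[ℝ] F where
  toFun c := c • R
  map_add' := fun a b => add_smul a b R
  map_smul' := fun r c => by
    ext x
    simp [mul_smul]

/-- Multiplication of an operator by a conjugated complex scalar, as a real-linear map. -/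
def conjScalarMul (R : F →L[ℝ] F) : ℂ →ₗ[ℝ] F →L[ℝ] F where
  toFun c := conj c • R
  map_add' := fun a b => by rw [map_add, add_smul]
  map_smul' := fun r c => by
    ext x
    simp [mul_smul]

theorem norm_scalarMul_pow_le {R : F →L[ℝ] F} (hR : ∀ x, ‖R x‖ ≤ ‖x‖) (n : ℕ) (c : ℂ) :
    ‖scalarMul (R ^ n) c‖ ≤ ‖c‖ := by
  refine ContinuousLinearMap.opNorm_le_bound _ (norm_nonneg _) fun x => ?_
  simp only [scalarMul, LinearMap.coe_mk, AddHom.coe_mk, smul_apply,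
    norm_smul]
  gcongr
  exact norm_pow_apply_le hR n x

/-- The power series `∑ₙ uₙ Rⁿ` of a contraction `R`. -/
def powerSeries (R : F →L[ℝ] F) (hR : ∀ x, ‖R x‖ ≤ ‖x‖) : Wiener →L[ℝ] (F →L[ℝ] F) :=
  synthesis (fun n => scalarMul (R ^ n)) fun n c => norm_scalarMul_pow_le hR n c

/-- The power series `∑ₙ conj(uₙ) Rⁿ` of a contraction `R`. -/
def conjPowerSeries (R : F →L[ℝ] F) (hR : ∀ x, ‖R x‖ ≤ ‖x‖) : Wiener →L[ℝ] (F →L[ℝ] F) :=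
  synthesis (fun n => conjScalarMul (R ^ n)) fun n c =>
    (norm_scalarMul_pow_le hR n (conj c)).trans (RCLike.norm_conj c).le

variable {R : F →L[ℝ] F} {hR : ∀ x, ‖R x‖ ≤ ‖x‖} {Q : G →L[ℝ] G} {hQ : ∀ x, ‖Q x‖ ≤ ‖x‖}

theorem hasSum_apply {f : ℕ → F →L[ℝ] F} {g : F →L[ℝ] F} (h : HasSum f g) (x : F) :
    HasSum (fun n => f n x) (g x) :=
  (ContinuousLinearMap.apply ℝ F x).hasSum h

theorem hasSum_powerSeries (u : Wiener) (x : F) :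
    HasSum (fun n => u n • (R ^ n) x) (powerSeries R hR u x) :=
  hasSum_apply (f := fun n => scalarMul (R ^ n) (u n)) (hasSum_synthesis _ _ u) x

theorem hasSum_conjPowerSeries (u : Wiener) (x : F) :
    HasSum (fun n => conj (u n) • (R ^ n) x) (conjPowerSeries R hR u x) :=
  hasSum_apply (f := fun n => conjScalarMul (R ^ n) (u n)) (hasSum_synthesis _ _ u) x

theorem norm_powerSeries_le (u : Wiener) : ‖powerSeries R hR u‖ ≤ ‖u‖ := norm_synthesis_le _ _ u

theorem norm_conjPowerSeries_le (u : Wiener) : ‖conjPowerSeries R hR u‖ ≤ ‖u‖ :=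
  norm_synthesis_le _ _ u

theorem intertwine_pow {X : F →L[ℝ] G} (h : ∀ x, X (R x) = Q (X x)) (n : ℕ) (x : F) :
    X ((R ^ n) x) = (Q ^ n) (X x) := by
  induction n with
  | zero => simp
  | succ n ih => simp only [pow_succ', mul_apply_eq_comp, h, ih]

theorem map_powerSeries {X : F →L[ℝ] G} (hX : ∀ (c : ℂ) x, X (c • x) = c • X x)
    (h : ∀ x, X (R x) = Q (X x)) (u : Wiener) (x : F) :
    X (powerSeries R hR u x) = powerSeries Q hQ u (X x) := by
  refine (X.hasSum (hasSum_powerSeries u x)).unique ?_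
  simp only [hX, intertwine_pow h]
  exact hasSum_powerSeries u (X x)

theorem map_conjPowerSeries {X : F →L[ℝ] G} (hX : ∀ (c : ℂ) x, X (c • x) = c • X x)
    (h : ∀ x, X (R x) = Q (X x)) (u : Wiener) (x : F) :
    X (conjPowerSeries R hR u x) = conjPowerSeries Q hQ u (X x) := by
  refine (X.hasSum (hasSum_conjPowerSeries u x)).unique ?_
  simp only [hX, intertwine_pow h]
  exact hasSum_conjPowerSeries u (X x)

theorem map_powerSeries_of_antilinear {X : F →L[ℝ] G}
    (hX : ∀ (c : ℂ) x, X (c • x) = conj c • X x)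
    (h : ∀ x, X (R x) = Q (X x)) (u : Wiener) (x : F) :
    X (powerSeries R hR u x) = conjPowerSeries Q hQ u (X x) := by
  refine (X.hasSum (hasSum_powerSeries u x)).unique ?_
  simp only [hX, intertwine_pow h]
  exact hasSum_conjPowerSeries u (X x)

theorem pow_smul_of_linear (hX : ∀ (c : ℂ) x, R (c • x) = c • R x) (n : ℕ) (c : ℂ) (x : F) :
    (R ^ n) (c • x) = c • (R ^ n) x := by
  induction n with
  | zero => simp
  | succ n ih => simp only [pow_succ', mul_apply_eq_comp, hX, ih]

theorem powerSeries_smul (hX : ∀ (c : ℂ) x, R (c • x) = c • R x) (u : Wiener) (c : ℂ) (x : F) :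
    powerSeries R hR u (c • x) = c • powerSeries R hR u x := by
  refine (hasSum_powerSeries u (c • x)).unique ?_
  simp only [pow_smul_of_linear hX, smul_comm _ c]
  exact (hasSum_powerSeries u x).const_smul c

theorem conjPowerSeries_smul (hX : ∀ (c : ℂ) x, R (c • x) = c • R x) (u : Wiener) (c : ℂ)
    (x : F) : conjPowerSeries R hR u (c • x) = c • conjPowerSeries R hR u x := by
  refine (hasSum_conjPowerSeries u (c • x)).unique ?_
  simp only [pow_smul_of_linear hX, smul_comm _ c]
  exact (hasSum_conjPowerSeries u x).const_smul c

end PowerSeries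

end Szego

namespace Szego

namespace Wiener

/-- The forward shift on the Wiener space. -/
def shift : Wiener →L[ℝ] Wiener :=
  synthesis (fun n => (LinearMap.toSpanSingleton ℂ Wiener (mono (n + 1))).restrictScalars ℝ)
    fun n c => by simp [norm_smul, norm_mono]

/-- The backward shift on the Wiener space. -/
def backshift : Wiener →L[ℝ] Wiener :=
  synthesis (fun n => if n = 0 then 0 else
    (LinearMap.toSpanSingleton ℂ Wiener (mono (n - 1))).restrictScalars ℝ)
    fun n c => by split_ifs <;> simp [norm_smul, norm_mono]

theorem norm_shift_le (u : Wiener) : ‖shift u‖ ≤ ‖u‖ := norm_synthesis_le _ _ u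

theorem norm_backshift_le (u : Wiener) : ‖backshift u‖ ≤ ‖u‖ := norm_synthesis_le _ _ u

theorem hasSum_shift (u : Wiener) : HasSum (fun n => u n • mono (n + 1)) (shift u) :=
  hasSum_synthesis _ _ u

theorem hasSum_backshift (u : Wiener) : HasSum (fun n => u (n + 1) • mono n) (backshift u) := by
  have h := hasSum_synthesis (fun n => if n = 0 then 0 else
    (LinearMap.toSpanSingleton ℂ Wiener (mono (n - 1))).restrictScalars ℝ)
    (fun n c => by split_ifs <;> simp [norm_smul, norm_mono]) u
  have h2 := (hasSum_nat_add_iff' 1).2 h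
  simp only [Finset.range_one, Finset.sum_singleton, if_true, LinearMap.zero_apply, sub_zero,
    Nat.add_eq_zero_iff, one_ne_zero, and_false, if_false, Nat.add_sub_cancel] at h2
  exact h2

@[simp] theorem shift_apply_zero (u : Wiener) : shift u 0 = 0 := by
  have h := (coeff 0).hasSum (hasSum_shift u)
  simp [mono_apply] at h
  exact h.unique hasSum_zero

@[simp] theorem shift_apply_succ (u : Wiener) (k : ℕ) : shift u (k + 1) = u k := by
  have h := (coeff (k + 1)).hasSum (hasSum_shift u)
  simp only [coeff_apply, mono_apply, add_left_inj, map_smul] at h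
  refine h.unique ?_
  convert hasSum_ite_eq k (u k) using 2 with n
  by_cases hn : n = k
  · simp [hn]
  · simp [hn, Ne.symm hn]

@[simp] theorem backshift_apply (u : Wiener) (k : ℕ) : backshift u k = u (k + 1) := by
  have h := (coeff k).hasSum (hasSum_backshift u)
  simp only [coeff_apply, mono_apply, map_smul] at h
  refine h.unique ?_
  convert hasSum_ite_eq k (u (k + 1)) using 2 with n
  by_cases hn : n = k
  · simp [hn]
  · simp [hn, Ne.symm hn]

theorem backshift_pow_apply (u : Wiener) (j k : ℕ) : (backshift ^ j) u k = u (k + j) := by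
  induction j generalizing k with
  | zero => simp
  | succ j ih =>
    rw [pow_succ', mul_apply_eq_comp, backshift_apply, ih]
    congr 1
    ring

theorem shift_pow_apply (u : Wiener) (j k : ℕ) :
    (shift ^ j) u k = if j ≤ k then u (k - j) else 0 := by
  induction j generalizing k with
  | zero => simp
  | succ j ih =>
    rw [pow_succ', mul_apply_eq_comp]
    cases k with
    | zero => simp
    | succ k => rw [shift_apply_succ, ih]; simp

/-- The cubic term `Π(|u|²u)` as an element of the Wiener space. -/
def cubicTerm (u : Wiener) : Wiener :=
  conjPowerSeries backshift norm_backshift_le u (powerSeries shift norm_shift_le u u)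

theorem norm_cubicTerm_le (u : Wiener) : ‖cubicTerm u‖ ≤ ‖u‖ ^ 3 := by
  have h1 := (conjPowerSeries backshift norm_backshift_le u).le_of_opNorm_le
    (norm_conjPowerSeries_le u) (powerSeries shift norm_shift_le u u)
  have h2 := (powerSeries shift norm_shift_le u).le_of_opNorm_le (norm_powerSeries_le u) u
  calc ‖cubicTerm u‖ ≤ ‖u‖ * (‖u‖ * ‖u‖) := h1.trans (by gcongr)
    _ = ‖u‖ ^ 3 := by ring

theorem continuous_cubicTerm : Continuous cubicTerm :=
  (conjPowerSeries backshift norm_backshift_le).continuous.clm_apply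
    ((powerSeries shift norm_shift_le).continuous.clm_apply continuous_id)

theorem cubicTerm_apply (u : Wiener) (n : ℕ) : cubicTerm u n = cubic u n := by
  set f : ℕ × ℕ × ℕ → ℂ := fun q =>
    if q.1 + q.2.2 = q.2.1 + n then u q.1 * conj (u q.2.1) * u q.2.2 else 0 with hf
  have hn := u.summable_norm
  have hfs : Summable f := by
    refine Summable.of_norm_bounded (g := fun q : ℕ × ℕ × ℕ => ‖u q.1‖ * (‖u q.2.1‖ * ‖u q.2.2‖))
      (hn.mul_of_nonneg (hn.mul_of_nonneg hn (fun _ => norm_nonneg _) fun _ => norm_nonneg _)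
        (fun _ => norm_nonneg _) fun _ => by positivity) fun q => ?_
    simp only [hf]
    split_ifs
    · simp [mul_assoc]
    · simp only [norm_zero]; positivity
  let e : ℕ × ℕ × ℕ ≃ ℕ × ℕ × ℕ :=
    ⟨fun q => (q.2.1, q.1, q.2.2), fun q => (q.2.1, q.1, q.2.2), fun _ => rfl, fun _ => rfl⟩
  have hes : Summable (f ∘ e) := e.summable_iff.2 hfs
  have h1 : cubic u n = ∑' b, ∑' a, ∑' c, f (a, b, c) := by
    change ∑' q, f q = _
    rw [← e.tsum_eq f]
    change ∑' q, (f ∘ e) q = _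
    rw [hes.tsum_prod]
    congr 1
    funext b
    exact (hes.prod_factor b).tsum_prod
  have h2 : ∀ a b, ∑' c, f (a, b, c) = conj (u b) * (u a * (shift ^ a) u (n + b)) := by
    intro a b
    rw [shift_pow_apply]
    split_ifs with h
    · rw [tsum_eq_single (n + b - a)]
      · simp only [hf]
        rw [if_pos (by omega)]
        ring
      · intro c hc
        simp only [hf]
        rw [if_neg (by omega)]
    · simp only [hf, mul_zero]
      convert tsum_zero with c
      rw [if_neg (by omega)]
  have h3 := (coeff n).hasSum (hasSum_conjPowerSeries (hR := norm_backshift_le) u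
    (powerSeries shift norm_shift_le u u))
  have h4 : ∀ m, powerSeries shift norm_shift_le u u m = ∑' a, u a * (shift ^ a) u m := by
    intro m
    have := (coeff m).hasSum (hasSum_powerSeries (hR := norm_shift_le) u u)
    simp only [coeff_apply, map_smul, smul_eq_mul] at this
    exact this.tsum_eq.symm
  simp only [coeff_apply, map_smul, smul_eq_mul, backshift_pow_apply, h4] at h3
  rw [h1, cubicTerm, ← h3.tsum_eq]
  simp only [h2, tsum_mul_left]

end Wiener

end Szego

namespace Szego

open scoped InnerProductSpace

/-- A complex Hilbert space with a unilateral shift of multiplicity one, its adjoint and a unit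
vector spanning the kernel of the adjoint. -/
class ShiftSpace (E : Type*) [NormedAddCommGroup E] [InnerProductSpace ℂ E] where
  fwd : E →L[ℝ] E
  bwd : E →L[ℝ] E
  one : E
  fwd_smul : ∀ (c : ℂ) x, fwd (c • x) = c • fwd x
  bwd_smul : ∀ (c : ℂ) x, bwd (c • x) = c • bwd x
  inner_bwd : ∀ x y, ⟪bwd x, y⟫_ℂ = ⟪x, fwd y⟫_ℂ
  bwd_fwd : ∀ x, bwd (fwd x) = x
  fwd_bwd : ∀ x, fwd (bwd x) = x - ⟪one, x⟫_ℂ • one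
  norm_one : ‖one‖ = 1
  total : ∀ x, (∀ n : ℕ, ⟪(fwd ^ n) one, x⟫_ℂ = 0) → x = 0

namespace ShiftSpace

variable {E : Type*} [NormedAddCommGroup E] [InnerProductSpace ℂ E] [ShiftSpace E]

theorem inner_fwd (x y : E) : ⟪fwd x, y⟫_ℂ = ⟪x, bwd y⟫_ℂ := by
  rw [← inner_conj_symm, ← inner_bwd, inner_conj_symm]

theorem norm_fwd (x : E) : ‖fwd x‖ = ‖x‖ := by
  have h : ⟪fwd x, fwd x⟫_ℂ = ⟪x, x⟫_ℂ := by rw [inner_fwd, bwd_fwd]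
  rw [inner_self_eq_norm_sq_to_K, inner_self_eq_norm_sq_to_K] at h
  have h2 : ‖fwd x‖ ^ 2 = ‖x‖ ^ 2 := by exact_mod_cast h
  exact (sq_eq_sq₀ (norm_nonneg _) (norm_nonneg _)).1 h2

theorem inner_one_one : ⟪(one : E), one⟫_ℂ = 1 := by
  rw [inner_self_eq_norm_sq_to_K, norm_one]
  simp

theorem bwd_one : bwd (one : E) = 0 := by
  have h : fwd (bwd (one : E)) = 0 := by rw [fwd_bwd, inner_one_one, one_smul, sub_self]
  rw [← norm_eq_zero, ← norm_fwd, h, norm_zero]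

theorem inner_one_fwd (x : E) : ⟪one, fwd x⟫_ℂ = 0 := by
  rw [← inner_bwd, bwd_one, inner_zero_left]

theorem norm_sq_bwd (x : E) : ‖bwd x‖ ^ 2 = ‖x‖ ^ 2 - ‖⟪one, x⟫_ℂ‖ ^ 2 := by
  have h : ⟪bwd x, bwd x⟫_ℂ = ⟪x, x⟫_ℂ - ⟪one, x⟫_ℂ * conj ⟪one, x⟫_ℂ := by
    rw [inner_bwd, fwd_bwd, inner_sub_right, inner_smul_right, inner_conj_symm]
  rw [inner_self_eq_norm_sq_to_K, inner_self_eq_norm_sq_to_K, Complex.mul_conj,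
    Complex.normSq_eq_norm_sq] at h
  simp only [Complex.coe_algebraMap] at h
  exact_mod_cast h

theorem norm_bwd_le (x : E) : ‖bwd x‖ ≤ ‖x‖ := by
  have := norm_sq_bwd x
  exact (sq_le_sq₀ (norm_nonneg _) (norm_nonneg _)).1 (by nlinarith [sq_nonneg ‖⟪one, x⟫_ℂ‖])

theorem norm_fwd_le (x : E) : ‖fwd x‖ ≤ ‖x‖ := (norm_fwd x).le

variable (E) in
/-- The orthonormal basis generated by the shift. -/
def basis (n : ℕ) : E := (fwd ^ n) one

@[simp] theorem basis_zero : basis E 0 = one := rfl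

theorem fwd_basis (n : ℕ) : fwd (basis E n) = basis E (n + 1) := by
  rw [basis, basis, pow_succ', mul_apply_eq_comp]

theorem bwd_basis_succ (n : ℕ) : bwd (basis E (n + 1)) = basis E n := by
  rw [← fwd_basis, bwd_fwd]

theorem inner_basis_bwd (n : ℕ) (x : E) : ⟪basis E n, bwd x⟫_ℂ = ⟪basis E (n + 1), x⟫_ℂ := by
  rw [← fwd_basis, inner_fwd]

theorem inner_basis_succ_fwd (n : ℕ) (x : E) :
    ⟪basis E (n + 1), fwd x⟫_ℂ = ⟪basis E n, x⟫_ℂ := by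
  rw [← inner_basis_bwd, bwd_fwd]

theorem inner_basis_bwd_pow (n j : ℕ) (x : E) :
    ⟪basis E n, (bwd ^ j) x⟫_ℂ = ⟪basis E (n + j), x⟫_ℂ := by
  induction j generalizing n with
  | zero => simp
  | succ j ih =>
    rw [pow_succ', mul_apply_eq_comp, inner_basis_bwd, ih]
    congr 2
    ring

theorem inner_basis_basis (i j : ℕ) : ⟪basis E i, basis E j⟫_ℂ = if i = j then 1 else 0 := by
  induction i generalizing j with
  | zero =>
    cases j with
    | zero => rw [basis_zero, inner_one_one]; simp
    | succ j => simp [← fwd_basis, inner_one_fwd]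
  | succ i ih =>
    cases j with
    | zero => rw [← inner_basis_bwd, basis_zero, bwd_one, inner_zero_right]; simp
    | succ j => rw [← inner_basis_bwd, bwd_basis_succ, ih]; simp

theorem orthonormal_basis : Orthonormal ℂ (basis E) :=
  orthonormal_iff_ite.2 inner_basis_basis

theorem ext_basis {x y : E} (h : ∀ n, ⟪basis E n, x⟫_ℂ = ⟪basis E n, y⟫_ℂ) : x = y :=
  sub_eq_zero.1 (total _ fun n => by
    have := h n
    rw [basis] at this
    rw [inner_sub_right, this, sub_self])

/-- The antilinear rank-one operator `x ↦ ⟪x, a⟫ b`. -/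
def antiRankOne (a b : E) : E →L[ℝ] E :=
  LinearMap.mkContinuous
    { toFun := fun x => ⟪x, a⟫_ℂ • b
      map_add' := fun x y => by rw [inner_add_left, add_smul]
      map_smul' := fun c x => by
        rw [← Complex.coe_smul, inner_smul_left, mul_smul, Complex.conj_ofReal, Complex.coe_smul,
          RingHom.id_apply] }
    (‖a‖ * ‖b‖) fun x => by
      change ‖⟪x, a⟫_ℂ • b‖ ≤ _
      rw [norm_smul]
      have := norm_inner_le_norm (𝕜 := ℂ) x a
      calc _ ≤ ‖x‖ * ‖a‖ * ‖b‖ := by gcongr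
        _ = _ := by ring

variable (E) in
/-- The Hankel operator whose symbol is the monomial of degree `n`. -/
def flip (n : ℕ) : E →L[ℝ] E :=
  ∑ k ∈ Finset.range (n + 1), antiRankOne (basis E (n - k)) (basis E k)

theorem flip_apply (n : ℕ) (x : E) :
    flip E n x = ∑ k ∈ Finset.range (n + 1), ⟪x, basis E (n - k)⟫_ℂ • basis E k := by
  simp [flip, antiRankOne]

theorem norm_flip_le (n : ℕ) (x : E) : ‖flip E n x‖ ≤ ‖x‖ := by
  rw [← sq_le_sq₀ (norm_nonneg _) (norm_nonneg _), flip_apply]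
  have h : ‖∑ k ∈ Finset.range (n + 1), ⟪x, basis E (n - k)⟫_ℂ • basis E k‖ ^ 2 =
      ∑ k ∈ Finset.range (n + 1), ‖⟪basis E (n - k), x⟫_ℂ‖ ^ 2 := by
    rw [← ofReal_inj, ofReal_pow]
    have := orthonormal_basis.inner_sum (𝕜 := ℂ) (E := E)
      (fun k => ⟪x, basis E (n - k)⟫_ℂ) (fun k => ⟪x, basis E (n - k)⟫_ℂ) (Finset.range (n + 1))
    rw [inner_self_eq_norm_sq_to_K] at this
    refine this.trans ?_
    push_cast
    refine Finset.sum_congr rfl fun k _ => ?_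
    rw [Complex.conj_mul', norm_inner_symm]
  rw [h, ← Finset.sum_flip]
  have h2 := orthonormal_basis.sum_inner_products_le (𝕜 := ℂ) (E := E) x (s := Finset.range (n + 1))
  refine le_trans (le_of_eq (Finset.sum_congr rfl fun k hk => ?_)) h2
  rw [Nat.sub_sub_self (Nat.lt_succ_iff.1 (Finset.mem_range.1 hk))]

theorem flip_smul (n : ℕ) (c : ℂ) (x : E) : flip E n (c • x) = conj c • flip E n x := by
  simp only [flip_apply, inner_smul_left, mul_smul, Finset.smul_sum]

theorem inner_flip_symm (n : ℕ) (x y : E) : ⟪x, flip E n y⟫_ℂ = ⟪y, flip E n x⟫_ℂ := by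
  simp only [flip_apply, inner_sum, inner_smul_right]
  rw [← Finset.sum_flip]
  refine Finset.sum_congr rfl fun k hk => ?_
  rw [Nat.sub_sub_self (Nat.lt_succ_iff.1 (Finset.mem_range.1 hk)), mul_comm]

theorem bwd_flip_zero (x : E) : bwd (flip E 0 x) = 0 := by
  simp [flip_apply, bwd_smul, bwd_one]

theorem bwd_flip_succ (n : ℕ) (x : E) : bwd (flip E (n + 1) x) = flip E n x := by
  simp only [flip_apply, map_sum, bwd_smul]
  rw [Finset.sum_range_succ']
  simp [bwd_basis_succ, bwd_one]

theorem flip_fwd (n : ℕ) (x : E) : flip E n (fwd x) = bwd (flip E n x) := by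
  cases n with
  | zero =>
    rw [bwd_flip_zero]
    simp only [flip_apply, zero_add, Finset.range_one, Finset.sum_singleton]
    rw [inner_fwd, basis_zero, bwd_one]
    simp
  | succ n =>
    rw [bwd_flip_succ, flip_apply, flip_apply, Finset.sum_range_succ]
    have h : ⟪fwd x, basis E (n + 1 - (n + 1))⟫_ℂ = 0 := by
      simp [inner_fwd, bwd_one]
    rw [h, zero_smul, add_zero]
    refine Finset.sum_congr rfl fun k hk => ?_
    rw [Nat.sub_add_comm (Nat.lt_succ_iff.1 (Finset.mem_range.1 hk)), inner_fwd, bwd_basis_succ]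

theorem flip_one (n : ℕ) : flip E n one = basis E n := by
  rw [flip_apply, Finset.sum_range_succ, Finset.sum_eq_zero]
  · rw [Nat.sub_self, basis_zero, inner_one_one, one_smul, zero_add]
  · intro k hk
    rw [← basis_zero, inner_basis_basis, if_neg, zero_smul]
    have := Finset.mem_range.1 hk
    omega

variable [CompleteSpace E]

theorem norm_scalarMul_flip_le (n : ℕ) (c : ℂ) : ‖scalarMul (flip E n) c‖ ≤ ‖c‖ := by
  refine ContinuousLinearMap.opNorm_le_bound _ (norm_nonneg _) fun x => ?_
  simp only [scalarMul, LinearMap.coe_mk, AddHom.coe_mk, smul_apply, norm_smul]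
  gcongr
  exact norm_flip_le n x

variable (E) in
/-- The Hankel operator `H_u`. -/
def hank : Wiener →L[ℝ] (E →L[ℝ] E) :=
  synthesis (fun n => scalarMul (flip E n)) norm_scalarMul_flip_le

variable (E) in
/-- The shifted Hankel operator `K_u`. -/
def shank : Wiener →L[ℝ] (E →L[ℝ] E) := (ContinuousLinearMap.mul ℝ (E →L[ℝ] E) bwd).comp (hank E)

variable (E) in
/-- The analytic Toeplitz operator with symbol `u`. -/
def toep : Wiener →L[ℝ] (E →L[ℝ] E) := powerSeries fwd norm_fwd_le

variable (E) in
/-- The adjoint of the analytic Toeplitz operator with symbol `u`. -/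
def cotoep : Wiener →L[ℝ] (E →L[ℝ] E) := conjPowerSeries bwd norm_bwd_le

variable (E) in
/-- The element of the Hilbert space with the coefficients of `u`. -/
def embed : Wiener →L[ℝ] E := (ContinuousLinearMap.apply ℝ E one).comp (toep E)

variable (E) in
/-- The Toeplitz operator with symbol `|u|²`. -/
def toepSq (u : Wiener) : E →L[ℝ] E := cotoep E u * toep E u

theorem hasSum_hank (u : Wiener) (x : E) : HasSum (fun n => u n • flip E n x) (hank E u x) :=
  hasSum_apply (f := fun n => scalarMul (flip E n) (u n)) (hasSum_synthesis _ _ u) x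

theorem shank_apply (u : Wiener) (x : E) : shank E u x = bwd (hank E u x) := rfl

theorem embed_apply (u : Wiener) : embed E u = toep E u one := rfl

theorem toepSq_apply (u : Wiener) (x : E) : toepSq E u x = cotoep E u (toep E u x) := rfl

theorem hasSum_embed (u : Wiener) : HasSum (fun n => u n • basis E n) (embed E u) :=
  hasSum_powerSeries (hR := norm_fwd_le) u one

theorem norm_hank_le (u : Wiener) : ‖hank E u‖ ≤ ‖u‖ := norm_synthesis_le _ _ u

theorem norm_toep_le (u : Wiener) : ‖toep E u‖ ≤ ‖u‖ := norm_powerSeries_le u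

theorem norm_cotoep_le (u : Wiener) : ‖cotoep E u‖ ≤ ‖u‖ := norm_conjPowerSeries_le u

theorem norm_shank_le (u : Wiener) : ‖shank E u‖ ≤ ‖u‖ :=
  ContinuousLinearMap.opNorm_le_bound _ (norm_nonneg _) fun x =>
    (norm_bwd_le _).trans ((hank E u).le_of_opNorm_le (norm_hank_le u) x)

theorem hank_smul (u : Wiener) (c : ℂ) (x : E) : hank E u (c • x) = conj c • hank E u x := by
  refine (hasSum_hank u (c • x)).unique ?_
  simp only [flip_smul, smul_comm _ (conj c)]
  exact (hasSum_hank u x).const_smul _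

theorem shank_smul (u : Wiener) (c : ℂ) (x : E) : shank E u (c • x) = conj c • shank E u x := by
  rw [shank_apply, hank_smul, bwd_smul, shank_apply]

theorem toep_smul (u : Wiener) (c : ℂ) (x : E) : toep E u (c • x) = c • toep E u x :=
  powerSeries_smul fwd_smul u c x

theorem cotoep_smul (u : Wiener) (c : ℂ) (x : E) : cotoep E u (c • x) = c • cotoep E u x :=
  conjPowerSeries_smul bwd_smul u c x

theorem toepSq_smul (u : Wiener) (c : ℂ) (x : E) : toepSq E u (c • x) = c • toepSq E u x := by
  simp only [toepSq_apply, toep_smul, cotoep_smul]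

theorem inner_hank_symm (u : Wiener) (x y : E) : ⟪x, hank E u y⟫_ℂ = ⟪y, hank E u x⟫_ℂ := by
  refine ((innerSL ℂ x).hasSum (hasSum_hank u y)).unique ?_
  rw [← innerSL_apply_apply ℂ y]
  convert (innerSL ℂ y).hasSum (hasSum_hank u x) using 2 with n
  simp only [map_smul, innerSL_apply_apply, inner_flip_symm n x y]

theorem hank_fwd (u : Wiener) (x : E) : hank E u (fwd x) = bwd (hank E u x) := by
  refine (hasSum_hank u (fwd x)).unique ?_
  convert bwd.hasSum (hasSum_hank u x) using 2 with n
  rw [bwd_smul, flip_fwd]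

theorem hank_one (u : Wiener) : hank E u one = embed E u := by
  refine (hasSum_hank u one).unique ?_
  simp only [flip_one]
  exact hasSum_embed u

theorem shank_eq_hank_fwd (u : Wiener) (x : E) : shank E u x = hank E u (fwd x) :=
  (hank_fwd u x).symm

theorem inner_shank_symm (u : Wiener) (x y : E) : ⟪x, shank E u y⟫_ℂ = ⟪y, shank E u x⟫_ℂ := by
  rw [shank_apply, ← inner_fwd, inner_hank_symm, shank_eq_hank_fwd]

theorem bwd_shank (u : Wiener) (x : E) : bwd (shank E u x) = shank E u (fwd x) := by
  rw [shank_apply, shank_eq_hank_fwd, hank_fwd, hank_fwd]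

theorem inner_fwd_pow (n : ℕ) (x y : E) : ⟪(fwd ^ n) x, y⟫_ℂ = ⟪x, (bwd ^ n) y⟫_ℂ := by
  induction n generalizing y with
  | zero => simp
  | succ n ih =>
    rw [pow_succ', pow_succ, mul_apply_eq_comp, mul_apply_eq_comp, inner_fwd, ih]

theorem inner_toep (u : Wiener) (x y : E) : ⟪toep E u x, y⟫_ℂ = ⟪x, cotoep E u y⟫_ℂ := by
  have h1 := ((innerSL ℂ y).hasSum (hasSum_powerSeries (hR := norm_fwd_le) u x)).star
  have h2 := ((innerSL ℂ x).hasSum (hasSum_conjPowerSeries (hR := norm_bwd_le) u y))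
  have h3 : (fun n => star (innerSL ℂ y (u n • (fwd ^ n) x))) =
      fun n => innerSL ℂ x (conj (u n) • (bwd ^ n) y) := by
    funext n
    simp only [map_smul, innerSL_apply_apply, smul_eq_mul, star_mul', RCLike.star_def,
      inner_conj_symm, inner_fwd_pow]
  rw [h3] at h1
  rw [← inner_conj_symm]
  exact h1.unique h2

theorem inner_toepSq (u : Wiener) (x y : E) : ⟪toepSq E u x, y⟫_ℂ = ⟪x, toepSq E u y⟫_ℂ := by
  rw [toepSq_apply, toepSq_apply, ← inner_toep, ← inner_conj_symm, ← inner_toep, inner_conj_symm]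

theorem inner_basis_embed (u : Wiener) (n : ℕ) : ⟪basis E n, embed E u⟫_ℂ = u n := by
  have h := (innerSL ℂ (basis E n)).hasSum (hasSum_embed u)
  simp only [map_smul, innerSL_apply_apply, inner_basis_basis] at h
  refine h.unique ?_
  have h2 : (fun k => u k • (if n = k then (1 : ℂ) else 0)) = fun k => if k = n then u n else 0 := by
    funext k
    by_cases hk : k = n
    · simp [hk]
    · simp [hk, Ne.symm hk]
  rw [h2]
  exact hasSum_ite_eq n (u n)

theorem embed_smul (c : ℂ) (u : Wiener) : embed E (c • u) = c • embed E u :=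
  ext_basis fun n => by simp [inner_basis_embed]

theorem embed_mono (n : ℕ) : embed E (Wiener.mono n) = basis E n :=
  ext_basis fun k => by rw [inner_basis_embed, inner_basis_basis, Wiener.mono_apply]

theorem embed_shift (u : Wiener) : embed E (Wiener.shift u) = fwd (embed E u) :=
  ext_basis fun n => by
    cases n with
    | zero => rw [inner_basis_embed, basis_zero, inner_one_fwd, Wiener.shift_apply_zero]
    | succ n =>
      rw [inner_basis_embed, inner_basis_succ_fwd, inner_basis_embed, Wiener.shift_apply_succ]

theorem embed_backshift (u : Wiener) : embed E (Wiener.backshift u) = bwd (embed E u) :=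
  ext_basis fun n => by
    rw [inner_basis_embed, inner_basis_bwd, inner_basis_embed, Wiener.backshift_apply]

theorem embed_cubicTerm (u : Wiener) : embed E (Wiener.cubicTerm u) = toepSq E u (embed E u) := by
  rw [Wiener.cubicTerm, map_conjPowerSeries embed_smul embed_backshift,
    map_powerSeries embed_smul embed_shift]
  rfl

theorem toep_fwd (u : Wiener) (x : E) : toep E u (fwd x) = fwd (toep E u x) :=
  (map_powerSeries (X := fwd) fwd_smul (fun _ => rfl) u x).symm

theorem cotoep_bwd (u : Wiener) (x : E) : cotoep E u (bwd x) = bwd (cotoep E u x) :=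
  (map_conjPowerSeries (X := bwd) bwd_smul (fun _ => rfl) u x).symm

theorem hank_toep (u v : Wiener) (x : E) : hank E u (toep E v x) = cotoep E v (hank E u x) :=
  map_powerSeries_of_antilinear (hank_smul u) (hank_fwd u) v x

theorem hank_embed (u : Wiener) : hank E u (embed E u) = toepSq E u one := by
  rw [embed_apply, hank_toep, hank_one]
  rfl

theorem bwd_toepSq_fwd (u : Wiener) (x : E) : bwd (toepSq E u (fwd x)) = toepSq E u x := by
  rw [toepSq_apply, toep_fwd, ← cotoep_bwd, bwd_fwd, toepSq_apply]

theorem shank_embed (u : Wiener) : shank E u (embed E u) = bwd (toepSq E u one) := by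
  rw [shank_apply, hank_embed]

theorem toepSq_fwd (u : Wiener) (x : E) :
    toepSq E u (fwd x) = fwd (toepSq E u x) + ⟪shank E u (embed E u), x⟫_ℂ • one := by
  have h := fwd_bwd (toepSq E u (fwd x))
  rw [bwd_toepSq_fwd, ← inner_toepSq, ← inner_bwd, ← shank_embed] at h
  rw [h, sub_add_cancel]

theorem bwd_toepSq (u : Wiener) (x : E) :
    bwd (toepSq E u x) = toepSq E u (bwd x) + ⟪one, x⟫_ℂ • shank E u (embed E u) := by
  have h := bwd_toepSq_fwd u (bwd x)
  rw [fwd_bwd, map_sub, map_sub, toepSq_smul, bwd_smul, ← shank_embed] at h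
  rw [← h, sub_add_cancel]

theorem hank_eq (u : Wiener) (x : E) :
    hank E u x = fwd (shank E u x) + ⟪x, embed E u⟫_ℂ • one := by
  rw [shank_apply, fwd_bwd, inner_hank_symm, hank_one, sub_add_cancel]

theorem hank_hank (u : Wiener) (x : E) :
    hank E u (hank E u x) = shank E u (shank E u x) + ⟪embed E u, x⟫_ℂ • embed E u := by
  conv_lhs => rw [hank_eq u x]
  rw [map_add, ← shank_eq_hank_fwd, hank_smul, inner_conj_symm, hank_one]

theorem antilinear_ext {X Y : E →L[ℝ] E} (hX : ∀ (c : ℂ) x, X (c • x) = conj c • X x)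
    (hY : ∀ (c : ℂ) x, Y (c • x) = conj c • Y x) (hXs : ∀ x, X (fwd x) = bwd (X x))
    (hYs : ∀ x, Y (fwd x) = bwd (Y x)) (h : X one = Y one) : X = Y := by
  have h1 : ∀ n, X (basis E n) = Y (basis E n) := by
    intro n
    induction n with
    | zero => exact h
    | succ n ih => rw [← fwd_basis, hXs, hYs, ih]
  have h2 : ∀ x : E, HasSum (fun n => ⟪basis E n, x⟫_ℂ • basis E n) x := by
    intro x
    have hs : (Submodule.span ℂ (Set.range (basis E)))ᗮ = ⊥ := by
      rw [Submodule.eq_bot_iff]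
      exact fun y hy => total y fun n => hy _ (Submodule.subset_span ⟨n, rfl⟩)
    simpa [HilbertBasis.repr_apply_apply] using
      (HilbertBasis.mkOfOrthogonalEqBot orthonormal_basis hs).hasSum_repr x
  ext x
  refine (X.hasSum (h2 x)).unique ?_
  simp only [hX, h1, ← hY]
  exact Y.hasSum (h2 x)

theorem hank_cubicTerm (u : Wiener) : hank E (Wiener.cubicTerm u) =
    toepSq E u * hank E u + hank E u * toepSq E u - hank E u * (hank E u * hank E u) := by
  refine antilinear_ext (hank_smul _) (fun c x => ?_) (hank_fwd _) (fun x => ?_) ?_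
  · simp only [sub_apply, add_apply, mul_apply_eq_comp, hank_smul, toepSq_smul, smul_sub,
      smul_add, Complex.conj_conj]
  · simp only [sub_apply, add_apply, mul_apply_eq_comp, map_sub, map_add]
    rw [toepSq_fwd, map_add, hank_smul, hank_one, bwd_toepSq, inner_conj_symm, hank_fwd u x,
      ← shank_apply u x, hank_hank u (shank E u x), hank_fwd u (toepSq E u x),
      ← shank_apply u (hank E u (hank E u x)), hank_hank u x, map_add, shank_smul, inner_conj_symm,
      inner_shank_symm, inner_hank_symm, hank_one]
    abel
  · simp only [sub_apply, add_apply, mul_apply_eq_comp, hank_one, hank_embed, embed_cubicTerm]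
    abel

end ShiftSpace

end Szego

namespace Szego

open scoped InnerProductSpace

/-- The vector field of the `α`-Szegő equation on the Wiener space. -/
def szegoField (α : ℝ) (u : Wiener) : Wiener :=
  (-Complex.I) • (u.cubicTerm + ((α : ℂ) * u 0) • Wiener.mono 0)

theorem szegoField_apply (α : ℝ) (u : Wiener) (n : ℕ) :
    szegoField α u n = -Complex.I * (cubic u n + (α : ℂ) * u 0 * oneSeq n) := by
  simp only [szegoField, Wiener.smul_apply, Wiener.add_apply, Wiener.cubicTerm_apply,
    Wiener.mono_apply, oneSeq]

theorem norm_szegoField_le (α : ℝ) (u : Wiener) : ‖szegoField α u‖ ≤ ‖u‖ ^ 3 + |α| * ‖u‖ := by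
  rw [szegoField, norm_smul, norm_neg, Complex.norm_I, one_mul]
  refine (norm_add_le _ _).trans (add_le_add u.norm_cubicTerm_le ?_)
  rw [norm_smul, Wiener.norm_mono, mul_one, norm_mul, Complex.norm_real, Real.norm_eq_abs]
  gcongr
  exact u.norm_apply_le 0

theorem continuous_szegoField (α : ℝ) : Continuous (szegoField α) := by
  have h1 := Wiener.continuous_cubicTerm
  have h2 : Continuous fun u : Wiener => u 0 := (Wiener.coeff 0).continuous
  have h3 : Continuous fun u : Wiener => ((α : ℂ) * u 0) • Wiener.mono 0 :=
    (continuous_const.mul h2).smul continuous_const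
  exact (h1.add h3).const_smul (-Complex.I)

namespace ShiftSpace

variable {E : Type*} [NormedAddCommGroup E] [InnerProductSpace ℂ E] [CompleteSpace E]
  [ShiftSpace E]

theorem hank_smul_left (c : ℂ) (u : Wiener) (x : E) : hank E (c • u) x = c • hank E u x := by
  refine (hasSum_hank (c • u) x).unique ?_
  simp only [Wiener.smul_apply, mul_smul]
  exact (hasSum_hank u x).const_smul c

theorem shank_smul_left (c : ℂ) (u : Wiener) (x : E) : shank E (c • u) x = c • shank E u x := by
  rw [shank_apply, hank_smul_left, bwd_smul, shank_apply]

theorem hank_mono (n : ℕ) (x : E) : hank E (Wiener.mono n) x = flip E n x := by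
  refine (hasSum_hank _ x).unique ?_
  have h : (fun k => Wiener.mono n k • flip E k x) = fun k => if k = n then flip E n x else 0 := by
    funext k
    rw [Wiener.mono_apply]
    split_ifs with hk
    · rw [hk, one_smul]
    · rw [zero_smul]
  rw [h]
  exact hasSum_ite_eq n _

theorem shank_mono_zero (x : E) : shank E (Wiener.mono 0) x = 0 := by
  rw [shank_apply, hank_mono, bwd_flip_zero]

theorem shank_cubicTerm (u : Wiener) (x : E) : shank E u.cubicTerm x =
    toepSq E u (shank E u x) + shank E u (toepSq E u x) - shank E u (shank E u (shank E u x)) := by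
  rw [shank_apply, hank_cubicTerm]
  simp only [sub_apply, add_apply, mul_apply_eq_comp, map_sub, map_add]
  rw [bwd_toepSq, ← shank_apply, ← shank_apply, ← shank_apply, hank_hank, map_add, shank_smul,
    inner_conj_symm, inner_hank_symm, hank_one]
  abel

variable (E) in
/-- The skew-adjoint operator of the Lax pair for `K_u`. -/
def laxOp (u : Wiener) : E →L[ℝ] E :=
  (-Complex.I) • toepSq E u + (Complex.I / 2) • (shank E u * shank E u)

theorem laxOp_apply (u : Wiener) (x : E) : laxOp E u x =
    (-Complex.I) • toepSq E u x + (Complex.I / 2) • shank E u (shank E u x) := rfl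

theorem laxOp_smul (u : Wiener) (c : ℂ) (x : E) : laxOp E u (c • x) = c • laxOp E u x := by
  simp only [laxOp_apply, toepSq_smul, shank_smul, Complex.conj_conj, smul_add]
  rw [smul_comm _ c, smul_comm _ c]

theorem inner_shank_shank (u : Wiener) (x y : E) :
    ⟪shank E u (shank E u x), y⟫_ℂ = ⟪x, shank E u (shank E u y)⟫_ℂ := by
  rw [inner_shank_symm, ← inner_conj_symm, inner_shank_symm, inner_conj_symm]

theorem inner_laxOp (u : Wiener) (x y : E) : ⟪laxOp E u x, y⟫_ℂ = -⟪x, laxOp E u y⟫_ℂ := by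
  simp only [laxOp_apply, inner_add_left, inner_add_right, inner_smul_left, inner_smul_right,
    inner_toepSq, inner_shank_shank, map_neg, Complex.conj_I, map_div₀, map_ofNat]
  ring

theorem norm_toepSq_le (u : Wiener) : ‖toepSq E u‖ ≤ ‖u‖ ^ 2 := by
  rw [sq]
  exact (norm_mul_le _ _).trans (mul_le_mul (norm_cotoep_le u) (norm_toep_le u) (norm_nonneg _)
    (norm_nonneg _))

theorem norm_laxOp_le (u : Wiener) : ‖laxOp E u‖ ≤ 2 * ‖u‖ ^ 2 := by
  have h1 := norm_toepSq_le (E := E) u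
  have h2 : ‖shank E u * shank E u‖ ≤ ‖u‖ ^ 2 := by
    rw [sq]
    exact (norm_mul_le _ _).trans (mul_le_mul (norm_shank_le u) (norm_shank_le u) (norm_nonneg _)
      (norm_nonneg _))
  refine (norm_add_le _ _).trans ?_
  rw [norm_smul, norm_smul]
  simp only [norm_neg, Complex.norm_I, norm_div, one_mul, Complex.norm_ofNat]
  linarith [norm_nonneg (shank E u * shank E u)]

theorem continuous_laxOp : Continuous (laxOp E) := by
  unfold laxOp toepSq
  fun_prop

theorem shank_szegoField (α : ℝ) (u : Wiener) (x : E) : shank E (szegoField α u) x =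
    laxOp E u (shank E u x) - shank E u (laxOp E u x) := by
  rw [szegoField, shank_smul_left, map_add, add_apply, shank_smul_left, shank_mono_zero,
    shank_cubicTerm]
  simp only [laxOp_apply, map_add, shank_smul, map_neg, Complex.conj_I, map_div₀, map_ofNat]
  module

theorem embed_szegoField (α : ℝ) (u : Wiener) : embed E (szegoField α u) =
    (-Complex.I) • (toepSq E u (embed E u) + ((α : ℂ) * u 0) • one) := by
  rw [szegoField, embed_smul, map_add, embed_smul, embed_cubicTerm, embed_mono, basis_zero]

theorem bwd_laxOp {u : Wiener} {x : E} (h1 : ⟪one, x⟫_ℂ = 0) (h2 : ⟪embed E u, x⟫_ℂ = 0) :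
    bwd (laxOp E u x) = laxOp E u (bwd x) := by
  have h3 : bwd (shank E u (shank E u x)) = shank E u (shank E u (bwd x)) := by
    rw [shank_eq_hank_fwd u (bwd x), fwd_bwd, h1, zero_smul, sub_zero, bwd_shank]
    have h4 := hank_eq u x
    rw [← inner_conj_symm, h2, map_zero, zero_smul, add_zero] at h4
    rw [h4]
  rw [laxOp_apply, map_add, bwd_smul, bwd_smul, h3, bwd_toepSq, h1, zero_smul, add_zero,
    laxOp_apply]

theorem inner_one_embed (u : Wiener) : ⟪(one : E), embed E u⟫_ℂ = u 0 := inner_basis_embed u 0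

theorem toepSq_one (u : Wiener) : toepSq E u one =
    shank E u (shank E u one) + conj (u 0) • embed E u := by
  rw [← hank_embed, ← hank_one, hank_hank, hank_one, ← inner_conj_symm, inner_one_embed]

theorem laxOp_one (u : Wiener) : laxOp E u one =
    (-Complex.I * conj (u 0)) • embed E u - (Complex.I / 2) • shank E u (shank E u one) := by
  rw [laxOp_apply, toepSq_one]
  module

theorem szegoField_sub_laxOp (α : ℝ) (u : Wiener) :
    embed E (szegoField α u) - laxOp E u (embed E u) =
      (-Complex.I * (α * u 0)) • one - (Complex.I / 2) • shank E u (shank E u (embed E u)) := by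
  rw [embed_szegoField, laxOp_apply]
  module

end ShiftSpace

end Szego

namespace Szego

open scoped InnerProductSpace

theorem eq_of_hasDerivAt_zero {F : Type*} [NormedAddCommGroup F] [NormedSpace ℝ F] {f : ℝ → F}
    (hf : ∀ t, HasDerivAt f 0 t) (s t : ℝ) : f s = f t :=
  is_const_of_deriv_eq_zero (fun t => (hf t).differentiableAt) (fun t => (hf t).deriv) s t

namespace ShiftSpace

variable {E : Type*} [NormedAddCommGroup E] [InnerProductSpace ℂ E] [CompleteSpace E]
  [ShiftSpace E]

/-- `U` is the unitary propagator, with inverse `V`, of the Lax operator along the curve `c`,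
normalized at time `t₀`. -/
structure IsLaxFlow (c : ℝ → Wiener) (t₀ : ℝ) (U V : ℝ → E →L[ℝ] E) : Prop where
  init : U t₀ = 1
  hasDerivAt : ∀ t, HasDerivAt U (laxOp E (c t) * U t) t
  inv_mul : ∀ t, V t * U t = 1
  mul_inv : ∀ t, U t * V t = 1
  map_smul : ∀ t (a : ℂ) x, U t (a • x) = a • U t x

theorem exists_isLaxFlow {c : ℝ → Wiener} (hc : Continuous c) {B : ℝ} (hB : ∀ t, ‖c t‖ ≤ B)
    (t₀ : ℝ) : ∃ U V : ℝ → E →L[ℝ] E, IsLaxFlow c t₀ U V := by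
  set C : ℝ → E →L[ℝ] E := fun t => laxOp E (c t) with hC
  have hCc : Continuous C := continuous_laxOp.comp hc
  have hCb : ∀ t, ‖C t‖ ≤ 2 * B ^ 2 := fun t =>
    (norm_laxOp_le _).trans (by have := hB t; gcongr)
  let lm := ContinuousLinearMap.mul ℝ (E →L[ℝ] E)
  have hl : ∀ t, ‖lm (C t)‖ ≤ 2 * B ^ 2 := fun t =>
    (ContinuousLinearMap.opNorm_mul_apply_le ℝ _ (C t)).trans (hCb t)
  have hr : ∀ t, ‖lm.flip (C t)‖ ≤ 2 * B ^ 2 := fun t =>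
    ContinuousLinearMap.opNorm_le_bound _ ((norm_nonneg _).trans (hCb t)) fun X => by
      refine (norm_mul_le X (C t)).trans ?_
      rw [mul_comm]
      have := hCb t
      gcongr
  have hlc : Continuous fun t => lm (C t) := lm.continuous.comp hCc
  have hrc : Continuous fun t => lm.flip (C t) := lm.flip.continuous.comp hCc
  obtain ⟨U, hU0, hU⟩ := exists_linear_ode_solution hlc hl t₀ 1
  obtain ⟨V, hV0, hV⟩ := exists_linear_ode_solution (C := fun t => -lm.flip (C t)) hrc.neg
    (fun t => (norm_neg _).trans_le (hr t)) t₀ 1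
  have hVU : ∀ t, V t * U t = 1 := by
    intro t
    have h : ∀ t, HasDerivAt (fun t => V t * U t) 0 t := by
      intro t
      refine ((hV t).mul (hU t)).congr_deriv ?_
      change -(V t * C t) * U t + V t * (C t * U t) = 0
      noncomm_ring
    have := eq_of_hasDerivAt_zero h t t₀
    simpa [hU0, hV0] using this
  have hUV : ∀ t, U t * V t = 1 := by
    have h := linear_ode_solution_unique (C := fun t => lm (C t) - lm.flip (C t))
      (b := 2 * B ^ 2 + 2 * B ^ 2) (t₀ := t₀) (x := fun t => U t * V t) (y := fun _ => 1)
      (fun t => (norm_sub_le _ _).trans (add_le_add (hl t) (hr t)))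
      (fun t => by
        refine ((hU t).mul (hV t)).congr_deriv ?_
        change C t * U t * V t + U t * -(V t * C t) = C t * (U t * V t) - U t * V t * C t
        noncomm_ring)
      (fun t => by
        refine (hasDerivAt_const t (1 : E →L[ℝ] E)).congr_deriv ?_
        change 0 = C t * 1 - 1 * C t
        noncomm_ring)
      (by simp [hU0, hV0])
    exact fun t => congrFun h t
  have hI : ∀ t, U t * (Complex.I • (1 : E →L[ℝ] E)) = (Complex.I • (1 : E →L[ℝ] E)) * U t := by
    have h := linear_ode_solution_unique hl (t₀ := t₀)
      (x := fun t => U t * (Complex.I • (1 : E →L[ℝ] E)))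
      (y := fun t => (Complex.I • (1 : E →L[ℝ] E)) * U t)
      (fun t => by
        exact ((hU t).mul_const (Complex.I • (1 : E →L[ℝ] E))).congr_deriv (mul_assoc _ _ _))
      (fun t => by
        refine ((hU t).const_mul (Complex.I • (1 : E →L[ℝ] E))).congr_deriv ?_
        ext x
        exact (laxOp_smul _ _ _).symm)
      (by simp [hU0])
    exact fun t => congrFun h t
  refine ⟨U, V, hU0, hU, hVU, hUV, fun t a x => ?_⟩
  have h1 : U t (Complex.I • x) = Complex.I • U t x := congrArg (fun X => X x) (hI t)
  rw [← Complex.re_add_im a, add_smul, add_smul, map_add, mul_smul, mul_smul, Complex.coe_smul,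
    Complex.coe_smul, Complex.coe_smul, Complex.coe_smul, ContinuousLinearMap.map_smul,
    ContinuousLinearMap.map_smul, h1]

namespace IsLaxFlow

variable {c : ℝ → Wiener} {t₀ : ℝ} {U V : ℝ → E →L[ℝ] E} (h : IsLaxFlow c t₀ U V)

include h

theorem hasDerivAt_apply (t : ℝ) (x : E) :
    HasDerivAt (fun t => U t x) (laxOp E (c t) (U t x)) t := by
  simpa using (h.hasDerivAt t).clm_apply (hasDerivAt_const t x)

theorem inv_apply (t : ℝ) (x : E) : V t (U t x) = x := congrArg (fun X => X x) (h.inv_mul t)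

theorem apply_inv (t : ℝ) (x : E) : U t (V t x) = x := congrArg (fun X => X x) (h.mul_inv t)

theorem inner_apply (t : ℝ) (x y : E) : ⟪U t x, U t y⟫_ℂ = ⟪x, y⟫_ℂ := by
  have h1 : ∀ t, HasDerivAt (fun t => ⟪U t x, U t y⟫_ℂ) 0 t := by
    intro t
    refine ((h.hasDerivAt_apply t x).inner ℂ (h.hasDerivAt_apply t y)).congr_deriv ?_
    rw [inner_laxOp, add_neg_cancel]
  have := eq_of_hasDerivAt_zero h1 t t₀
  simpa [h.init] using this

theorem norm_apply (t : ℝ) (x : E) : ‖U t x‖ = ‖x‖ := by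
  have h1 := h.inner_apply t x x
  rw [inner_self_eq_norm_sq_to_K, inner_self_eq_norm_sq_to_K] at h1
  have h2 : ‖U t x‖ ^ 2 = ‖x‖ ^ 2 := by exact_mod_cast h1
  exact (sq_eq_sq₀ (norm_nonneg _) (norm_nonneg _)).1 h2

theorem norm_inv (t : ℝ) (x : E) : ‖V t x‖ = ‖x‖ := by
  rw [← h.norm_apply t, h.apply_inv]

theorem inv_smul (t : ℝ) (a : ℂ) (x : E) : V t (a • x) = a • V t x := by
  rw [← h.inv_apply t (a • V t x), h.map_smul, h.apply_inv]

end IsLaxFlow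

end ShiftSpace

end Szego

namespace Szego

open scoped InnerProductSpace

/-- The sequence model of the Hardy space, with its complex Hilbert space structure. -/
def HardyHilbert : Type := Hardy

namespace HardyHilbert

instance : NormedAddCommGroup HardyHilbert := inferInstanceAs (NormedAddCommGroup Hardy)

instance : InnerProductSpace ℂ HardyHilbert := inferInstanceAs (InnerProductSpace ℂ Hardy)

instance : CompleteSpace HardyHilbert := inferInstanceAs (CompleteSpace Hardy)

/-- The coefficients of an element of the Hardy space. -/
@[coe] def toFun (x : HardyHilbert) : ℕ → ℂ := fun n => (show Hardy from x) n

instance : CoeFun HardyHilbert (fun _ => ℕ → ℂ) := ⟨toFun⟩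

theorem ext {x y : HardyHilbert} (h : ∀ n, x n = y n) : x = y := lp.ext (funext h)

@[simp] theorem add_apply (x y : HardyHilbert) (n : ℕ) : (x + y) n = x n + y n := rfl

@[simp] theorem sub_apply (x y : HardyHilbert) (n : ℕ) : (x - y) n = x n - y n := rfl

@[simp] theorem zero_apply (n : ℕ) : (0 : HardyHilbert) n = 0 := rfl

@[simp] theorem smul_apply (c : ℂ) (x : HardyHilbert) (n : ℕ) : (c • x) n = c * x n := rfl

@[simp] theorem real_smul_apply (c : ℝ) (x : HardyHilbert) (n : ℕ) : (c • x) n = c * x n := rfl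

theorem memL2 (x : HardyHilbert) : MemL2 x := lp.memℓp (show Hardy from x)

theorem hasSum_inner (x y : HardyHilbert) : HasSum (fun n => y n * conj (x n)) ⟪x, y⟫_ℂ :=
  lp.hasSum_inner (𝕜 := ℂ) (show Hardy from x) (show Hardy from y)

theorem hasSum_norm_sq (x : HardyHilbert) : HasSum (fun n => ‖x n‖ ^ 2) (‖x‖ ^ 2) := by
  have h := lp.hasSum_norm (p := 2) (by simp) (show Hardy from x)
  simp only [ENNReal.toReal_ofNat, Real.rpow_ofNat] at h
  exact h

/-- The element of the Hardy space with given coefficients. -/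
def mk (f : ℕ → ℂ) (hf : Summable fun n => ‖f n‖ ^ 2) : HardyHilbert :=
  (⟨f, memℓp_gen (by simpa using hf)⟩ : Hardy)

@[simp] theorem mk_apply (f : ℕ → ℂ) (hf) (n : ℕ) : mk f hf n = f n := rfl

theorem hasSum_bwd (x : HardyHilbert) :
    HasSum (fun n => ‖x (n + 1)‖ ^ 2) (‖x‖ ^ 2 - ‖x 0‖ ^ 2) := by
  simpa using (hasSum_nat_add_iff' (f := fun n => ‖x n‖ ^ 2) 1).2 x.hasSum_norm_sq

theorem hasSum_fwd (x : HardyHilbert) :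
    HasSum (fun n => ‖(Nat.casesOn n 0 fun k => x k : ℂ)‖ ^ 2) (‖x‖ ^ 2) := by
  refine (hasSum_nat_add_iff' (f := fun n => ‖(Nat.casesOn n 0 fun k => x k : ℂ)‖ ^ 2) 1).1 ?_
  simpa using x.hasSum_norm_sq

theorem norm_mk_sq {f : ℕ → ℂ} {r : ℝ} (hf : HasSum (fun n => ‖f n‖ ^ 2) r) :
    ‖mk f hf.summable‖ ^ 2 = r :=
  (hasSum_norm_sq (mk f hf.summable)).unique hf

/-- The shift of coefficients, as a linear map. -/
def fwdₗ : HardyHilbert →ₗ[ℝ] HardyHilbert where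
  toFun x := mk _ x.hasSum_fwd.summable
  map_add' x y := ext fun n => by cases n <;> simp
  map_smul' c x := ext fun n => by cases n <;> simp

/-- The backward shift of coefficients, as a linear map. -/
def bwdₗ : HardyHilbert →ₗ[ℝ] HardyHilbert where
  toFun x := mk _ x.hasSum_bwd.summable
  map_add' x y := ext fun n => rfl
  map_smul' c x := ext fun n => rfl

theorem norm_fwdₗ_le (x : HardyHilbert) : ‖fwdₗ x‖ ≤ 1 * ‖x‖ := by
  rw [one_mul, ← sq_le_sq₀ (norm_nonneg _) (norm_nonneg _)]
  exact (norm_mk_sq x.hasSum_fwd).le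

theorem norm_bwdₗ_le (x : HardyHilbert) : ‖bwdₗ x‖ ≤ 1 * ‖x‖ := by
  rw [one_mul, ← sq_le_sq₀ (norm_nonneg _) (norm_nonneg _)]
  refine (norm_mk_sq x.hasSum_bwd).le.trans ?_
  linarith [sq_nonneg ‖x 0‖]

/-- The shift of coefficients. -/
def fwd : HardyHilbert →L[ℝ] HardyHilbert := fwdₗ.mkContinuous 1 norm_fwdₗ_le

/-- The backward shift of coefficients. -/
def bwd : HardyHilbert →L[ℝ] HardyHilbert := bwdₗ.mkContinuous 1 norm_bwdₗ_le

@[simp] theorem fwd_apply_zero (x : HardyHilbert) : fwd x 0 = 0 := rfl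

@[simp] theorem fwd_apply_succ (x : HardyHilbert) (n : ℕ) : fwd x (n + 1) = x n := rfl

@[simp] theorem bwd_apply (x : HardyHilbert) (n : ℕ) : bwd x n = x (n + 1) := rfl

/-- The constant function `1`. -/
def one : HardyHilbert := (lp.single 2 0 1 : Hardy)

theorem one_apply (n : ℕ) : one n = if n = 0 then 1 else 0 := by
  have := lp.single_apply (E := fun _ : ℕ => ℂ) 2 0 1 n
  simp only [Pi.single_apply] at this
  exact this

theorem inner_one (x : HardyHilbert) : ⟪one, x⟫_ℂ = x 0 := by
  refine (hasSum_inner one x).unique ?_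
  have h : (fun n => x n * conj (one n)) = fun n => if n = 0 then x 0 else 0 := by
    funext n
    rw [one_apply]
    split_ifs with hn <;> simp [hn]
  rw [h]
  exact hasSum_ite_eq 0 _

theorem inner_bwd (x y : HardyHilbert) : ⟪bwd x, y⟫_ℂ = ⟪x, fwd y⟫_ℂ := by
  refine (hasSum_inner _ _).unique ?_
  simpa using (hasSum_nat_add_iff' (f := fun n => fwd y n * conj (x n)) 1).2 (hasSum_inner x (fwd y))

theorem inner_fwd_pow_one (n : ℕ) (x : HardyHilbert) : ⟪(fwd ^ n) one, x⟫_ℂ = x n := by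
  induction n generalizing x with
  | zero => exact inner_one x
  | succ n ih =>
    rw [pow_succ', mul_apply_eq_comp, ← inner_conj_symm, ← inner_bwd, inner_conj_symm, ih, bwd_apply]

instance : ShiftSpace HardyHilbert where
  fwd := fwd
  bwd := bwd
  one := one
  fwd_smul c x := ext fun n => by cases n <;> simp
  bwd_smul c x := rfl
  inner_bwd := inner_bwd
  bwd_fwd x := rfl
  fwd_bwd x := ext fun n => by cases n <;> simp [one_apply, inner_one]
  norm_one := (lp.norm_single (E := fun _ : ℕ => ℂ) (p := 2) (by simp) 0 1).trans (by simp)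
  total x h := ext fun n => by rw [← inner_fwd_pow_one, h]; rfl

theorem inner_basis (n : ℕ) (x : HardyHilbert) : ⟪ShiftSpace.basis HardyHilbert n, x⟫_ℂ = x n :=
  inner_fwd_pow_one n x

theorem embed_apply (u : Wiener) (n : ℕ) : ShiftSpace.embed HardyHilbert u n = u n := by
  rw [← inner_basis, ShiftSpace.inner_basis_embed]

end HardyHilbert

namespace ShiftSpace

variable {E : Type*} [NormedAddCommGroup E] [InnerProductSpace ℂ E] [CompleteSpace E]
  [ShiftSpace E]

theorem hank_basis (u : Wiener) (n : ℕ) : hank E u (basis E n) = (bwd ^ n) (embed E u) := by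
  induction n with
  | zero => exact hank_one u
  | succ n ih => rw [← fwd_basis, hank_fwd, ih, pow_succ', mul_apply_eq_comp]

theorem shank_basis (u : Wiener) (n : ℕ) :
    shank E u (basis E n) = (bwd ^ (n + 1)) (embed E u) := by
  rw [shank_eq_hank_fwd, fwd_basis, hank_basis]

theorem inner_basis_shank_basis (u : Wiener) (i j : ℕ) :
    ⟪basis E i, shank E u (basis E j)⟫_ℂ = u (i + j + 1) := by
  rw [shank_basis, inner_basis_bwd_pow, inner_basis_embed, add_assoc]

end ShiftSpace

theorem HardyHilbert.shank_apply (u : Wiener) (x : HardyHilbert) (k : ℕ) :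
    ShiftSpace.shank HardyHilbert u x k = khankel u x k := by
  rw [← inner_basis, ShiftSpace.inner_shank_symm, ShiftSpace.shank_basis, khankel,
    ← (hasSum_inner _ _).tsum_eq]
  congr 1
  funext n
  rw [← inner_basis, ShiftSpace.inner_basis_bwd_pow, ShiftSpace.inner_basis_embed, add_comm n]

end Szego

namespace Szego

open scoped InnerProductSpace

section Baire

/-- A function which, on every interval where it is bounded, is controlled by the value of another
function at any point of the interval, is locally bounded if the latter has closed sublevels. -/
theorem le_of_forall_bounded_interval {f g : ℝ → ℝ} (hg : ∀ m : ℝ, IsClosed {t | g t ≤ m})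
    (h : ∀ a b B, (∀ τ ∈ Set.uIcc a b, f τ ≤ B) → f b ≤ 3 * g a) (s t : ℝ) : f t ≤ 3 * g s := by
  set O : Set ℝ := {t | ∃ B, ∀ᶠ τ in 𝓝 t, f τ ≤ B} with hO
  have hOo : IsOpen O := by
    rw [isOpen_iff_mem_nhds]
    rintro t ⟨B, hB⟩
    filter_upwards [eventually_eventually_nhds.2 hB] with τ hτ using ⟨B, hτ⟩
  have hbdd : ∀ a b, Set.uIcc a b ⊆ O → ∃ B, ∀ τ ∈ Set.uIcc a b, f τ ≤ B := by
    intro a b hab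
    refine isCompact_uIcc.induction_on (p := fun s => ∃ B, ∀ τ ∈ s, f τ ≤ B) ⟨0, by simp⟩ ?_ ?_ ?_
    · rintro s t hst ⟨B, hB⟩
      exact ⟨B, fun τ hτ => hB τ (hst hτ)⟩
    · rintro s t ⟨B, hB⟩ ⟨B', hB'⟩
      refine ⟨max B B', fun τ hτ => ?_⟩
      rcases hτ with hτ | hτ
      · exact le_max_of_le_left (hB τ hτ)
      · exact le_max_of_le_right (hB' τ hτ)
    · intro x hx
      obtain ⟨B, hB⟩ := hab hx
      exact ⟨_, mem_nhdsWithin_of_mem_nhds hB, B, fun τ hτ => hτ⟩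
  have hend : ∀ a b, (∀ τ ∈ Set.uIcc a b, τ ≠ a → τ ∈ O) → f b ≤ 3 * g a := by
    intro a b hab
    refine h a b (max (3 * g b) (f a)) fun τ hτ => ?_
    by_cases hτa : τ = a
    · exact hτa ▸ le_max_right _ _
    refine le_max_of_le_left ?_
    obtain ⟨B, hB⟩ := hbdd b τ fun σ hσ => by
      refine hab σ (Set.uIcc_subset_uIcc Set.right_mem_uIcc hτ hσ) ?_
      rintro rfl
      rw [Set.mem_uIcc] at hσ hτ
      rcases hσ with hσ | hσ <;> rcases hτ with hτ | hτ <;>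
        exact hτa (by linarith [hσ.1, hσ.2, hτ.1, hτ.2])
    exact h b τ B hB
  have hOu : O = Set.univ := by
    by_contra hne
    have hF : Oᶜ.Nonempty := Set.nonempty_compl.2 hne
    have : Nonempty ↥Oᶜ := hF.to_subtype
    have : CompleteSpace ↥Oᶜ := hOo.isClosed_compl.completeSpace_coe
    obtain ⟨m, x, hx⟩ := nonempty_interior_of_iUnion_of_closed
      (f := fun m : ℕ => {t : ↥Oᶜ | g t ≤ m}) (fun m => (hg m).preimage continuous_subtype_val) (by
        rw [Set.eq_univ_iff_forall]
        exact fun t => Set.mem_iUnion.2 (exists_nat_ge (g t)))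
    rw [mem_interior_iff_mem_nhds, Metric.mem_nhds_iff] at hx
    obtain ⟨ε, hε, hball⟩ := hx
    refine x.2 ⟨3 * m, ?_⟩
    filter_upwards [Metric.ball_mem_nhds (x : ℝ) hε] with t ht
    have hc : IsCompact (Oᶜ ∩ Set.uIcc (x : ℝ) t) := isCompact_uIcc.inter_left hOo.isClosed_compl
    obtain ⟨a, ha, hmin⟩ := hc.exists_isMinOn ⟨x, x.2, Set.left_mem_uIcc⟩
      (f := fun τ => dist τ t) (by fun_prop)
    have hab : a ∈ Metric.ball (x : ℝ) ε := by
      have := Set.uIcc_subset_uIcc_left ha.2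
      rw [Metric.mem_ball, Real.dist_eq] at ht ⊢
      rw [abs_sub_comm] at ht ⊢
      refine lt_of_le_of_lt ?_ ht
      rw [abs_sub_comm, abs_sub_comm (x : ℝ)]
      exact Set.abs_sub_left_of_mem_uIcc ha.2
    have hga : g a ≤ m := @hball ⟨a, ha.1⟩ hab
    refine (hend a t fun τ hτ hτa => ?_).trans (by linarith)
    by_contra hτO
    have h1 := hmin (⟨hτO, Set.uIcc_subset_uIcc_right ha.2 hτ⟩ : τ ∈ Oᶜ ∩ Set.uIcc (x : ℝ) t)
    simp only [Set.mem_ofPred_eq, Real.dist_eq] at h1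
    rw [Set.mem_uIcc] at hτ
    rcases hτ with hτ | hτ
    · rw [abs_of_nonpos (by linarith [hτ.1, hτ.2]), abs_of_nonpos (by linarith [hτ.1, hτ.2])] at h1
      exact hτa (le_antisymm (by linarith) hτ.1)
    · rw [abs_of_nonneg (by linarith [hτ.1, hτ.2]), abs_of_nonneg (by linarith [hτ.1, hτ.2])] at h1
      exact hτa (le_antisymm hτ.2 (by linarith))
  obtain ⟨B, hB⟩ := hbdd s t (by rw [hOu]; exact Set.subset_univ _)
  exact h s t B hB

end Baire

namespace Wiener

/-- Truncation to degree less than `m`. -/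
def trunc (m : ℕ) (u : Wiener) : Wiener := ∑ n ∈ Finset.range m, u n • mono n

theorem tendsto_trunc (u : Wiener) : Tendsto (fun m => trunc m u) atTop (𝓝 u) :=
  u.hasSum_mono.tendsto_sum_nat

theorem norm_trunc_le (m : ℕ) (u : Wiener) : ‖trunc m u‖ ≤ ‖u‖ := by
  refine (norm_sum_le _ _).trans ?_
  simp only [norm_smul, norm_mono, mul_one]
  rw [norm_eq]
  exact u.summable_norm.sum_le_tsum _ fun _ _ => norm_nonneg _

theorem trunc_sub (m : ℕ) (u v : Wiener) : trunc m (u - v) = trunc m u - trunc m v := by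
  simp [trunc, sub_smul]

end Wiener

/-- A curve of rapidly decreasing coefficient sequences solving the `α`-Szegő equation
coefficientwise. -/
structure IsCoeffSolution (α : ℝ) (w : ℝ → Wiener) : Prop where
  hasDerivAt : ∀ n t, HasDerivAt (fun τ => w τ n) (szegoField α (w t) n) t
  summable : ∀ t, Summable fun n : ℕ => (n + 1 : ℝ) * ‖w t n‖

namespace IsCoeffSolution

variable {α : ℝ} {w : ℝ → Wiener} (h : IsCoeffSolution α w)

include h

theorem hasDerivAt_trunc (m : ℕ) (t : ℝ) :
    HasDerivAt (fun τ => (w τ).trunc m) ((szegoField α (w t)).trunc m) t :=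
  HasDerivAt.fun_sum fun n _ => (h.hasDerivAt n t).smul_const (Wiener.mono n)

theorem norm_sub_le {a b B : ℝ} (hB : ∀ τ ∈ Set.Icc a b, ‖w τ‖ ≤ B) {s t : ℝ}
    (hs : s ∈ Set.Icc a b) (ht : t ∈ Set.Icc a b) :
    ‖w t - w s‖ ≤ (B ^ 3 + |α| * B) * ‖t - s‖ := by
  refine le_of_tendsto (Wiener.tendsto_trunc (w t - w s)).norm (Eventually.of_forall fun m => ?_)
  rw [Wiener.trunc_sub]
  refine (convex_Icc a b).norm_image_sub_le_of_norm_hasDerivWithin_le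
    (fun τ _ => (h.hasDerivAt_trunc m τ).hasDerivWithinAt) (fun τ hτ => ?_) hs ht
  refine (Wiener.norm_trunc_le _ _).trans ((norm_szegoField_le _ _).trans ?_)
  have := hB τ hτ
  gcongr

theorem exists_hasDerivAt {a b B : ℝ} (hab : a ≤ b) (hB : ∀ τ ∈ Set.Icc a b, ‖w τ‖ ≤ B) :
    ∃ c v : ℝ → Wiener, Continuous c ∧ (∀ t, ‖c t‖ ≤ B) ∧ Set.EqOn c w (Set.Icc a b) ∧
      Set.EqOn v w (Set.Icc a b) ∧ ∀ t, HasDerivAt v (szegoField α (c t)) t := by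
  have hcont : ContinuousOn w (Set.Icc a b) := by
    have hL : LipschitzOnWith (Real.toNNReal (B ^ 3 + |α| * B)) w (Set.Icc a b) :=
      LipschitzOnWith.of_dist_le_mul fun t ht s hs => by
        rw [dist_eq_norm, dist_eq_norm]
        refine (h.norm_sub_le hB hs ht).trans ?_
        gcongr
        exact Real.le_coe_toNNReal _
    exact hL.continuousOn
  let c : ℝ → Wiener := fun t => w (Set.projIcc a b hab t)
  have hc : Continuous c := hcont.comp_continuous (by fun_prop) fun t => (Set.projIcc a b hab t).2
  have hcw : Set.EqOn c w (Set.Icc a b) := fun t ht => by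
    simp only [c, Set.projIcc_of_mem hab ht]
  have hF : Continuous fun t => szegoField α (c t) := (continuous_szegoField α).comp hc
  let v : ℝ → Wiener := fun t => w a + ∫ σ in a..t, szegoField α (c σ)
  have hv : ∀ t, HasDerivAt v (szegoField α (c t)) t := fun t =>
    (intervalIntegral.integral_hasDerivAt_right (hF.intervalIntegrable _ _)
      (hF.stronglyMeasurableAtFilter _ _) hF.continuousAt).const_add (w a)
  refine ⟨c, v, hc, fun t => hB _ (Set.projIcc a b hab t).2, hcw, fun t ht => ?_, hv⟩
  refine Wiener.ext fun n => ?_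
  have hd : ∀ τ, HasDerivAt (fun τ => v τ n - w τ n)
      (szegoField α (c τ) n - szegoField α (w τ) n) τ := fun τ =>
    (((Wiener.coeff n).restrictScalars ℝ).hasFDerivAt.comp_hasDerivAt τ (hv τ)).sub
      (h.hasDerivAt n τ)
  have := constant_of_has_deriv_right_zero (f := fun τ => v τ n - w τ n) (a := a) (b := b)
    (fun τ _ => (hd τ).continuousAt.continuousWithinAt) (fun τ hτ => by
      have := hd τ
      rw [hcw (Set.Ico_subset_Icc_self hτ), sub_self] at this
      exact this.hasDerivWithinAt) t ht
  have hva : v a = w a := by simp [v]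
  rw [hva, sub_self] at this
  exact sub_eq_zero.1 this

end IsCoeffSolution

namespace ShiftSpace

variable {E : Type*} [NormedAddCommGroup E] [InnerProductSpace ℂ E] [CompleteSpace E]
  [ShiftSpace E]

theorem sum_norm_inner_flip_le {f g : ℕ → E} (hf : Orthonormal ℂ f) (hg : Orthonormal ℂ g) (n : ℕ)
    (s : Finset ℕ) : ∑ i ∈ s, ‖⟪f i, flip E n (g i)⟫_ℂ‖ ≤ n + 1 := by
  have h1 : ∀ i ∈ s, ‖⟪f i, flip E n (g i)⟫_ℂ‖ ≤ ∑ k ∈ Finset.range (n + 1),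
      (‖⟪g i, basis E (n - k)⟫_ℂ‖ ^ 2 / 2 + ‖⟪f i, basis E k⟫_ℂ‖ ^ 2 / 2) := by
    intro i _
    rw [flip_apply, inner_sum]
    refine (norm_sum_le _ _).trans (Finset.sum_le_sum fun k _ => ?_)
    rw [inner_smul_right, norm_mul]
    nlinarith [sq_nonneg (‖⟪g i, basis E (n - k)⟫_ℂ‖ - ‖⟪f i, basis E k⟫_ℂ‖)]
  refine (Finset.sum_le_sum h1).trans ?_
  rw [Finset.sum_comm]
  have h2 : ∀ k ∈ Finset.range (n + 1), ∑ i ∈ s,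
      (‖⟪g i, basis E (n - k)⟫_ℂ‖ ^ 2 / 2 + ‖⟪f i, basis E k⟫_ℂ‖ ^ 2 / 2) ≤ 1 := by
    intro k _
    rw [Finset.sum_add_distrib, ← Finset.sum_div, ← Finset.sum_div]
    have h3 := hg.sum_inner_products_le (basis E (n - k)) (s := s)
    have h4 := hf.sum_inner_products_le (basis E k) (s := s)
    rw [(orthonormal_basis (E := E)).1] at h3 h4
    linarith
  refine (Finset.sum_le_sum h2).trans ?_
  simp

theorem sum_norm_inner_hank_le {f g : ℕ → E} (hf : Orthonormal ℂ f) (hg : Orthonormal ℂ g)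
    {u : Wiener} (hu : Summable fun n : ℕ => (n + 1 : ℝ) * ‖u n‖) (s : Finset ℕ) :
    ∑ i ∈ s, ‖⟪f i, hank E u (g i)⟫_ℂ‖ ≤ ∑' n : ℕ, (n + 1 : ℝ) * ‖u n‖ := by
  have h0 : ∀ i, HasSum (fun n => u n * ⟪f i, flip E n (g i)⟫_ℂ) ⟪f i, hank E u (g i)⟫_ℂ := by
    intro i
    have := (innerSL ℂ (f i)).hasSum (hasSum_hank u (g i))
    simpa only [map_smul, innerSL_apply_apply, smul_eq_mul] using this
  have hs : ∀ i, Summable fun n => ‖u n‖ * ‖⟪f i, flip E n (g i)⟫_ℂ‖ := by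
    intro i
    refine Summable.of_nonneg_of_le (fun _ => by positivity) (fun n => ?_) u.summable_norm
    refine mul_le_of_le_one_right (norm_nonneg _) ((norm_inner_le_norm _ _).trans ?_)
    rw [hf.1, one_mul]
    exact (norm_flip_le n _).trans (hg.1 i).le
  have h1 : ∀ i ∈ s, ‖⟪f i, hank E u (g i)⟫_ℂ‖ ≤
      ∑' n, ‖u n‖ * ‖⟪f i, flip E n (g i)⟫_ℂ‖ := by
    intro i _
    rw [← (h0 i).tsum_eq]
    refine (norm_tsum_le_tsum_norm ?_).trans (by simp only [norm_mul]; rfl)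
    simpa only [norm_mul] using hs i
  refine (Finset.sum_le_sum h1).trans ?_
  rw [← Summable.tsum_finsetSum fun i _ => hs i]
  refine Summable.tsum_le_tsum (fun n => ?_) (summable_sum fun i _ => hs i) hu
  rw [← Finset.mul_sum, mul_comm]
  exact mul_le_mul_of_nonneg_right (sum_norm_inner_flip_le hf hg n s) (norm_nonneg _)

theorem orthonormal_fwd {f : ℕ → E} (hf : Orthonormal ℂ f) : Orthonormal ℂ fun i => fwd (f i) := by
  refine ⟨fun i => (norm_fwd _).trans (hf.1 i), fun i j hij => ?_⟩
  change ⟪fwd (f i), fwd (f j)⟫_ℂ = 0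
  rw [inner_fwd, bwd_fwd]
  exact hf.2 hij

theorem sum_norm_inner_shank_le {f g : ℕ → E} (hf : Orthonormal ℂ f) (hg : Orthonormal ℂ g)
    {u : Wiener} (hu : Summable fun n : ℕ => (n + 1 : ℝ) * ‖u n‖) (s : Finset ℕ) :
    ∑ i ∈ s, ‖⟪f i, shank E u (g i)⟫_ℂ‖ ≤ ∑' n : ℕ, (n + 1 : ℝ) * ‖u n‖ := by
  refine le_trans (le_of_eq (Finset.sum_congr rfl fun i _ => ?_))
    (sum_norm_inner_hank_le (orthonormal_fwd hf) hg hu s)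
  rw [shank_apply, inner_fwd]

theorem hasDerivAt_inner_shank {c v : ℝ → Wiener} {t₀ : ℝ} {U V : ℝ → E →L[ℝ] E}
    (hU : IsLaxFlow c t₀ U V) {α t : ℝ} (hct : c t = v t)
    (hv : HasDerivAt v (szegoField α (v t)) t) (x y : E) :
    HasDerivAt (fun t => ⟪U t x, shank E (v t) (U t y)⟫_ℂ) 0 t := by
  have h1 := hU.hasDerivAt_apply t x
  have h2 := ((shank E).hasFDerivAt.comp_hasDerivAt t hv).clm_apply (hU.hasDerivAt_apply t y)
  refine (h1.inner ℂ h2).congr_deriv ?_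
  simp only [Function.comp_apply]
  rw [hct, shank_szegoField, sub_add_cancel, inner_laxOp, add_neg_cancel]

theorem re_inner_embed_szegoField (α : ℝ) (u : Wiener) :
    ⟪embed E u, embed E (szegoField α u)⟫_ℂ + ⟪embed E (szegoField α u), embed E u⟫_ℂ = 0 := by
  rw [embed_szegoField]
  simp only [inner_smul_left, inner_smul_right, inner_add_left, inner_add_right, inner_toepSq,
    inner_one_embed, map_neg, Complex.conj_I, map_mul, Complex.conj_ofReal]
  rw [← inner_conj_symm (embed E u) one, inner_one_embed]
  ring

theorem hasDerivAt_inner_embed {v : ℝ → Wiener} {α t : ℝ}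
    (hv : HasDerivAt v (szegoField α (v t)) t) :
    HasDerivAt (fun t => ⟪embed E (v t), embed E (v t)⟫_ℂ) 0 t := by
  have h1 := (embed E).hasFDerivAt.comp_hasDerivAt t hv
  exact (h1.inner ℂ h1).congr_deriv (re_inner_embed_szegoField α _)

theorem norm_embed_le (u : Wiener) : ‖embed E u‖ ≤ ‖u‖ := by
  have := (toep E u).le_of_opNorm_le (norm_toep_le u) one
  rwa [norm_one, mul_one] at this

theorem norm_coeff_le_norm_embed (u : Wiener) (n : ℕ) : ‖u n‖ ≤ ‖embed E u‖ := by
  rw [← inner_basis_embed (E := E) u n]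
  refine (norm_inner_le_norm _ _).trans ?_
  rw [(orthonormal_basis (E := E)).1, one_mul]

end ShiftSpace

open ShiftSpace

namespace IsCoeffSolution

variable {α : ℝ} {w : ℝ → Wiener} (h : IsCoeffSolution α w)

include h

theorem norm_le_of_bounded {a b B : ℝ} (hB : ∀ τ ∈ Set.Icc a b, ‖w τ‖ ≤ B) {s t : ℝ}
    (hs : s ∈ Set.Icc a b) (ht : t ∈ Set.Icc a b) :
    ‖w t‖ ≤ 3 * ∑' n : ℕ, (n + 1 : ℝ) * ‖w s n‖ := by
  obtain ⟨c, v, hc, hcB, hcw, hvw, hv⟩ := h.exists_hasDerivAt (hs.1.trans hs.2) hB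
  obtain ⟨U, V, hU⟩ := exists_isLaxFlow (E := HardyHilbert) hc hcB t
  have hcv : ∀ τ ∈ Set.Icc a b, c τ = v τ := fun τ hτ => (hcw hτ).trans (hvw hτ).symm
  have hv' : ∀ τ ∈ Set.Icc a b, HasDerivAt v (szegoField α (v τ)) τ := fun τ hτ =>
    hcv τ hτ ▸ hv τ
  have hconst : ∀ φ : ℝ → ℂ, (∀ τ ∈ Set.Icc a b, HasDerivAt φ 0 τ) → φ t = φ s := by
    intro φ hφ
    have := constant_of_has_deriv_right_zero (f := φ) (a := a) (b := b)
      (fun τ hτ => (hφ τ hτ).continuousAt.continuousWithinAt)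
      (fun τ hτ => (hφ τ (Set.Ico_subset_Icc_self hτ)).hasDerivWithinAt)
    rw [this t ht, this s hs]
  have hK : ∀ x y, ⟪x, shank HardyHilbert (w t) y⟫_ℂ =
      ⟪U s x, shank HardyHilbert (w s) (U s y)⟫_ℂ := by
    intro x y
    have := hconst _ fun τ hτ => hasDerivAt_inner_shank hU (hcv τ hτ) (hv' τ hτ) x y
    rw [hU.init, hvw ht, hvw hs] at this
    exact this
  have hE : ‖embed HardyHilbert (w t)‖ = ‖embed HardyHilbert (w s)‖ := by
    have := hconst _ fun τ hτ => hasDerivAt_inner_embed (E := HardyHilbert) (hv' τ hτ)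
    rw [hvw ht, hvw hs, inner_self_eq_norm_sq_to_K, inner_self_eq_norm_sq_to_K] at this
    have h2 : ‖embed HardyHilbert (w t)‖ ^ 2 = ‖embed HardyHilbert (w s)‖ ^ 2 := by
      exact_mod_cast this
    exact (sq_eq_sq₀ (norm_nonneg _) (norm_nonneg _)).1 h2
  have hortho : ∀ k, Orthonormal ℂ fun i => U s (basis HardyHilbert (i + k)) := by
    intro k
    refine orthonormal_iff_ite.2 fun i j => ?_
    rw [hU.inner_apply, inner_basis_basis]
    simp
  set S := ∑' n : ℕ, (n + 1 : ℝ) * ‖w s n‖ with hS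
  have h0 : ‖w t 0‖ ≤ S := by
    refine (norm_coeff_le_norm_embed (E := HardyHilbert) _ _).trans ?_
    rw [hE]
    refine (norm_embed_le _).trans ?_
    rw [Wiener.norm_eq]
    refine Summable.tsum_le_tsum (fun n => ?_) (Wiener.summable_norm _) (h.summable s)
    have := norm_nonneg (w s n)
    have hn : (0 : ℝ) ≤ n := n.cast_nonneg
    nlinarith
  have hsum : ∀ k m, ∑ i ∈ Finset.range m, ‖w t (2 * i + k + 1)‖ ≤ S := by
    intro k m
    refine le_trans (le_of_eq (Finset.sum_congr rfl fun i _ => ?_))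
      (sum_norm_inner_shank_le (hortho k) (hortho 0) (h.summable s) (Finset.range m))
    rw [← hK, inner_basis_shank_basis]
    congr 2
    ring
  have hsplit : ∀ m, ∑ n ∈ Finset.range (2 * m + 1), ‖w t n‖ = ‖w t 0‖ +
      ∑ i ∈ Finset.range m, ‖w t (2 * i + 0 + 1)‖ + ∑ i ∈ Finset.range m, ‖w t (2 * i + 1 + 1)‖ := by
    intro m
    induction m with
    | zero => simp
    | succ m ih =>
      rw [show 2 * (m + 1) + 1 = 2 * m + 1 + 1 + 1 by ring, Finset.sum_range_succ,
        Finset.sum_range_succ, ih, Finset.sum_range_succ, Finset.sum_range_succ]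
      simp only [add_zero]
      ring
  rw [Wiener.norm_eq]
  refine (Wiener.summable_norm _).tsum_le_of_sum_range_le fun m => ?_
  have h1 : ∑ n ∈ Finset.range m, ‖w t n‖ ≤ ∑ n ∈ Finset.range (2 * m + 1), ‖w t n‖ :=
    Finset.sum_le_sum_of_subset_of_nonneg (Finset.range_mono (by omega)) fun _ _ _ => norm_nonneg _
  have h2 := hsplit m
  have h3 := hsum 0 m
  have h4 := hsum 1 m
  linarith

theorem isClosed_sublevel (m : ℝ) : IsClosed {t | ∑' n : ℕ, (n + 1 : ℝ) * ‖w t n‖ ≤ m} := by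
  have : {t | ∑' n : ℕ, (n + 1 : ℝ) * ‖w t n‖ ≤ m} =
      ⋂ s : Finset ℕ, {t | ∑ n ∈ s, (n + 1 : ℝ) * ‖w t n‖ ≤ m} := by
    ext t
    simp only [Set.mem_ofPred_eq, Set.mem_iInter]
    exact ⟨fun ht s => ((h.summable t).sum_le_tsum s fun _ _ => by positivity).trans ht,
      fun ht => (h.summable t).tsum_le_of_sum_le ht⟩
  rw [this]
  refine isClosed_iInter fun s => isClosed_le ?_ continuous_const
  refine continuous_finsetSum _ fun n _ => continuous_const.mul (Continuous.norm ?_)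
  exact continuous_iff_continuousAt.2 fun t => (h.hasDerivAt n t).continuousAt

theorem norm_le (s t : ℝ) : ‖w t‖ ≤ 3 * ∑' n : ℕ, (n + 1 : ℝ) * ‖w s n‖ :=
  le_of_forall_bounded_interval (f := fun t => ‖w t‖)
    (g := fun s => ∑' n : ℕ, (n + 1 : ℝ) * ‖w s n‖) h.isClosed_sublevel
    (fun _ _ _ hB => h.norm_le_of_bounded hB Set.left_mem_uIcc Set.right_mem_uIcc) s t

theorem hasDerivAt_curve (t : ℝ) : HasDerivAt w (szegoField α (w t)) t := by
  obtain ⟨c, v, -, -, hcw, hvw, hv⟩ := h.exists_hasDerivAt (a := t - 1) (b := t + 1) (by linarith)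
    fun τ _ => h.norm_le 0 τ
  have hmem : Set.Icc (t - 1) (t + 1) ∈ 𝓝 t := Icc_mem_nhds (by linarith) (by linarith)
  have := hv t
  rw [hcw (mem_of_mem_nhds hmem)] at this
  exact this.congr_of_eventuallyEq (by filter_upwards [hmem] with τ hτ using (hvw hτ).symm)

end IsCoeffSolution

end Szego

namespace Szego

open scoped InnerProductSpace NNReal

section Stability

variable {F : Type*} [NormedAddCommGroup F] [NormedSpace ℂ F] [FiniteDimensional ℂ F]

theorem exists_apply_eq_smul_of_mem_spectrum {B : F →L[ℂ] F} {k : ℂ} (hk : k ∈ spectrum ℂ B) :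
    ∃ h : F, h ≠ 0 ∧ B h = k • h := by
  have : CompleteSpace F := FiniteDimensional.complete ℂ F
  rw [spectrum.mem_iff, ContinuousLinearMap.isUnit_iff_bijective] at hk
  have hinj : ¬ Function.Injective (algebraMap ℂ (F →L[ℂ] F) k - B) := fun hi =>
    hk ⟨hi, (LinearMap.injective_iff_surjective (f := (algebraMap ℂ (F →L[ℂ] F) k - B : F →ₗ[ℂ] F))).1 hi⟩
  rw [injective_iff_map_eq_zero] at hinj
  push Not at hinj
  obtain ⟨h, h0, hne⟩ := hinj
  refine ⟨h, hne, (sub_eq_zero.1 ?_).symm⟩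
  rw [← h0]
  rfl

theorem exists_norm_pow_lt_one {B : F →L[ℂ] F} (h1 : ‖B‖ ≤ 1)
    (heig : ∀ (k : ℂ) h, ‖k‖ = 1 → B h = k • h → h = 0) : ∃ n : ℕ, ‖B ^ n‖ < 1 := by
  have : CompleteSpace F := FiniteDimensional.complete ℂ F
  rcases subsingleton_or_nontrivial F with hF | hF
  · refine ⟨1, ?_⟩
    rw [Subsingleton.elim (B ^ 1) 0, norm_zero]
    exact one_pos
  have hr : spectralRadius ℂ B < (1 : ℝ≥0) := by
    refine spectrum.spectralRadius_lt_of_forall_lt B fun k hk => ?_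
    obtain ⟨h, hne, hB⟩ := exists_apply_eq_smul_of_mem_spectrum hk
    have hpos : 0 < ‖h‖ := norm_pos_iff.2 hne
    have hle : ‖k‖ ≤ 1 := by
      have h2 := B.le_of_opNorm_le h1 h
      rw [hB, norm_smul] at h2
      exact le_of_mul_le_mul_right h2 hpos
    have hlt : ‖k‖ < 1 := lt_of_le_of_ne hle fun h2 => hne (heig k h h2 hB)
    exact_mod_cast hlt
  have ht := (spectrum.pow_nnnorm_pow_one_div_tendsto_nhds_spectralRadius B).eventually_lt_const hr
  obtain ⟨n, hn, hn0⟩ := (ht.and (eventually_gt_atTop 0)).exists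
  refine ⟨n, ?_⟩
  by_contra! hge
  refine hn.not_ge ?_
  have h2 : (1 : ℝ≥0∞) ≤ (‖B ^ n‖₊ : ℝ≥0∞) := by exact_mod_cast hge
  simpa using ENNReal.rpow_le_rpow h2 (by positivity : (0 : ℝ) ≤ 1 / n)

theorem exists_norm_pow_le {S : Set (F →L[ℂ] F)} (hS : IsCompact S) (h1 : ∀ B ∈ S, ‖B‖ ≤ 1)
    (heig : ∀ B ∈ S, ∀ (k : ℂ) h, ‖k‖ = 1 → B h = k • h → h = 0) :
    ∃ n : ℕ, ∃ q : ℝ, 0 ≤ q ∧ q < 1 ∧ ∀ B ∈ S, ‖B ^ n‖ ≤ q := by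
  rcases S.eq_empty_or_nonempty with rfl | hne
  · exact ⟨0, 0, le_rfl, one_pos, by simp⟩
  have hmono : ∀ B : F →L[ℂ] F, ‖B‖ ≤ 1 → ∀ m n, m ≤ n → ‖B ^ m‖ < 1 → ‖B ^ n‖ < 1 := by
    intro B hB m n hmn hm
    induction n, hmn using Nat.le_induction with
    | base => exact hm
    | succ n _ ih =>
      rw [pow_succ]
      refine (norm_mul_le _ _).trans_lt ?_
      exact (mul_le_of_le_one_right (norm_nonneg _) hB).trans_lt ih
  have hcont : ∀ n : ℕ, Continuous fun B : F →L[ℂ] F => ‖B ^ n‖ := fun n =>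
    (continuous_pow n).norm
  obtain ⟨n, hn⟩ : ∃ n : ℕ, ∀ B ∈ S, ‖B ^ n‖ < 1 := by
    refine hS.induction_on (p := fun s => ∃ n : ℕ, ∀ B ∈ s ∩ S, ‖B ^ n‖ < 1) ⟨0, by simp⟩ ?_ ?_ ?_
      |>.imp fun n hn B hB => hn B ⟨hB, hB⟩
    · rintro s t hst ⟨n, hn⟩
      exact ⟨n, fun B hB => hn B ⟨hst hB.1, hB.2⟩⟩
    · rintro s t ⟨n, hn⟩ ⟨m, hm⟩
      refine ⟨max n m, fun B hB => ?_⟩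
      rcases hB.1 with h | h
      · exact hmono B (h1 B hB.2) _ _ (le_max_left _ _) (hn B ⟨h, hB.2⟩)
      · exact hmono B (h1 B hB.2) _ _ (le_max_right _ _) (hm B ⟨h, hB.2⟩)
    · intro B hB
      obtain ⟨n, hn⟩ := exists_norm_pow_lt_one (h1 B hB) (heig B hB)
      exact ⟨_, mem_nhdsWithin_of_mem_nhds ((hcont n).continuousAt.eventually_lt_const hn), n,
        fun C hC => hC.1⟩
  obtain ⟨B, hB, hmax⟩ := hS.exists_isMaxOn hne (hcont n).continuousOn
  exact ⟨n, ‖B ^ n‖, norm_nonneg _, hn B hB, fun C hC => hmax hC⟩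

end Stability

end Szego

namespace Szego

open scoped InnerProductSpace

namespace ShiftSpace

variable {E : Type*} [NormedAddCommGroup E] [InnerProductSpace ℂ E] [CompleteSpace E]
  [ShiftSpace E]

theorem eq_zero_of_bwd_eq_smul {k : ℂ} {x : E} (hk : ‖k‖ = 1) (h : bwd x = k • x) : x = 0 := by
  have h1 : ⟪one, x⟫_ℂ = 0 := by
    have h2 := norm_sq_bwd x
    rw [h, norm_smul, hk, one_mul] at h2
    have h3 : ‖⟪one, x⟫_ℂ‖ ^ 2 = 0 := by linarith
    exact norm_eq_zero.1 (pow_eq_zero_iff two_ne_zero |>.1 h3)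
  refine ext_basis fun n => ?_
  rw [inner_zero_right]
  induction n with
  | zero => exact h1
  | succ n ih => rw [← inner_basis_bwd, h, inner_smul_right, ih, mul_zero]

theorem embed_eq (u : Wiener) : embed E u = fwd (shank E u one) + u 0 • one := by
  rw [← hank_one, hank_eq, inner_one_embed]

/-- The range of the shifted Hankel operator. -/
def shankRange (u : Wiener) : Submodule ℂ E where
  carrier := Set.range (shank E u)
  zero_mem' := ⟨0, map_zero _⟩
  add_mem' := by
    rintro _ _ ⟨x, rfl⟩ ⟨y, rfl⟩
    exact ⟨x + y, map_add _ _ _⟩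
  smul_mem' := by
    rintro c _ ⟨x, rfl⟩
    exact ⟨conj c • x, by rw [shank_smul, Complex.conj_conj]⟩

variable {w : ℝ → Wiener} {α : ℝ} {U V : ℝ → E →L[ℝ] E}

namespace IsLaxFlow

variable (hU : IsLaxFlow w 0 U V) (hw : ∀ t, HasDerivAt w (szegoField α (w t)) t)

include hU hw

theorem shank_apply_apply (t : ℝ) (x : E) : shank E (w t) (U t x) = U t (shank E (w 0) x) := by
  have h1 : ∀ y, ⟪U t y, shank E (w t) (U t x)⟫_ℂ = ⟪U t y, U t (shank E (w 0) x)⟫_ℂ := by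
    intro y
    have := eq_of_hasDerivAt_zero (fun t => hasDerivAt_inner_shank hU rfl (hw t) y x) t 0
    rw [this, hU.inner_apply, hU.init]
    rfl
  refine ext_inner_left ℂ fun y => ?_
  rw [← hU.apply_inv t y, h1]

theorem shank_inv (t : ℝ) (x : E) : V t (shank E (w t) x) = shank E (w 0) (V t x) := by
  rw [← hU.inv_apply t (shank E (w 0) (V t x)), ← hU.shank_apply_apply hw, hU.apply_inv]

omit hw in
theorem hasDerivAt_inner_one {h : E} {μ : ℝ}
    (hKK : ∀ t, shank E (w t) (shank E (w t) (U t h)) = (μ : ℂ) • U t h) (t : ℝ) :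
    HasDerivAt (fun t => ⟪one, U t h⟫_ℂ)
      (-(Complex.I * w t 0 * ⟪embed E (w t), U t h⟫_ℂ + Complex.I / 2 * μ * ⟪one, U t h⟫_ℂ)) t := by
  refine ((hasDerivAt_const t (one : E)).inner ℂ (hU.hasDerivAt_apply t h)).congr_deriv ?_
  rw [inner_zero_left, add_zero, ← neg_neg (inner ℂ one _), ← inner_laxOp, laxOp_one,
    inner_sub_left, inner_smul_left, inner_smul_left, inner_shank_shank, hKK, inner_smul_right]
  simp only [map_mul, map_neg, map_div₀, Complex.conj_I, Complex.conj_conj, map_ofNat]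
  ring

theorem hasDerivAt_inner_embed {h : E} {μ : ℝ}
    (hKK : ∀ t, shank E (w t) (shank E (w t) (U t h)) = (μ : ℂ) • U t h) (t : ℝ) :
    HasDerivAt (fun t => ⟪embed E (w t), U t h⟫_ℂ)
      (Complex.I * α * conj (w t 0) * ⟪one, U t h⟫_ℂ +
        Complex.I / 2 * μ * ⟪embed E (w t), U t h⟫_ℂ) t := by
  have h1 := (embed E).hasFDerivAt.comp_hasDerivAt t (hw t)
  refine (h1.inner ℂ (hU.hasDerivAt_apply t h)).congr_deriv ?_
  simp only [Function.comp_apply]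
  rw [← neg_neg (inner ℂ (embed E (w t)) (laxOp E (w t) (U t h))), ← inner_laxOp, neg_add_eq_sub,
    ← inner_sub_left, szegoField_sub_laxOp, inner_sub_left, inner_smul_left, inner_smul_left,
    inner_shank_shank, hKK, inner_smul_right]
  simp only [map_mul, map_neg, map_div₀, Complex.conj_I, Complex.conj_ofReal, map_ofNat]
  ring

theorem norm_sq_sub_eq {h : E} {μ : ℝ} (hKK : shank E (w 0) (shank E (w 0) h) = (μ : ℂ) • h)
    (s t : ℝ) : ‖⟪embed E (w s), U s h⟫_ℂ‖ ^ 2 - α * ‖⟪one, U s h⟫_ℂ‖ ^ 2 =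
      ‖⟪embed E (w t), U t h⟫_ℂ‖ ^ 2 - α * ‖⟪one, U t h⟫_ℂ‖ ^ 2 := by
  have hKK' : ∀ t, shank E (w t) (shank E (w t) (U t h)) = (μ : ℂ) • U t h := fun t => by
    rw [hU.shank_apply_apply hw, hU.shank_apply_apply hw, hKK, hU.map_smul]
  have h1 : ∀ t, HasDerivAt (fun t =>
      ⟪embed E (w t), U t h⟫_ℂ * conj ⟪embed E (w t), U t h⟫_ℂ -
        (α : ℂ) * (⟪one, U t h⟫_ℂ * conj ⟪one, U t h⟫_ℂ)) 0 t := by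
    intro t
    have hp := hU.hasDerivAt_inner_embed hw hKK' t
    have hq := hU.hasDerivAt_inner_one hKK' t
    refine ((hp.mul hp.star).sub ((hq.mul hq.star).const_mul (α : ℂ))).congr_deriv ?_
    simp only [RCLike.star_def, map_mul, map_neg, map_add, map_div₀, Complex.conj_I,
      Complex.conj_ofReal, Complex.conj_conj, map_ofNat]
    ring
  have h2 := eq_of_hasDerivAt_zero h1 s t
  simp only [Complex.mul_conj, Complex.normSq_eq_norm_sq] at h2
  exact_mod_cast h2

theorem bwd_apply_of_forall_eq_zero {h : E} {B : ℝ} (hB : ∀ t, ‖w t‖ ≤ B)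
    (hp : ∀ t, ⟪embed E (w t), U t h⟫_ℂ = 0) (hq : ∀ t, ⟪one, U t h⟫_ℂ = 0) (t : ℝ) :
    bwd (U t h) = U t (bwd h) := by
  refine congrFun (linear_ode_solution_unique (C := fun t => laxOp E (w t)) (b := 2 * B ^ 2)
    (t₀ := 0) (x := fun t => bwd (U t h)) (y := fun t => U t (bwd h)) (fun t => ?_) (fun t => ?_)
    (hU.hasDerivAt_apply · _) ?_) t
  · refine (norm_laxOp_le _).trans ?_
    have := hB t
    gcongr
  · refine ((bwd (E := E)).hasFDerivAt.comp_hasDerivAt t (hU.hasDerivAt_apply t h)).congr_deriv ?_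
    exact bwd_laxOp (hq t) (hp t)
  · simp [hU.init]

end IsLaxFlow

end ShiftSpace

end Szego

namespace Szego

open scoped InnerProductSpace

theorem norm_pow_le_pow_of_norm_le {F : Type*} [NormedAddCommGroup F] [NormedSpace ℂ F]
    {A : F →L[ℂ] F} {q : ℝ} (h : ‖A‖ ≤ q) (n : ℕ) : ‖A ^ n‖ ≤ q ^ n := by
  induction n with
  | zero => rw [pow_zero, pow_zero]; exact ContinuousLinearMap.norm_id_le
  | succ n ih =>
    rw [pow_succ, pow_succ]
    exact (norm_mul_le _ _).trans (mul_le_mul ih h (norm_nonneg _) (norm_nonneg _ |>.trans ih))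

theorem norm_pow_succ_le_of_norm_le {F : Type*} [NormedAddCommGroup F] [NormedSpace ℂ F]
    {A : F →L[ℂ] F} {q : ℝ} (h : ‖A‖ ≤ 1) {n : ℕ} (hn : ‖A ^ n‖ ≤ q) : ‖A ^ (n + 1)‖ ≤ q := by
  rw [pow_succ]
  exact (norm_mul_le _ _).trans ((mul_le_mul hn h (norm_nonneg _)
    ((norm_nonneg _).trans hn)).trans_eq (mul_one _))

theorem exists_norm_pow_le_of_tendsto {F : Type*} [NormedAddCommGroup F] [NormedSpace ℂ F]
    [FiniteDimensional ℂ F] {S : Set (F →L[ℂ] F)} (h1 : ∀ B ∈ S, ‖B‖ ≤ 1)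
    (heig : ∀ (a : ℕ → F →L[ℂ] F) (b : F →L[ℂ] F), (∀ n, a n ∈ S) →
      (∀ x, Tendsto (fun n => a n x) atTop (𝓝 (b x))) → ∀ (k : ℂ) h, ‖k‖ = 1 → b h = k • h → h = 0) :
    ∃ (n : ℕ) (q : ℝ), 0 ≤ q ∧ q < 1 ∧ ∀ B ∈ S, ‖B ^ n‖ ≤ q := by
  have hS1 : ∀ b ∈ closure S, ‖b‖ ≤ 1 := fun b hb =>
    closure_minimal (t := {b | ‖b‖ ≤ 1}) h1 (isClosed_le continuous_norm continuous_const) hb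
  have : ProperSpace (F →L[ℂ] F) := FiniteDimensional.proper ℂ _
  have hS : IsCompact (closure S) := Metric.isCompact_of_isClosed_isBounded isClosed_closure
    (isBounded_iff_forall_norm_le.2 ⟨1, hS1⟩)
  obtain ⟨n, q, hq0, hq1, hq⟩ := exists_norm_pow_le hS hS1 fun b hb => by
    obtain ⟨a, ha, hab⟩ := mem_closure_iff_seq_limit.1 hb
    exact heig a b ha fun x => ((ContinuousLinearMap.apply ℂ F x).continuous.tendsto b).comp hab
  exact ⟨n, q, hq0, hq1, fun b hb => hq b (subset_closure hb)⟩

namespace ShiftSpace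

variable {E : Type*} [NormedAddCommGroup E] [InnerProductSpace ℂ E] [CompleteSpace E]
  [ShiftSpace E] {w : ℝ → Wiener} {α : ℝ} {U V : ℝ → E →L[ℝ] E}

namespace IsLaxFlow

variable (hU : IsLaxFlow w 0 U V)

include hU

theorem norm_sq_conj_bwd (t : ℝ) (x : E) :
    ‖V t (bwd (U t x))‖ ^ 2 = ‖x‖ ^ 2 - ‖⟪one, U t x⟫_ℂ‖ ^ 2 := by
  rw [hU.norm_inv, norm_sq_bwd, hU.norm_apply]

theorem norm_conj_bwd_le (t : ℝ) (x : E) : ‖V t (bwd (U t x))‖ ≤ ‖x‖ := by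
  rw [hU.norm_inv, ← hU.norm_apply t x]
  exact norm_bwd_le _

theorem conj_fwd_conj_bwd (t : ℝ) (x : E) :
    V t (fwd (U t (V t (bwd (U t x))))) = x - ⟪one, U t x⟫_ℂ • V t one := by
  rw [hU.apply_inv, fwd_bwd, map_sub, hU.inv_apply, hU.inv_smul]

section Asymptotic

variable {s : ℕ → ℝ} {k : ℂ} {h : E}

theorem tendsto_inner_one (hk : ‖k‖ = 1)
    (hh : Tendsto (fun n => V (s n) (bwd (U (s n) h))) atTop (𝓝 (k • h))) :
    Tendsto (fun n => ⟪one, U (s n) h⟫_ℂ) atTop (𝓝 0) := by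
  have h1 : Tendsto (fun n => ‖h‖ ^ 2 - ‖V (s n) (bwd (U (s n) h))‖ ^ 2) atTop (𝓝 0) := by
    have := (hh.norm.pow 2).const_sub (‖h‖ ^ 2)
    rwa [norm_smul, hk, one_mul, sub_self] at this
  simp only [hU.norm_sq_conj_bwd, sub_sub_cancel] at h1
  have h2 := h1.sqrt
  simp only [Real.sqrt_zero, Real.sqrt_sq (norm_nonneg _)] at h2
  exact tendsto_zero_iff_norm_tendsto_zero.2 h2

theorem tendsto_conj_fwd (hk : ‖k‖ = 1)
    (hh : Tendsto (fun n => V (s n) (bwd (U (s n) h))) atTop (𝓝 (k • h))) :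
    Tendsto (fun n => V (s n) (fwd (U (s n) h))) atTop (𝓝 (conj k • h)) := by
  have hkk : conj k * k = 1 := by rw [Complex.conj_mul', hk]; simp
  have h1 : ∀ n, V (s n) (fwd (U (s n) h)) - conj k • h =
      V (s n) (fwd (U (s n) (h - conj k • V (s n) (bwd (U (s n) h))))) -
        (conj k * ⟪one, U (s n) h⟫_ℂ) • V (s n) one := by
    intro n
    rw [map_sub, map_sub, map_sub, hU.map_smul, fwd_smul, hU.inv_smul, hU.conj_fwd_conj_bwd]
    module
  rw [tendsto_iff_norm_sub_tendsto_zero]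
  have h2 : Tendsto (fun n => ‖h - conj k • V (s n) (bwd (U (s n) h))‖ + ‖⟪one, U (s n) h⟫_ℂ‖)
      atTop (𝓝 0) := by
    have h3 := ((hh.const_smul (conj k)).const_sub h).norm.add
      (hU.tendsto_inner_one hk hh).norm
    rwa [smul_smul, hkk, one_smul, sub_self, norm_zero, norm_zero, add_zero] at h3
  refine squeeze_zero (fun _ => norm_nonneg _) (fun n => ?_) h2
  rw [h1]
  refine (norm_sub_le _ _).trans (add_le_add ?_ ?_)
  · rw [hU.norm_inv, norm_fwd, hU.norm_apply]
  · rw [norm_smul, norm_mul, RCLike.norm_conj, hk, one_mul, hU.norm_inv, norm_one, mul_one]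

variable (hw : ∀ t, HasDerivAt w (szegoField α (w t)) t)

include hw

theorem conj_bwd_shank (t : ℝ) (x : E) :
    V t (bwd (U t (shank E (w 0) x))) = shank E (w 0) (V t (fwd (U t x))) := by
  rw [← hU.shank_apply_apply hw, bwd_shank, hU.shank_inv hw]

theorem tendsto_conj_bwd_shank (hk : ‖k‖ = 1)
    (hh : Tendsto (fun n => V (s n) (bwd (U (s n) h))) atTop (𝓝 (k • h))) :
    Tendsto (fun n => V (s n) (bwd (U (s n) (shank E (w 0) h)))) atTop
      (𝓝 (k • shank E (w 0) h)) := by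
  simp only [hU.conj_bwd_shank hw]
  have := ((shank E (w 0)).continuous.tendsto _).comp (hU.tendsto_conj_fwd hk hh)
  rwa [shank_smul, Complex.conj_conj] at this

theorem inner_embed_eq (t : ℝ) (x : E) : ⟪embed E (w t), U t x⟫_ℂ =
    conj ⟪one, U t (shank E (w 0) (V t (bwd (U t x))))⟫_ℂ + conj (w t 0) * ⟪one, U t x⟫_ℂ := by
  rw [embed_eq, inner_add_left, inner_smul_left, inner_fwd, ← hU.shank_apply_apply hw,
    hU.apply_inv, inner_shank_symm, inner_conj_symm]

theorem tendsto_inner_embed {B : ℝ} (hB : ∀ t, ‖w t‖ ≤ B) (hk : ‖k‖ = 1)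
    (hh : Tendsto (fun n => V (s n) (bwd (U (s n) h))) atTop (𝓝 (k • h))) :
    Tendsto (fun n => ⟪embed E (w (s n)), U (s n) h⟫_ℂ) atTop (𝓝 0) := by
  have hq := hU.tendsto_inner_one hk hh
  have hq' := hU.tendsto_inner_one hk (hU.tendsto_conj_bwd_shank hw hk hh)
  have h0 : Tendsto (fun n => shank E (w 0) (V (s n) (bwd (U (s n) h))) -
      conj k • shank E (w 0) h) atTop (𝓝 0) := by
    have := (((shank E (w 0)).continuous.tendsto _).comp hh).sub_const (conj k • shank E (w 0) h)
    rwa [shank_smul, sub_self] at this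
  have h1 : ∀ n, ‖⟪embed E (w (s n)), U (s n) h⟫_ℂ‖ ≤
      (‖shank E (w 0) (V (s n) (bwd (U (s n) h))) - conj k • shank E (w 0) h‖ +
        ‖⟪one, U (s n) (shank E (w 0) h)⟫_ℂ‖) + B * ‖⟪one, U (s n) h⟫_ℂ‖ := by
    intro n
    rw [hU.inner_embed_eq hw]
    refine (norm_add_le _ _).trans (add_le_add ?_ ?_)
    · rw [RCLike.norm_conj, ← sub_add_cancel (shank E (w 0) (V (s n) (bwd (U (s n) h))))
        (conj k • shank E (w 0) h), map_add, hU.map_smul, inner_add_right, inner_smul_right,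
        add_sub_cancel_right]
      refine (norm_add_le _ _).trans (add_le_add ?_ ?_)
      · refine (norm_inner_le_norm _ _).trans ?_
        rw [norm_one, one_mul, hU.norm_apply]
      · rw [norm_mul, RCLike.norm_conj, hk, one_mul]
    · rw [norm_mul, RCLike.norm_conj]
      gcongr
      exact ((w (s n)).norm_apply_le 0).trans (hB _)
  refine squeeze_zero_norm h1 ?_
  have := (h0.norm.add hq'.norm).add (hq.norm.const_mul B)
  simpa using this

theorem eq_zero_of_tendsto {B : ℝ} (hB : ∀ t, ‖w t‖ ≤ B) (hα : α < 0) (hk : ‖k‖ = 1)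
    (hh : Tendsto (fun n => V (s n) (bwd (U (s n) h))) atTop (𝓝 (k • h))) {μ : ℝ}
    (hKK : shank E (w 0) (shank E (w 0) h) = (μ : ℂ) • h) : h = 0 := by
  have hlim : Tendsto (fun n => ‖⟪embed E (w (s n)), U (s n) h⟫_ℂ‖ ^ 2 -
      α * ‖⟪one, U (s n) h⟫_ℂ‖ ^ 2) atTop (𝓝 0) := by
    have := ((hU.tendsto_inner_embed hw hB hk hh).norm.pow 2).sub
      (((hU.tendsto_inner_one hk hh).norm.pow 2).const_mul α)
    simpa using this
  have h0 : ∀ t, ‖⟪embed E (w t), U t h⟫_ℂ‖ ^ 2 - α * ‖⟪one, U t h⟫_ℂ‖ ^ 2 = 0 := by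
    intro t
    refine tendsto_nhds_unique (tendsto_const_nhds.congr fun n => ?_) hlim
    exact hU.norm_sq_sub_eq hw hKK t (s n)
  have hp : ∀ t, ⟪embed E (w t), U t h⟫_ℂ = 0 := fun t => by
    have := h0 t
    have h2 := sq_nonneg ‖⟪one, U t h⟫_ℂ‖
    rw [← norm_eq_zero, ← sq_eq_zero_iff]
    nlinarith [sq_nonneg ‖⟪embed E (w t), U t h⟫_ℂ‖]
  have hq : ∀ t, ⟪one, U t h⟫_ℂ = 0 := fun t => by
    have := h0 t
    rw [hp, norm_zero, zero_pow two_ne_zero, zero_sub, neg_eq_zero, mul_eq_zero] at this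
    exact norm_eq_zero.1 (pow_eq_zero_iff two_ne_zero |>.1 (this.resolve_left hα.ne))
  refine eq_zero_of_bwd_eq_smul hk (tendsto_nhds_unique (tendsto_const_nhds.congr fun n => ?_) hh)
  rw [hU.bwd_apply_of_forall_eq_zero hw hB hp hq, hU.inv_apply]

end Asymptotic

section Compression

variable (hw : ∀ t, HasDerivAt w (szegoField α (w t)) t)
  [FiniteDimensional ℂ (shankRange (E := E) (w 0))]

include hw

theorem exists_compression : ∃ A : ℝ → shankRange (E := E) (w 0) →L[ℂ] shankRange (E := E) (w 0),
    ∀ t x, (A t x : E) = V t (bwd (U t x)) := by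
  refine ⟨fun t => LinearMap.toContinuousLinearMap
    { toFun := fun x => ⟨V t (bwd (U t x)), ?_⟩
      map_add' := fun x y => Subtype.ext (by simp)
      map_smul' := fun c x => Subtype.ext (by simp [hU.map_smul, bwd_smul, hU.inv_smul]) },
    fun t x => rfl⟩
  obtain ⟨y, hy⟩ := x.2
  exact ⟨V t (fwd (U t y)), by rw [← hU.conj_bwd_shank hw, hy]⟩

theorem exists_norm_compression_pow_le {B : ℝ} (hB : ∀ t, ‖w t‖ ≤ B) (hα : α < 0)
    {A : ℝ → shankRange (E := E) (w 0) →L[ℂ] shankRange (E := E) (w 0)}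
    (hA : ∀ t x, (A t x : E) = V t (bwd (U t x))) :
    ∃ (n : ℕ) (q : ℝ), 0 ≤ q ∧ q < 1 ∧ ∀ t, ‖A t ^ n‖ ≤ q := by
  have hA1 : ∀ t, ‖A t‖ ≤ 1 := fun t =>
    ContinuousLinearMap.opNorm_le_bound _ zero_le_one fun x => by
      rw [one_mul, Submodule.coe_norm, hA]
      exact hU.norm_conj_bwd_le t x
  suffices h : ∃ (n : ℕ) (q : ℝ), 0 ≤ q ∧ q < 1 ∧ ∀ b ∈ Set.range A, ‖b ^ n‖ ≤ q by
    obtain ⟨n, q, hq0, hq1, hq⟩ := h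
    exact ⟨n, q, hq0, hq1, fun t => hq _ ⟨t, rfl⟩⟩
  refine exists_norm_pow_le_of_tendsto (Set.forall_mem_range.2 hA1) ?_
  intro a b ha hab k h hk hbh
  choose s hs using ha
  have hlim : ∀ x : shankRange (E := E) (w 0),
      Tendsto (fun n => V (s n) (bwd (U (s n) x))) atTop (𝓝 (b x : E)) := by
    intro x
    simp only [← hA, hs]
    exact (continuous_subtype_val.tendsto _).comp (hab x)
  let Z : Submodule ℂ E :=
    { carrier := {x | x ∈ shankRange (w 0) ∧
        Tendsto (fun n => V (s n) (bwd (U (s n) x))) atTop (𝓝 (k • x))}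
      zero_mem' := ⟨Submodule.zero_mem _, by simp⟩
      add_mem' := by
        rintro x y ⟨hx, hx'⟩ ⟨hy, hy'⟩
        exact ⟨Submodule.add_mem _ hx hy, by simpa using hx'.add hy'⟩
      smul_mem' := by
        rintro c x ⟨hx, hx'⟩
        refine ⟨Submodule.smul_mem _ c hx, ?_⟩
        simp only [hU.map_smul, bwd_smul, hU.inv_smul, smul_comm k c x]
        exact hx'.const_smul c }
  have hK : ∀ x ∈ Z, shank E (w 0) x ∈ Z := fun x hx =>
    ⟨⟨x, rfl⟩, hU.tendsto_conj_bwd_shank hw hk hx.2⟩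
  have : FiniteDimensional ℂ Z := Submodule.finiteDimensional_of_le
    (show Z ≤ shankRange (w 0) from fun x hx => hx.1)
  let T : Z →ₗ[ℂ] Z :=
    { toFun := fun x => ⟨shank E (w 0) (shank E (w 0) x), hK _ (hK _ x.2)⟩
      map_add' := fun x y => Subtype.ext (by simp)
      map_smul' := fun c x => Subtype.ext (by simp [shank_smul]) }
  by_contra hne
  have hhZ : (h : E) ∈ Z := ⟨h.2, by
    have := hlim h
    rwa [hbh] at this⟩
  have : Nontrivial Z := ⟨⟨⟨h, hhZ⟩, 0, fun h0 => hne (Subtype.ext (congrArg (fun z : Z => (z : E)) h0))⟩⟩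
  obtain ⟨μ, hμ⟩ := Module.End.exists_eigenvalue T
  obtain ⟨x, hx⟩ := hμ.exists_hasEigenvector
  have hTx : shank E (w 0) (shank E (w 0) x) = μ • (x : E) := congrArg Subtype.val hx.apply_eq_smul
  have hx0 : (x : E) ≠ 0 := fun h0 => hx.2 (Subtype.ext h0)
  refine hx0 (hU.eq_zero_of_tendsto hw hB hα hk x.2.2 (μ := ‖shank E (w 0) x‖ ^ 2 / ‖(x : E)‖ ^ 2) ?_)
  rw [hTx]
  congr 1
  have h1 : ⟪(x : E), shank E (w 0) (shank E (w 0) x)⟫_ℂ = ⟪shank E (w 0) x, shank E (w 0) x⟫_ℂ :=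
    inner_shank_symm _ _ _
  rw [hTx, inner_smul_right, inner_self_eq_norm_sq_to_K, inner_self_eq_norm_sq_to_K] at h1
  have h2 : ((‖(x : E)‖ : ℂ)) ^ 2 ≠ 0 := by simpa using hx0
  push_cast
  rw [eq_div_iff h2]
  exact h1

theorem exists_norm_coeff_succ_le {B : ℝ} (hB : ∀ t, ‖w t‖ ≤ B) (hα : α < 0) :
    ∃ (m : ℕ) (q : ℝ), m ≠ 0 ∧ 0 ≤ q ∧ q < 1 ∧ ∀ t j, ‖w t (j + 1)‖ ≤ B * q ^ (j / m) := by
  obtain ⟨A, hA⟩ := hU.exists_compression hw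
  obtain ⟨m', q, hq0, hq1, hq'⟩ := hU.exists_norm_compression_pow_le hw hB hα hA
  have hA1 : ∀ t, ‖A t‖ ≤ 1 := fun t =>
    ContinuousLinearMap.opNorm_le_bound _ zero_le_one fun x => by
      rw [one_mul, Submodule.coe_norm, hA]
      exact hU.norm_conj_bwd_le t x
  obtain ⟨m, hm0, hq⟩ : ∃ m : ℕ, m ≠ 0 ∧ ∀ t, ‖A t ^ m‖ ≤ q := by
    refine ⟨m' + 1, m'.succ_ne_zero, fun t => ?_⟩
    exact norm_pow_succ_le_of_norm_le (hA1 t) (hq' t)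
  refine ⟨m, q, hm0, hq0, hq1, fun t j => ?_⟩
  have hpow : ∀ (i : ℕ) (x : shankRange (E := E) (w 0)),
      (bwd ^ i) (U t x) = U t ((A t ^ i) x : shankRange (E := E) (w 0)) := by
    intro i x
    induction i with
    | zero => simp
    | succ i ih =>
      rw [pow_succ', mul_apply_eq_comp, ih, pow_succ', mul_apply_eq_comp, hA, hU.apply_inv]
  let x : shankRange (E := E) (w 0) := ⟨shank E (w 0) (V t one), ⟨_, rfl⟩⟩
  have hx : shank E (w t) one = U t x := by
    rw [← hU.shank_apply_apply hw, hU.apply_inv]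
  have hxB : ‖x‖ ≤ B := by
    refine ((shank E (w 0)).le_of_opNorm_le ((norm_shank_le _).trans (hB 0)) _).trans ?_
    rw [hU.norm_inv, norm_one, mul_one]
  have h1 : w t (j + 1) = ⟪one, U t ((A t ^ j) x : shankRange (E := E) (w 0))⟫_ℂ := by
    rw [← hpow, ← hx, ← basis_zero, inner_basis_bwd_pow, inner_basis_shank_basis]
    simp
  have h2 : ‖A t ^ j‖ ≤ q ^ (j / m) := by
    conv_lhs => rw [← Nat.mod_add_div j m, pow_add, pow_mul]
    have h3 := norm_pow_le_pow_of_norm_le (hA1 t) (j % m)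
    have h4 := norm_pow_le_pow_of_norm_le (hq t) (j / m)
    rw [one_pow] at h3
    exact (norm_mul_le _ _).trans ((mul_le_mul h3 h4 (norm_nonneg _) zero_le_one).trans_eq
      (one_mul _))
  rw [h1]
  refine (norm_inner_le_norm _ _).trans ?_
  rw [norm_one, one_mul, hU.norm_apply, mul_comm B]
  exact ((A t ^ j).le_of_opNorm_le h2 x).trans (by gcongr)

/-- The coefficients of the solution decay exponentially, uniformly in time. -/
theorem exists_norm_coeff_le {B : ℝ} (hB : ∀ t, ‖w t‖ ≤ B) (hα : α < 0) :
    ∃ C r : ℝ, 0 < r ∧ r < 1 ∧ ∀ t n, ‖w t n‖ ≤ C * r ^ n := by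
  obtain ⟨m, q₀, hm, hq0₀, hq1₀, hq₀⟩ := hU.exists_norm_coeff_succ_le hw hB hα
  have hB0 : 0 ≤ B := (norm_nonneg _).trans (hB 0)
  obtain ⟨q, hq0, hq1, hq⟩ : ∃ q : ℝ, 0 < q ∧ q < 1 ∧
      ∀ t j, ‖w t (j + 1)‖ ≤ B * q ^ (j / m) := by
    refine ⟨max q₀ (1 / 2), lt_max_of_lt_right (by norm_num), max_lt hq1₀ (by norm_num), fun t j => ?_⟩
    refine (hq₀ t j).trans ?_
    gcongr
    exact le_max_left _ _
  set r : ℝ := q ^ (m : ℝ)⁻¹ with hr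
  have hrm : r ^ m = q := Real.rpow_inv_natCast_pow hq0.le hm
  have hr0 : 0 < r := Real.rpow_pos_of_pos hq0 _
  have hr1 : r < 1 := Real.rpow_lt_one hq0.le hq1 (by positivity)
  refine ⟨B / (q * r), r, hr0, hr1, fun t n => ?_⟩
  rw [div_mul_eq_mul_div, le_div_iff₀ (by positivity)]
  cases n with
  | zero =>
    rw [pow_zero, mul_one]
    have h1 := ((w t).norm_apply_le 0).trans (hB t)
    have h2 : q * r ≤ 1 := mul_le_one₀ hq1.le hr0.le hr1.le
    exact (mul_le_mul h1 h2 (by positivity) hB0).trans_eq (mul_one _)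
  | succ j =>
    have h1 : q ^ (j / m) * q ≤ r ^ j := by
      rw [← hrm, ← pow_mul, ← pow_add]
      refine pow_le_pow_of_le_one hr0.le hr1.le ?_
      have := Nat.div_add_mod j m
      have := Nat.mod_lt j (Nat.pos_of_ne_zero hm)
      lia
    calc ‖w t (j + 1)‖ * (q * r) ≤ B * q ^ (j / m) * (q * r) := by gcongr; exact hq t j
      _ = B * (q ^ (j / m) * q) * r := by ring
      _ ≤ B * r ^ j * r := by gcongr
      _ = _ := by ring

end Compression

end IsLaxFlow

end ShiftSpace

end Szego

namespace Szego

open scoped InnerProductSpace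

theorem isCompact_setOf_norm_le {g : ℕ → ℝ} (hg : Summable g) :
    IsCompact {u : Wiener | ∀ n, ‖u n‖ ≤ g n} := by
  have h1 : IsCompact (Set.pi Set.univ fun n => Metric.closedBall (0 : ℂ) (g n)) :=
    isCompact_univ_pi fun n => isCompact_closedBall _ _
  have h2 : ContinuousOn (fun f : ℕ → ℂ => ∑' n, f n • Wiener.mono n)
      (Set.pi Set.univ fun n => Metric.closedBall (0 : ℂ) (g n)) := by
    refine continuousOn_tsum (fun n => by fun_prop) hg fun n f hf => ?_
    rw [norm_smul, Wiener.norm_mono, mul_one]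
    simpa using hf n (Set.mem_univ n)
  have h3 := h1.image_of_continuousOn h2
  convert h3 using 1
  ext u
  simp only [Set.mem_ofPred_eq, Set.mem_image]
  constructor
  · intro hu
    exact ⟨u, fun n _ => by simpa using hu n, u.hasSum_mono.tsum_eq⟩
  · rintro ⟨f, hf, rfl⟩ n
    have hf' : ∀ n, ‖f n‖ ≤ g n := fun n => by simpa using hf n (Set.mem_univ n)
    have h4 : Wiener.mk f (Summable.of_nonneg_of_le (fun _ => norm_nonneg _) hf' hg) =
        ∑' n, f n • Wiener.mono n := (Wiener.hasSum_mono _).tsum_eq.symm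
    rw [← h4]
    exact hf' n

theorem summable_sobolev_geometric (s C : ℝ) {r : ℝ} (hr0 : 0 < r) (hr1 : r < 1) :
    Summable fun n : ℕ => ((1 : ℝ) + (n : ℝ) ^ 2) ^ s * (C * r ^ n) ^ 2 := by
  have h1 := summable_pow_mul_geometric_of_norm_lt_one (R := ℝ) (2 * ⌈s⌉₊) (r := r ^ 2)
    (by rw [Real.norm_of_nonneg (by positivity)]; exact pow_lt_one₀ hr0.le hr1 two_ne_zero)
  have h2 := ((summable_nat_add_iff 1).2 h1).mul_left (C ^ 2 / r ^ 2)
  refine Summable.of_nonneg_of_le (fun n => by positivity) (fun n => ?_) h2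
  have h3 : ((1 : ℝ) + (n : ℝ) ^ 2) ^ s ≤ ((n : ℝ) + 1) ^ (2 * ⌈s⌉₊) := by
    calc ((1 : ℝ) + (n : ℝ) ^ 2) ^ s ≤ ((1 : ℝ) + (n : ℝ) ^ 2) ^ (⌈s⌉₊ : ℝ) :=
          Real.rpow_le_rpow_of_exponent_le (by nlinarith) (Nat.le_ceil s)
      _ = ((1 : ℝ) + (n : ℝ) ^ 2) ^ ⌈s⌉₊ := Real.rpow_natCast _ _
      _ ≤ (((n : ℝ) + 1) ^ 2) ^ ⌈s⌉₊ := by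
        gcongr
        nlinarith [(Nat.cast_nonneg n : (0 : ℝ) ≤ n)]
      _ = _ := (pow_mul _ _ _).symm
  calc _ ≤ ((n : ℝ) + 1) ^ (2 * ⌈s⌉₊) * (C * r ^ n) ^ 2 := by gcongr
    _ = _ := by
      push_cast
      field_simp
      ring

namespace ShiftSpace

variable {E : Type*} [NormedAddCommGroup E] [InnerProductSpace ℂ E] [CompleteSpace E]
  [ShiftSpace E]

theorem eq_zero_of_shank_eq_zero {u : Wiener} {x : E} (hx : x ∈ shankRange u)
    (h : shank E u x = 0) : x = 0 := by
  obtain ⟨y, rfl⟩ := hx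
  rw [← inner_self_eq_zero (𝕜 := ℂ), inner_shank_symm, h, inner_zero_right]

theorem exists_norm_le_norm_shank (u : Wiener) [FiniteDimensional ℂ (shankRange (E := E) u)] :
    ∃ c : ℝ, 0 < c ∧ ∀ x ∈ shankRange (E := E) u, ‖x‖ ≤ c * ‖shank E u x‖ := by
  let T : shankRange (E := E) u →ₗ[ℝ] E :=
    { toFun := fun x => shank E u x
      map_add' := fun x y => by simp
      map_smul' := fun c x => by simp }
  have : FiniteDimensional ℝ (shankRange (E := E) u) := FiniteDimensional.complexToReal _
  have hT : LinearMap.ker T = ⊥ := LinearMap.ker_eq_bot'.2 fun x hx =>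
    Subtype.ext (eq_zero_of_shank_eq_zero x.2 hx)
  obtain ⟨c, hc, hTc⟩ := T.exists_antilipschitzWith hT
  exact ⟨c, hc, fun x hx => hTc.le_mul_norm (map_zero T) ⟨x, hx⟩⟩

variable {w : ℝ → Wiener} {α : ℝ} {U V : ℝ → E →L[ℝ] E}

namespace IsLaxFlow

variable (hU : IsLaxFlow w 0 U V) (hw : ∀ t, HasDerivAt w (szegoField α (w t)) t)

include hU hw

theorem rank_shankRange_le (t : ℝ) :
    Module.rank ℂ (shankRange (E := E) (w t)) ≤ Module.rank ℂ (shankRange (E := E) (w 0)) := by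
  let T : E →ₗ[ℂ] E :=
    { toFun := U t
      map_add' := map_add (U t)
      map_smul' := fun c x => hU.map_smul t c x }
  refine (Submodule.rank_mono ?_).trans (rank_map_le T (shankRange (w 0)))
  rintro _ ⟨x, rfl⟩
  refine ⟨shank E (w 0) (V t x), ⟨_, rfl⟩, ?_⟩
  change U t _ = _
  rw [← hU.shank_apply_apply hw, hU.apply_inv]

theorem rank_shankRange_le_of_mem_closure {N : ℕ}
    (hN : Module.rank ℂ (shankRange (E := E) (w 0)) ≤ N) {v : Wiener}
    (hv : v ∈ closure (Set.range w)) : Module.rank ℂ (shankRange (E := E) v) ≤ N := by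
  refine rank_le fun s hs => ?_
  choose x hx using fun i : s => i.1.2
  have h1 : LinearIndependent ℂ fun i : s => shank E v (x i) := by
    have := hs.map' (shankRange v).subtype (Submodule.ker_subtype _)
    rwa [show (shankRange v).subtype ∘ (fun i : s => i.1) = fun i : s => shank E v (x i) from
      funext fun i => (hx i).symm] at this
  have h2 : Continuous fun u : Wiener => fun i : s => shank E u (x i) := by fun_prop
  have h3 := (isOpen_setOfPred_linearIndependent (𝕜 := ℂ) (E := E) (ι := s)).preimage h2
  obtain ⟨_, h4, t, rfl⟩ := mem_closure_iff.1 hv _ h3 h1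
  have h5 : LinearIndependent ℂ fun i : s => (⟨shank E (w t) (x i), ⟨_, rfl⟩⟩ :
      shankRange (E := E) (w t)) := LinearIndependent.of_comp (shankRange (w t)).subtype h4
  have h6 := h5.cardinal_le_rank.trans ((hU.rank_shankRange_le hw t).trans hN)
  simpa using h6

theorem rank_shankRange_ge_of_mem_closure [FiniteDimensional ℂ (shankRange (E := E) (w 0))]
    {v : Wiener} (hv : v ∈ closure (Set.range w)) :
    Module.rank ℂ (shankRange (E := E) (w 0)) ≤ Module.rank ℂ (shankRange (E := E) v) := by
  obtain ⟨c, hc, hK⟩ := exists_norm_le_norm_shank (E := E) (w 0)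
  obtain ⟨_, ⟨t, rfl⟩, ht⟩ := Metric.mem_closure_iff.1 hv (1 / c) (by positivity)
  let T : shankRange (E := E) (w 0) →ₗ[ℂ] shankRange (E := E) v :=
    { toFun := fun x => ⟨shank E v (U t (shank E (w 0) x)), ⟨_, rfl⟩⟩
      map_add' := fun x y => Subtype.ext (by simp)
      map_smul' := fun a x => Subtype.ext (by simp [shank_smul, hU.map_smul]) }
  refine LinearMap.rank_le_of_injective T ((injective_iff_map_eq_zero T).2 fun x hx => ?_)
  have hx' : shank E v (U t (shank E (w 0) x)) = 0 := congrArg Subtype.val hx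
  set y := shank E (w 0) (x : E) with hy
  have h1 : ‖shank E (w 0) y‖ ≤ ‖w t - v‖ * ‖y‖ := by
    rw [← hU.norm_apply t (shank E (w 0) y), ← hU.shank_apply_apply hw, ← sub_zero (shank E _ _),
      ← hx', ← hU.norm_apply t y, ← sub_apply, ← map_sub]
    exact (shank E (w t - v)).le_of_opNorm_le (norm_shank_le _) _
  have h2 := hK y ⟨_, rfl⟩
  rw [dist_comm, dist_eq_norm, lt_div_iff₀ hc] at ht
  have h3 : y = 0 := by
    by_contra hne
    have h4 : 0 < ‖y‖ := norm_pos_iff.2 hne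
    nlinarith
  exact Subtype.ext (eq_zero_of_shank_eq_zero x.2 h3)

end IsLaxFlow

end ShiftSpace

theorem kuRank_eq (v : Wiener) :
    kuRank v = Module.rank ℂ (ShiftSpace.shankRange (E := HardyHilbert) v) := by
  let L : HardyHilbert →ₗ[ℂ] (ℕ → ℂ) :=
    { toFun := fun x => x
      map_add' := fun _ _ => rfl
      map_smul' := fun _ _ => rfl }
  have hL : Function.Injective L := fun x y h => HardyHilbert.ext (congrFun h)
  have h1 : khankel v '' {h | MemL2 h} = (ShiftSpace.shankRange (E := HardyHilbert) v).map L := by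
    ext f
    constructor
    · rintro ⟨h, hh, rfl⟩
      refine ⟨_, ⟨(show HardyHilbert from (⟨h, hh⟩ : Hardy)), rfl⟩, ?_⟩
      exact funext fun k => HardyHilbert.shank_apply v _ k
    · rintro ⟨_, ⟨x, rfl⟩, rfl⟩
      exact ⟨x, x.memL2, funext fun k => (HardyHilbert.shank_apply v x k).symm⟩
  rw [kuRank, h1, Submodule.span_eq]
  exact (LinearEquiv.rank_eq (Submodule.equivMapOfInjective L hL _)).symm

end Szego

namespace Szego

theorem summable_mul_norm_of_memHs {f : ℕ → ℂ} (hf : MemHs 2 f) :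
    Summable fun n : ℕ => (n + 1 : ℝ) * ‖f n‖ := by
  have h1 : Summable fun n : ℕ => 1 / ((n + 1 : ℕ) : ℝ) ^ 2 :=
    (summable_nat_add_iff 1).2 (Real.summable_one_div_nat_pow.2 one_lt_two)
  refine Summable.of_nonneg_of_le (fun n => by positivity) (fun n => ?_) (h1.add (hf.mul_left 4))
  push_cast
  rw [Real.rpow_two]
  set a : ℝ := (n : ℝ) + 1 with ha
  have ha0 : 0 < a := by positivity
  have h2 : a ^ 2 ≤ 2 * (1 + (n : ℝ) ^ 2) := by nlinarith [sq_nonneg ((n : ℝ) - 1)]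
  have h3 : a ^ 4 ≤ 4 * (1 + (n : ℝ) ^ 2) ^ 2 := by
    calc a ^ 4 = (a ^ 2) ^ 2 := by ring
      _ ≤ (2 * (1 + (n : ℝ) ^ 2)) ^ 2 := by gcongr
      _ = _ := by ring
  have h4 : a * ‖f n‖ ≤ 1 / a ^ 2 + a ^ 4 * ‖f n‖ ^ 2 := by
    have h5 : (1 / a) * (a ^ 2 * ‖f n‖) = a * ‖f n‖ := by field_simp
    have h6 := two_mul_le_add_sq (1 / a) (a ^ 2 * ‖f n‖)
    have h7 : 0 ≤ a * ‖f n‖ := by positivity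
    have h8 : (1 / a) ^ 2 + (a ^ 2 * ‖f n‖) ^ 2 = 1 / a ^ 2 + a ^ 4 * ‖f n‖ ^ 2 := by
      rw [mul_pow, div_pow, one_pow, ← pow_mul]
    linarith
  refine h4.trans ?_
  rw [← mul_assoc]
  gcongr

theorem exists_isCoeffSolution {α : ℝ} {u : ℝ → ℕ → ℂ} (hreg : ∀ t, MemHs 2 (u t))
    (hsol : SolvesSzego α u) :
    ∃ w : ℝ → Wiener, IsCoeffSolution α w ∧ ∀ t, ⇑(w t) = u t := by
  have h1 : ∀ t, Summable fun n => ‖u t n‖ := fun t =>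
    Summable.of_nonneg_of_le (fun _ => norm_nonneg _)
      (fun n => le_mul_of_one_le_left (norm_nonneg _) (by simp))
      (summable_mul_norm_of_memHs (hreg t))
  refine ⟨fun t => Wiener.mk (u t) (h1 t), ⟨fun n t => ?_, fun t => ?_⟩, fun t => rfl⟩
  · rw [szegoField_apply]
    exact hsol n t
  · exact summable_mul_norm_of_memHs (hreg t)

end Szego

open Szego Szego.ShiftSpace

/-- For `α < 0` and `u₀ ∈ ℒ(N)`, the trajectory of the solution stays
in a compact subset of ℒ(N); in particular all Sobolev norms stay bounded in time. -/
theorem alpha_negative_trajectory_compact (α : ℝ) (hα : α < 0) (N : ℕ) (hN : 1 ≤ N)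
    (u₀ : ℕ → ℂ) (hu₀ : InLN N u₀) (hu₀s : ∀ s : ℝ, MemHs s u₀)
    (u : ℝ → ℕ → ℂ) (hu0 : u 0 = u₀) (hreg : ∀ s : ℝ, SmoothHsCurve s u)
    (hsol : SolvesSzego α u) :
    (∃ Kc : Set Hardy, IsCompact Kc ∧ (∀ v ∈ Kc, InLN N (⇑v)) ∧
      ∀ t : ℝ, ∃ hm : Memℓp (u t) 2, (⟨u t, hm⟩ : Hardy) ∈ Kc) ∧
    ∀ s : ℝ, 0 ≤ s → ∃ C : ℝ, ∀ t : ℝ, hsNormSq s (u t) ≤ C := by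
  obtain ⟨w, hw, hwu⟩ := exists_isCoeffSolution (hreg 2).1 hsol
  have hder := hw.hasDerivAt_curve
  have hB := hw.norm_le 0
  obtain ⟨U, V, hU⟩ := exists_isLaxFlow (E := HardyHilbert)
    (continuous_iff_continuousAt.2 fun t => (hder t).continuousAt) hB 0
  have hrank : Module.rank ℂ (shankRange (E := HardyHilbert) (w 0)) = N := by
    rw [← kuRank_eq, hwu, hu0]
    exact hu₀.2
  have : FiniteDimensional ℂ (shankRange (E := HardyHilbert) (w 0)) :=
    Module.rank_lt_aleph0_iff.1 (hrank ▸ Cardinal.natCast_lt_aleph0)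
  obtain ⟨C, r, hr0, hr1, hC⟩ := hU.exists_norm_coeff_le hder hB hα
  have hmem : ∀ x : HardyHilbert, Memℓp (⇑x) 2 := fun x => x.memL2
  have hemb : ∀ v : Wiener, ⇑(embed HardyHilbert v) = ⇑v := fun v =>
    funext (HardyHilbert.embed_apply v)
  refine ⟨⟨(fun v => (show Hardy from embed HardyHilbert v)) '' closure (Set.range w), ?_, ?_, ?_⟩,
    fun s _ => ⟨∑' n : ℕ, ((1 : ℝ) + (n : ℝ) ^ 2) ^ s * (C * r ^ n) ^ 2, fun t => ?_⟩⟩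
  · have hcomp : IsCompact {u : Wiener | ∀ n, ‖u n‖ ≤ C * r ^ n} :=
      isCompact_setOf_norm_le ((summable_geometric_of_lt_one hr0.le hr1).mul_left C)
    refine (hcomp.closure_of_subset ?_).image (embed HardyHilbert).continuous
    rintro _ ⟨t, rfl⟩
    exact hC t
  · rintro _ ⟨v, hv, rfl⟩
    have h1 : InLN N v := by
      refine ⟨hemb v ▸ hmem _, ?_⟩
      rw [kuRank_eq]
      exact le_antisymm (hU.rank_shankRange_le_of_mem_closure hder hrank.le hv)
        (hrank.symm.le.trans (hU.rank_shankRange_ge_of_mem_closure hder hv))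
    rw [← hemb v] at h1
    exact h1
  · intro t
    have h1 : ⇑(embed HardyHilbert (w t)) = u t := (hemb _).trans (hwu t)
    refine ⟨h1 ▸ hmem _, w t, subset_closure ⟨t, rfl⟩, ?_⟩
    exact lp.ext h1
  · have h1 := summable_sobolev_geometric s C hr0 hr1
    refine Summable.tsum_le_tsum (fun n => ?_) ((hreg s).1 t) h1
    rw [← hwu]
    have := hC t n
    gcongr

end
end

section
/- Let α > 0 and let N ≥ 1 be an integer. There exist u₀ ∈ ℒ(N) and a constant C_α > 0 such that the solution u of the α-Szegő equation i∂ₜu = Π(|u|²u) + α(u|1) with u(0) = u₀ satisfies, for every s ≥ 1/2: there are constants 0 < c_s ≤ C_s and T_s ≥ 0 with c_s·e^{C_α(2s−1)|t|} ≤ ‖u(t)‖_{H^s} ≤ C_s·e^{C_α(2s−1)|t|} for all |t| ≥ T_s. In particular, for every s > 1/2 the H^s norm of u(t) grows exponentially in time. -/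
open Complex Filter
open scoped ComplexConjugate Topology ENNReal

noncomputable section

/-- The coefficients of `z ↦ v(z ^ N)`, where `v` has coefficient sequence `v`. -/
def dilate (N : ℕ) (v : ℕ → ℂ) : ℕ → ℂ := fun n => if N ∣ n then v (n / N) else 0

/-- The coefficients of the rational function `b + c z / (1 - p z)`. -/
def rationalSeq (b c : ℂ) (p : ℝ) : ℕ → ℂ
  | 0 => b
  | k + 1 => c * (p : ℂ) ^ k

@[simp] lemma rationalSeq_zero (b c : ℂ) (p : ℝ) : rationalSeq b c p 0 = b := rfl

@[simp] lemma rationalSeq_succ (b c : ℂ) (p : ℝ) (k : ℕ) :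
    rationalSeq b c p (k + 1) = c * (p : ℂ) ^ k := rfl

section Dilate

variable {N : ℕ}

lemma dilate_mul (hN : 1 ≤ N) (v : ℕ → ℂ) (k : ℕ) : dilate N v (N * k) = v k := by
  simp [dilate, Nat.mul_div_cancel_left k hN]

lemma dilate_of_not_dvd (v : ℕ → ℂ) {n : ℕ} (h : ¬ N ∣ n) : dilate N v n = 0 := by
  simp [dilate, h]

lemma cubic_dilate_mul (hN : 1 ≤ N) (v : ℕ → ℂ) (k : ℕ) :
    cubic (dilate N v) (N * k) = cubic v k := by
  unfold cubic
  have hinj : Function.Injective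
      (fun q : ℕ × ℕ × ℕ => ((N * q.1, N * q.2.1, N * q.2.2) : ℕ × ℕ × ℕ)) := by
    rintro ⟨a, b, c⟩ ⟨a', b', c'⟩ h
    simp only [Prod.mk.injEq, mul_eq_mul_left_iff] at h ⊢
    omega
  rw [← hinj.tsum_eq]
  · refine tsum_congr fun q => ?_
    simp only [dilate_mul hN, ← mul_add]
    have : N * (q.1 + q.2.2) = N * (q.2.1 + k) ↔ q.1 + q.2.2 = q.2.1 + k :=
      Nat.mul_right_inj (by omega)
    simp only [this]
  · intro q hq
    by_contra hr
    apply hq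
    simp only [dilate]
    split_ifs with h0 h1 h2 h3 <;> try simp
    obtain ⟨a, ha⟩ := h1
    obtain ⟨b, hb⟩ := h2
    obtain ⟨c, hc⟩ := h3
    exact (hr ⟨(a, b, c), by simp [← ha, ← hb, ← hc]⟩).elim

lemma cubic_dilate_of_not_dvd (v : ℕ → ℂ) {n : ℕ} (h : ¬ N ∣ n) :
    cubic (dilate N v) n = 0 := by
  unfold cubic
  refine (tsum_congr fun q => ?_).trans tsum_zero
  simp only [dilate]
  split_ifs with h0 h1 h2 h3 <;> try simp
  exact absurd ((Nat.dvd_add_right h2).1 (h0 ▸ dvd_add h1 h3)) h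

lemma mul_left_injective_of_one_le (hN : 1 ≤ N) : Function.Injective (fun k : ℕ => N * k) :=
  fun _ _ h => Nat.eq_of_mul_eq_mul_left hN h

lemma memHs_dilate (hN : 1 ≤ N) (v : ℕ → ℂ) (s : ℝ) :
    MemHs s (dilate N v) ↔
      Summable fun k : ℕ => ((1 : ℝ) + ((N : ℝ) * k) ^ 2) ^ s * ‖v k‖ ^ 2 := by
  unfold MemHs
  rw [← (mul_left_injective_of_one_le hN).summable_iff]
  · simp [Function.comp_def, dilate_mul hN]
  · intro n hn
    rw [dilate_of_not_dvd v fun ⟨k, hk⟩ => hn ⟨k, hk.symm⟩]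
    simp

lemma hsNormSq_dilate (hN : 1 ≤ N) (v : ℕ → ℂ) (s : ℝ) :
    hsNormSq s (dilate N v) = ∑' k : ℕ, ((1 : ℝ) + ((N : ℝ) * k) ^ 2) ^ s * ‖v k‖ ^ 2 := by
  unfold hsNormSq
  rw [← (mul_left_injective_of_one_le hN).tsum_eq]
  · simp [dilate_mul hN]
  · intro n hn
    by_contra hr
    apply hn
    simp only
    rw [dilate_of_not_dvd v fun ⟨k, hk⟩ => hr ⟨k, hk.symm⟩]
    simp

end Dilate

section Cubic

lemma tsum_ite_antidiagonal (v : ℕ → ℂ) (m : ℕ) :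
    (∑' q : ℕ × ℕ, if q.1 + q.2 = m then v q.1 * v q.2 else 0)
      = ∑ q ∈ Finset.HasAntidiagonal.antidiagonal m, v q.1 * v q.2 := by
  rw [tsum_eq_sum (s := Finset.HasAntidiagonal.antidiagonal m)]
  · refine Finset.sum_congr rfl fun q hq => ?_
    rw [if_pos (Finset.HasAntidiagonal.mem_antidiagonal.1 hq)]
  · intro q hq
    rw [if_neg fun h => hq (Finset.HasAntidiagonal.mem_antidiagonal.2 h)]

/-- For absolutely summable coefficients, `Π(|u|²u)` is obtained by correlating the coefficients
of `u²` with those of `u`. -/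
lemma cubic_eq_tsum_antidiagonal {v : ℕ → ℂ} (hv : Summable fun n => ‖v n‖) (n : ℕ) :
    cubic v n = ∑' j, conj (v j) * ∑ q ∈ Finset.HasAntidiagonal.antidiagonal (j + n), v q.1 * v q.2 := by
  unfold cubic
  let e : ℕ × ℕ × ℕ ≃ ℕ × ℕ × ℕ :=
    ⟨fun q => (q.2.1, q.1, q.2.2), fun q => (q.2.1, q.1, q.2.2), fun _ => rfl, fun _ => rfl⟩
  rw [← e.tsum_eq]
  have hs : Summable fun q : ℕ × ℕ × ℕ =>
      if q.2.1 + q.2.2 = q.1 + n then v q.2.1 * conj (v q.1) * v q.2.2 else 0 := by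
    have h2 := hv.mul_of_nonneg hv (fun _ => norm_nonneg _) (fun _ => norm_nonneg _)
    have h3 := hv.mul_of_nonneg h2 (fun _ => norm_nonneg _) (fun _ => by simp; positivity)
    refine Summable.of_norm_bounded h3 fun q => ?_
    split_ifs
    · simp only [norm_mul, RCLike.norm_conj]
      exact le_of_eq (by ring)
    · simp only [norm_zero]
      positivity
  rw [show (fun q => if (e q).1 + (e q).2.2 = (e q).2.1 + n then
      v (e q).1 * conj (v (e q).2.1) * v (e q).2.2 else 0) = fun q : ℕ × ℕ × ℕ =>
      if q.2.1 + q.2.2 = q.1 + n then v q.2.1 * conj (v q.1) * v q.2.2 else 0 from rfl]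
  rw [hs.tsum_prod]
  refine tsum_congr fun j => ?_
  rw [← tsum_ite_antidiagonal, ← tsum_mul_left]
  refine tsum_congr fun q => ?_
  simp only [mul_ite, mul_zero]
  congr 1
  ring

lemma sum_antidiagonal_rationalSeq_succ (b c : ℂ) (p : ℝ) (k : ℕ) :
    ∑ q ∈ Finset.HasAntidiagonal.antidiagonal (k + 1), rationalSeq b c p q.1 * rationalSeq b c p q.2
      = 2 * b * c * (p : ℂ) ^ k + c ^ 2 * (k * (p : ℂ) ^ (k - 1)) := by
  rw [Finset.Nat.sum_antidiagonal_succ]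
  cases k with
  | zero => simp [rationalSeq]; ring
  | succ k =>
    rw [Finset.Nat.sum_antidiagonal_succ']
    have : ∀ q ∈ Finset.HasAntidiagonal.antidiagonal k,
        rationalSeq b c p (q.1 + 1) * rationalSeq b c p (q.2 + 1) = c ^ 2 * (p : ℂ) ^ k := by
      intro q hq
      rw [← Finset.HasAntidiagonal.mem_antidiagonal.1 hq]
      simp only [rationalSeq]
      ring
    rw [Finset.sum_congr rfl this]
    simp [rationalSeq]
    ring

lemma summable_norm_rationalSeq (b c : ℂ) {p : ℝ} (hp : |p| < 1) :
    Summable fun n => ‖rationalSeq b c p n‖ := by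
  rw [← summable_nat_add_iff 1]
  simp only [rationalSeq, norm_mul, norm_pow, Complex.norm_real, Real.norm_eq_abs]
  exact (summable_geometric_of_lt_one (abs_nonneg p) hp).mul_left _

lemma norm_ofReal_sq_lt_one {p : ℝ} (hp : |p| < 1) : ‖(p : ℂ) ^ 2‖ < 1 := by
  rw [norm_pow, Complex.norm_real, Real.norm_eq_abs]
  exact pow_lt_one₀ (abs_nonneg p) hp two_ne_zero

lemma one_sub_ofReal_sq_ne_zero {p : ℝ} (hp : |p| < 1) : 1 - (p : ℂ) ^ 2 ≠ 0 := by
  intro h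
  have h1 := norm_ofReal_sq_lt_one hp
  rw [← sub_eq_zero.1 h, norm_one] at h1
  exact lt_irrefl _ h1

lemma cubic_rationalSeq_of_hasSum (b c : ℂ) {p : ℝ} (hp : |p| < 1) (n : ℕ) {L : ℂ}
    (hL : HasSum (fun j : ℕ => (p : ℂ) ^ j * (2 * b * c * (p : ℂ) ^ (j + n)
      + c ^ 2 * ((j + n : ℕ) * (p : ℂ) ^ (j + n - 1)))) L) :
    cubic (rationalSeq b c p) n = conj b * (∑ q ∈ Finset.HasAntidiagonal.antidiagonal n,
      rationalSeq b c p q.1 * rationalSeq b c p q.2) + conj c * L := by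
  rw [cubic_eq_tsum_antidiagonal (summable_norm_rationalSeq b c hp)]
  refine HasSum.tsum_eq ?_
  rw [← hasSum_nat_add_iff' 1]
  simp only [Finset.sum_range_one, zero_add, rationalSeq_zero, rationalSeq_succ, add_sub_cancel_left]
  refine (hL.mul_left (conj c)).congr_fun fun j => ?_
  rw [show j + 1 + n = j + n + 1 by ring, sum_antidiagonal_rationalSeq_succ]
  simp only [map_mul, map_pow, Complex.conj_ofReal]
  ring

lemma cubic_rationalSeq_zero (b c : ℂ) {p : ℝ} (hp : |p| < 1) :
    cubic (rationalSeq b c p) 0 = conj b * b ^ 2 + conj c * (2 * b * c / (1 - (p : ℂ) ^ 2)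
      + c ^ 2 * p / (1 - (p : ℂ) ^ 2) ^ 2) := by
  have hx := norm_ofReal_sq_lt_one hp
  have hx0 := one_sub_ofReal_sq_ne_zero hp
  have h0 := hasSum_geometric_of_norm_lt_one hx
  have h1 := hasSum_coe_mul_geometric_of_norm_lt_one hx
  have h2 : HasSum (fun j : ℕ => (p : ℂ) ^ j * (j * (p : ℂ) ^ (j - 1)))
      (p / (1 - (p : ℂ) ^ 2) ^ 2) := by
    rw [← hasSum_nat_add_iff' 1]
    convert! (h1.add h0).mul_left (p : ℂ) using 1
    · ext j
      simp
      ring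
    · simp
      field_simp
      ring
  have hL := (h0.mul_left (2 * b * c)).add (h2.mul_left (c ^ 2))
  rw [cubic_rationalSeq_of_hasSum b c hp 0 (hL.congr_fun fun j => by simp; ring)]
  simp [rationalSeq]
  ring

lemma cubic_rationalSeq_succ (b c : ℂ) {p : ℝ} (hp : |p| < 1) (k : ℕ) :
    cubic (rationalSeq b c p) (k + 1) =
      conj b * (2 * b * c * (p : ℂ) ^ k + c ^ 2 * (k * (p : ℂ) ^ (k - 1)))
      + conj c * (2 * b * c * (p : ℂ) ^ (k + 1) / (1 - (p : ℂ) ^ 2)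
        + c ^ 2 * (p : ℂ) ^ k *
          ((p : ℂ) ^ 2 / (1 - (p : ℂ) ^ 2) ^ 2 + (k + 1) / (1 - (p : ℂ) ^ 2))) := by
  have hx := norm_ofReal_sq_lt_one hp
  have h0 := hasSum_geometric_of_norm_lt_one hx
  have h1 := hasSum_coe_mul_geometric_of_norm_lt_one hx
  have hL := (h0.mul_left (2 * b * c * (p : ℂ) ^ (k + 1))).add
    ((h1.add (h0.mul_left (k + 1 : ℂ))).mul_left (c ^ 2 * (p : ℂ) ^ k))
  rw [cubic_rationalSeq_of_hasSum b c hp (k + 1) (hL.congr_fun fun j => by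
    rw [← add_assoc, Nat.add_sub_cancel]
    push_cast
    ring), sum_antidiagonal_rationalSeq_succ]
  simp only [div_eq_mul_inv]

end Cubic

section SobolevNorm

/-- The `j`-th term of the weighted sum defining the `H^s` norm of `z ^ N / (1 - p z ^ N)`,
with `x = p ^ 2`. -/
def sobolevTerm (N : ℕ) (s x : ℝ) (j : ℕ) : ℝ :=
  ((1 : ℝ) + ((N : ℝ) * (j + 1 : ℕ)) ^ 2) ^ s * x ^ j

lemma hasSum_succ_mul_geometric {x : ℝ} (hx0 : 0 ≤ x) (hx1 : x < 1) :
    HasSum (fun j : ℕ => ((j : ℝ) + 1) * x ^ j) (1 / (1 - x) ^ 2) := by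
  have hx : ‖x‖ < 1 := by rwa [Real.norm_eq_abs, abs_of_nonneg hx0]
  have hy : 1 - x ≠ 0 := by linarith
  convert! (hasSum_coe_mul_geometric_of_norm_lt_one hx).add
    (hasSum_geometric_of_norm_lt_one hx) using 1
  · ext j
    ring
  · field_simp
    ring

lemma sobolevTerm_nonneg (N : ℕ) (s : ℝ) {x : ℝ} (hx : 0 ≤ x) (j : ℕ) :
    0 ≤ sobolevTerm N s x j := by
  unfold sobolevTerm
  positivity

/-- Polynomial weights are dominated by binomial coefficients. -/
lemma succ_pow_le_factorial_mul_choose (j m : ℕ) :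
    ((j : ℝ) + 1) ^ m ≤ m.factorial * ((j + m).choose m : ℝ) := by
  have h := Nat.pow_succ_le_ascFactorial (j + 1) m
  rw [Nat.ascFactorial_eq_factorial_mul_choose] at h
  exact_mod_cast h

lemma sobolevTerm_le_rpow (N : ℕ) {s x : ℝ} (hs : 0 ≤ s) (hx0 : 0 ≤ x) (j : ℕ) :
    sobolevTerm N s x j ≤ (1 + (N : ℝ) ^ 2) ^ s * (((j : ℝ) + 1) ^ (2 * s) * x ^ j) := by
  unfold sobolevTerm
  rw [← mul_assoc]
  refine mul_le_mul_of_nonneg_right ?_ (by positivity)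
  rw [Real.rpow_mul (by positivity), ← Real.mul_rpow (by positivity) (by positivity)]
  refine Real.rpow_le_rpow (by positivity) ?_ hs
  push_cast
  rw [Real.rpow_two]
  nlinarith [sq_nonneg (j : ℝ), (Nat.cast_nonneg j : (0 : ℝ) ≤ j)]

lemma rpow_le_sobolevTerm {N : ℕ} (hN : 1 ≤ N) {s x : ℝ} (hs : 0 ≤ s) (hx0 : 0 ≤ x) (j : ℕ) :
    ((j : ℝ) + 1) ^ (2 * s) * x ^ j ≤ sobolevTerm N s x j := by
  unfold sobolevTerm
  refine mul_le_mul_of_nonneg_right ?_ (by positivity)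
  rw [Real.rpow_mul (by positivity)]
  refine Real.rpow_le_rpow (by positivity) ?_ hs
  push_cast
  have hN' : (1 : ℝ) ≤ N := by exact_mod_cast hN
  have : (j : ℝ) + 1 ≤ N * (j + 1) := le_mul_of_one_le_left (by positivity) hN'
  rw [Real.rpow_two]
  nlinarith [(Nat.cast_nonneg j : (0 : ℝ) ≤ j)]

lemma rpow_le_one_add_choose {s y : ℝ} (hy0 : 0 < y) {m : ℕ} (hm : 2 * s ≤ m)
    (hs : 0 ≤ s) (j : ℕ) :
    ((j : ℝ) + 1) ^ (2 * s) ≤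
      y ^ (-(2 * s)) * (1 + m.factorial * ((j + m).choose m : ℝ) * y ^ m) := by
  have hj : (0 : ℝ) < (j : ℝ) + 1 := by positivity
  have key : (((j : ℝ) + 1) * y) ^ (2 * s) ≤ 1 + (((j : ℝ) + 1) * y) ^ m := by
    rcases le_total (((j : ℝ) + 1) * y) 1 with h | h
    · have := Real.rpow_le_one (by positivity) h (by positivity : 0 ≤ 2 * s)
      have : 0 ≤ (((j : ℝ) + 1) * y) ^ m := by positivity
      linarith
    · have := Real.rpow_le_rpow_of_exponent_le h hm
      rw [Real.rpow_natCast] at this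
      linarith
  rw [Real.rpow_neg hy0.le, ← div_eq_inv_mul, le_div_iff₀ (by positivity),
    ← Real.mul_rpow hj.le hy0.le]
  refine key.trans ?_
  rw [mul_pow]
  gcongr
  exact succ_pow_le_factorial_mul_choose j m

lemma sobolevTerm_le (N : ℕ) {s x : ℝ} (hs : 0 ≤ s) (hx0 : 0 ≤ x) (hx1 : x < 1)
    {m : ℕ} (hm : 2 * s ≤ m) (j : ℕ) :
    sobolevTerm N s x j ≤ (1 + (N : ℝ) ^ 2) ^ s * (1 - x) ^ (-(2 * s)) *
      (x ^ j + m.factorial * (1 - x) ^ m * (((j + m).choose m : ℝ) * x ^ j)) := by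
  refine (sobolevTerm_le_rpow N hs hx0 j).trans ?_
  rw [mul_assoc]
  refine mul_le_mul_of_nonneg_left ?_ (by positivity)
  refine (mul_le_mul_of_nonneg_right
    (rpow_le_one_add_choose (sub_pos.2 hx1) hm hs j) (by positivity)).trans_eq ?_
  ring

lemma hasSum_sobolev_majorant {x : ℝ} (hx0 : 0 ≤ x) (hx1 : x < 1) (A : ℝ) (m : ℕ) :
    HasSum (fun j : ℕ => A *
      (x ^ j + m.factorial * (1 - x) ^ m * (((j + m).choose m : ℝ) * x ^ j)))
      (A * ((1 + m.factorial) * (1 - x)⁻¹)) := by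
  have hx : ‖x‖ < 1 := by rwa [Real.norm_eq_abs, abs_of_nonneg hx0]
  have hy : 1 - x ≠ 0 := by linarith
  convert! ((hasSum_geometric_of_norm_lt_one hx).add
    ((hasSum_choose_mul_geometric_of_norm_lt_one m hx).mul_left
      (m.factorial * (1 - x) ^ m))).mul_left A using 2
  field_simp
  ring

lemma summable_sobolevTerm (N : ℕ) (s : ℝ) {x : ℝ} (hx0 : 0 ≤ x) (hx1 : x < 1) :
    Summable (sobolevTerm N s x) := by
  have hpos : Summable (sobolevTerm N |s| x) := by
    obtain ⟨m, hm⟩ := exists_nat_ge (2 * |s|)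
    exact Summable.of_nonneg_of_le (sobolevTerm_nonneg N _ hx0)
      (sobolevTerm_le N (abs_nonneg s) hx0 hx1 hm) (hasSum_sobolev_majorant hx0 hx1 _ m).summable
  refine Summable.of_nonneg_of_le (sobolevTerm_nonneg N _ hx0) (fun j => ?_) hpos
  unfold sobolevTerm
  refine mul_le_mul_of_nonneg_right ?_ (by positivity)
  exact Real.rpow_le_rpow_of_exponent_le (le_add_of_nonneg_right (by positivity)) (le_abs_self s)

/-- Jensen's inequality for the geometric distribution bounds the weighted sum from below. -/
lemma rpow_le_tsum_sobolevTerm {N : ℕ} (hN : 1 ≤ N) {s x : ℝ} (hs : 1 / 2 ≤ s)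
    (hx0 : 0 ≤ x) (hx1 : x < 1) :
    (1 - x) ^ (-(2 * s) - 1) ≤ ∑' j, sobolevTerm N s x j := by
  have hx : ‖x‖ < 1 := by rwa [Real.norm_eq_abs, abs_of_nonneg hx0]
  have hy : 0 < 1 - x := sub_pos.2 hx1
  have hsum : HasSum (fun j : ℕ => (1 - x) ^ (-(2 * s)) *
      ((1 - 2 * s) * x ^ j + 2 * s * (1 - x) * (((j : ℝ) + 1) * x ^ j)))
      ((1 - x) ^ (-(2 * s) - 1)) := by
    convert! (((hasSum_geometric_of_norm_lt_one hx).mul_left (1 - 2 * s)).add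
      ((hasSum_succ_mul_geometric hx0 hx1).mul_left (2 * s * (1 - x)))).mul_left
      ((1 - x) ^ (-(2 * s))) using 1
    rw [Real.rpow_sub_one hy.ne']
    field_simp
    ring
  refine hasSum_le (fun j => ?_) hsum (summable_sobolevTerm N s hx0 hx1).hasSum
  refine le_trans ?_ (rpow_le_sobolevTerm hN (by linarith) hx0 j)
  have hj : (0 : ℝ) < (j : ℝ) + 1 := by positivity
  have hb := one_add_mul_self_le_rpow_one_add (s := ((j : ℝ) + 1) * (1 - x) - 1)
    (by nlinarith) (p := 2 * s) (by linarith)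
  rw [add_sub_cancel, Real.mul_rpow hj.le hy.le] at hb
  rw [Real.rpow_neg hy.le, ← div_eq_inv_mul, div_le_iff₀ (by positivity)]
  have := mul_le_mul_of_nonneg_right hb (by positivity : 0 ≤ x ^ j)
  linarith

lemma tsum_sobolevTerm_le (N : ℕ) {s x : ℝ} (hs : 0 ≤ s)
    (hx0 : 0 ≤ x) (hx1 : x < 1) {m : ℕ} (hm : 2 * s ≤ m) :
    ∑' j, sobolevTerm N s x j ≤
      (1 + (N : ℝ) ^ 2) ^ s * (1 + m.factorial) * (1 - x) ^ (-(2 * s) - 1) := by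
  have hy : 0 < 1 - x := sub_pos.2 hx1
  refine (hasSum_le (sobolevTerm_le N hs hx0 hx1 hm) (summable_sobolevTerm N s hx0 hx1).hasSum
    (hasSum_sobolev_majorant hx0 hx1 _ m)).trans_eq ?_
  rw [Real.rpow_sub_one hy.ne']
  ring

lemma sobolev_summand_rationalSeq_succ (N : ℕ) (s : ℝ) (b c : ℂ) (p : ℝ) (j : ℕ) :
    ((1 : ℝ) + ((N : ℝ) * (j + 1 : ℕ)) ^ 2) ^ s * ‖rationalSeq b c p (j + 1)‖ ^ 2
      = ‖c‖ ^ 2 * sobolevTerm N s (p ^ 2) j := by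
  rw [rationalSeq_succ, norm_mul, norm_pow, Complex.norm_real, sobolevTerm, ← sq_abs p,
    Real.norm_eq_abs]
  ring

lemma memHs_dilate_rationalSeq {N : ℕ} (hN : 1 ≤ N) (s : ℝ) (b c : ℂ) {p : ℝ} (hp : |p| < 1) :
    MemHs s (dilate N (rationalSeq b c p)) := by
  rw [memHs_dilate hN, ← summable_nat_add_iff 1]
  simp only [sobolev_summand_rationalSeq_succ]
  exact (summable_sobolevTerm N s (sq_nonneg p) ((sq_lt_one_iff_abs_lt_one p).2 hp)).mul_left _

lemma hsNormSq_dilate_rationalSeq {N : ℕ} (hN : 1 ≤ N) (s : ℝ) (b c : ℂ) {p : ℝ} (hp : |p| < 1) :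
    hsNormSq s (dilate N (rationalSeq b c p))
      = ‖b‖ ^ 2 + ‖c‖ ^ 2 * ∑' j, sobolevTerm N s (p ^ 2) j := by
  have h := (memHs_dilate hN _ s).1 (memHs_dilate_rationalSeq hN s b c hp)
  rw [hsNormSq_dilate hN, h.tsum_eq_zero_add]
  simp only [sobolev_summand_rationalSeq_succ, tsum_mul_left]
  simp

end SobolevNorm

section Rank

lemma dilate_rationalSeq_zero_pole {N : ℕ} (hN : 1 ≤ N) (b c : ℂ) {n : ℕ} (hn : 1 ≤ n) :
    dilate N (rationalSeq b c 0) n = if n = N then c else 0 := by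
  by_cases h : N ∣ n
  · obtain ⟨k, rfl⟩ := h
    rw [dilate_mul hN]
    match k with
    | 0 => omega
    | 1 => simp
    | k + 2 =>
      have : N * (k + 2) ≠ N := by nlinarith
      simp [this]
  · rw [dilate_of_not_dvd _ h, if_neg]
    rintro rfl
    exact h dvd_rfl

lemma khankel_dilate_rationalSeq_zero_pole {N : ℕ} (hN : 1 ≤ N) (b c : ℂ) (h : ℕ → ℂ) (k : ℕ) :
    khankel (dilate N (rationalSeq b c 0)) h k
      = if k < N then c * conj (h (N - 1 - k)) else 0 := by
  unfold khankel
  simp_rw [fun l => dilate_rationalSeq_zero_pole hN b c (show 1 ≤ k + 1 + l by omega)]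
  split_ifs with hk
  · rw [tsum_eq_single (N - 1 - k)]
    · rw [if_pos (by omega)]
    · intro l hl
      rw [if_neg (by omega), zero_mul]
  · refine (tsum_congr fun l => ?_).trans tsum_zero
    rw [if_neg (by omega), zero_mul]

lemma memL2_of_forall_ge_eq_zero {h : ℕ → ℂ} {N : ℕ} (hh : ∀ n, N ≤ n → h n = 0) : MemL2 h := by
  refine memℓp_gen (summable_of_ne_finset_zero (s := Finset.range N) fun n hn => ?_)
  rw [hh n (by simpa using hn)]
  simp

lemma image_khankel_eq_range {N : ℕ} (hN : 1 ≤ N) (b : ℂ) {c : ℂ} (hc : c ≠ 0) :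
    khankel (dilate N (rationalSeq b c 0)) '' {h | MemL2 h}
      = (LinearMap.range (Function.ExtendByZero.linearMap ℂ (Fin.val : Fin N → ℕ)) :
          Set (ℕ → ℂ)) := by
  have hext : ∀ (f : Fin N → ℂ) (k : ℕ),
      Function.ExtendByZero.linearMap ℂ (Fin.val : Fin N → ℕ) f k
        = if hk : k < N then f ⟨k, hk⟩ else 0 := by
    intro f k
    simp only [Function.ExtendByZero.linearMap_apply]
    split_ifs with hk
    · exact Fin.val_injective.extend_apply f 0 (⟨k, hk⟩ : Fin N)
    · rw [Function.extend_apply' _ _ _ fun ⟨i, hi⟩ => hk (hi ▸ i.2)]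
      rfl
  apply Set.Subset.antisymm
  · rintro _ ⟨h, -, rfl⟩
    refine ⟨fun i => c * conj (h (N - 1 - i)), funext fun k => ?_⟩
    rw [hext, khankel_dilate_rationalSeq_zero_pole hN]
    split_ifs <;> rfl
  · rintro _ ⟨f, rfl⟩
    refine ⟨fun l => if hl : l < N then conj (f ⟨N - 1 - l, by omega⟩ / c) else 0,
      memL2_of_forall_ge_eq_zero (N := N) fun n hn => dif_neg (by omega), funext fun k => ?_⟩
    rw [hext, khankel_dilate_rationalSeq_zero_pole hN]
    split_ifs with hk h2
    · rw [Complex.conj_conj, mul_div_cancel₀ _ hc]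
      congr 2
      omega
    · omega
    · rfl

lemma kuRank_dilate_rationalSeq_zero_pole {N : ℕ} (hN : 1 ≤ N) (b : ℂ) {c : ℂ} (hc : c ≠ 0) :
    kuRank (dilate N (rationalSeq b c 0)) = N := by
  have hinj : Function.Injective
      (Function.ExtendByZero.linearMap ℂ (Fin.val : Fin N → ℕ)) :=
    Function.extend_injective Fin.val_injective 0
  unfold kuRank
  rw [image_khankel_eq_range hN b hc, Submodule.span_eq,
    ← (LinearEquiv.ofInjective _ hinj).rank_eq, rank_fin_fun]

end Rank

section ExplicitSolution

lemma cubic_const_mul {e : ℂ} (he : e * conj e = 1) (v : ℕ → ℂ) (n : ℕ) :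
    cubic (fun k => e * v k) n = e * cubic v n := by
  unfold cubic
  rw [← tsum_mul_left]
  refine tsum_congr fun q => ?_
  split_ifs
  · rw [map_mul]
    linear_combination (e * v q.1 * conj (v q.2.1) * v q.2.2) * he
  · simp

lemma rationalSeq_const_mul (e b c : ℂ) (p : ℝ) :
    rationalSeq (e * b) (e * c) p = fun k => e * rationalSeq b c p k := by
  ext k
  cases k <;> simp [mul_assoc]

lemma hasDerivAt_tanh_const_mul (β t : ℝ) :
    HasDerivAt (fun t => Real.tanh (β * t)) (β * (1 - Real.tanh (β * t) ^ 2)) t := by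
  have hm : HasDerivAt (fun t => β * t) β t := by simpa using (hasDerivAt_id t).const_mul β
  have hc : Real.cosh (β * t) ≠ 0 := (Real.cosh_pos _).ne'
  simp only [Real.tanh_eq_sinh_div_cosh]
  convert! hm.sinh.div hm.cosh hc using 1
  field_simp

lemma one_sub_tanh_sq (x : ℝ) : 1 - Real.tanh x ^ 2 = (Real.cosh x ^ 2)⁻¹ := by
  have hc : Real.cosh x ≠ 0 := (Real.cosh_pos _).ne'
  rw [Real.tanh_eq_sinh_div_cosh]
  field_simp
  rw [Real.cosh_sq]
  ring

lemma abs_tanh_lt_one (x : ℝ) : |Real.tanh x| < 1 := by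
  rw [← sq_lt_one_iff_abs_lt_one, ← sub_pos, one_sub_tanh_sq]
  have := Real.cosh_pos x
  positivity

/-- The rotating phase of the explicit solution for `α = a ^ 2`. -/
def szegoPhase (a t : ℝ) : ℂ := Complex.exp (-(3 * a ^ 2 * t) * Complex.I)

/-- The pole parameter of the explicit solution for `α = a ^ 2`. -/
def szegoPole (a t : ℝ) : ℝ := Real.tanh (a ^ 2 * t)

/-- The solution `e^{-3iαt} (-a (p + i) + a (1 - p²) z / (1 - p z))`, `p = tanh (α t)`,
of the `α`-Szegő equation with `α = a ^ 2`. -/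
def szegoProfile (a t : ℝ) : ℕ → ℂ :=
  rationalSeq (szegoPhase a t * (-(a * (szegoPole a t + Complex.I))))
    (szegoPhase a t * (a * (1 - (szegoPole a t : ℂ) ^ 2))) (szegoPole a t)

lemma abs_szegoPole_lt_one (a t : ℝ) : |szegoPole a t| < 1 := abs_tanh_lt_one _

lemma norm_szegoPhase (a t : ℝ) : ‖szegoPhase a t‖ = 1 := by
  rw [szegoPhase, show (-(3 * a ^ 2 * t) * Complex.I : ℂ)
    = ((-(3 * a ^ 2 * t) : ℝ) : ℂ) * Complex.I by push_cast; ring]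
  exact Complex.norm_exp_ofReal_mul_I _

lemma szegoPhase_mul_conj (a t : ℝ) : szegoPhase a t * conj (szegoPhase a t) = 1 := by
  rw [Complex.mul_conj, Complex.normSq_eq_norm_sq, norm_szegoPhase]
  simp

lemma hasDerivAt_szegoPhase (a t : ℝ) :
    HasDerivAt (szegoPhase a) (szegoPhase a t * (-(3 * a ^ 2) * Complex.I)) t := by
  have h : HasDerivAt (fun t : ℝ => (-(3 * a ^ 2 * t) * Complex.I : ℂ))
      (-(3 * a ^ 2) * Complex.I) t := by
    have h0 := ((hasDerivAt_id t).ofReal_comp).const_mul (-(3 * a ^ 2) * Complex.I : ℂ)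
    convert! h0 using 1
    · ext t
      simp
      ring
    · simp
  exact h.cexp

lemma hasDerivAt_szegoPole (a t : ℝ) :
    HasDerivAt (fun t => (szegoPole a t : ℂ)) (a ^ 2 * (1 - (szegoPole a t : ℂ) ^ 2)) t := by
  have h := (hasDerivAt_tanh_const_mul (a ^ 2) t).ofReal_comp
  convert! h using 1
  simp only [szegoPole]
  push_cast
  rfl

lemma cubic_szegoProfile (a t : ℝ) (n : ℕ) :
    cubic (szegoProfile a t) n = szegoPhase a t *
      cubic (rationalSeq (-(a * (szegoPole a t + Complex.I)))
        (a * (1 - (szegoPole a t : ℂ) ^ 2)) (szegoPole a t)) n := by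
  rw [szegoProfile, rationalSeq_const_mul, cubic_const_mul (szegoPhase_mul_conj a t)]

lemma hasDerivAt_szegoProfile_zero (a t : ℝ) :
    HasDerivAt (fun t => szegoProfile a t 0)
      (-Complex.I * (cubic (szegoProfile a t) 0 + (a : ℂ) ^ 2 * szegoProfile a t 0)) t := by
  rw [cubic_szegoProfile, cubic_rationalSeq_zero _ _ (abs_szegoPole_lt_one a t)]
  have hq := one_sub_ofReal_sq_ne_zero (abs_szegoPole_lt_one a t)
  have hd := (hasDerivAt_szegoPhase a t).mul
    ((((hasDerivAt_szegoPole a t).add_const Complex.I).const_mul (a : ℂ)).neg)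
  refine hd.congr_deriv ?_
  simp only [szegoProfile, rationalSeq_zero, map_mul, map_neg, map_add, map_sub, map_pow, map_one,
    Complex.conj_ofReal, Complex.conj_I, Pi.neg_apply]
  set T : ℂ := (szegoPole a t : ℂ)
  set e := szegoPhase a t
  have e1 : ∀ x : ℂ, 2 * x * (a * (1 - T ^ 2)) / (1 - T ^ 2) = 2 * x * a := fun x => by
    field_simp
  have e2 : (a * (1 - T ^ 2)) ^ 2 * T / (1 - T ^ 2) ^ 2 = a ^ 2 * T := by
    field_simp
  rw [e1, e2]
  linear_combination (e * a ^ 3 * (3 - (-Complex.I * T + T ^ 2 - (Complex.I ^ 2 - 1)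
    + 2 * (1 - T ^ 2) + 1))) * Complex.I_sq

lemma hasDerivAt_szegoProfile_succ (a t : ℝ) (k : ℕ) :
    HasDerivAt (fun t => szegoProfile a t (k + 1))
      (-Complex.I * cubic (szegoProfile a t) (k + 1)) t := by
  rw [cubic_szegoProfile, cubic_rationalSeq_succ _ _ (abs_szegoPole_lt_one a t)]
  have hq := one_sub_ofReal_sq_ne_zero (abs_szegoPole_lt_one a t)
  have hp := hasDerivAt_szegoPole a t
  have hd := ((hasDerivAt_szegoPhase a t).mul
    (((hp.pow 2).const_sub 1).const_mul (a : ℂ))).mul (hp.pow k)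
  refine hd.congr_deriv ?_
  simp only [map_mul, map_neg, map_add, map_sub, map_pow, map_one,
    Complex.conj_ofReal, Complex.conj_I, Pi.mul_apply, Pi.pow_apply, Nat.cast_ofNat,
    Nat.add_one_sub_one, pow_one]
  have hk : (szegoPole a t : ℂ) * (k * (szegoPole a t : ℂ) ^ (k - 1))
      = k * (szegoPole a t : ℂ) ^ k := by
    cases k with
    | zero => simp
    | succ k => simp; ring
  rw [pow_succ _ k]
  set T : ℂ := (szegoPole a t : ℂ)
  set e := szegoPhase a t
  generalize T ^ (k - 1) = X at *
  generalize T ^ k = Y at *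
  have e1 : ∀ x y : ℂ, 2 * x * (a * (1 - T ^ 2)) * y / (1 - T ^ 2) = 2 * x * a * y := fun x y => by
    field_simp
  have e2 : (a * (1 - T ^ 2)) ^ 2 * Y * (T ^ 2 / (1 - T ^ 2) ^ 2 + (k + 1) / (1 - T ^ 2))
      = a ^ 2 * Y * (T ^ 2 + (k + 1) * (1 - T ^ 2)) := by
    field_simp
  rw [e1, e2]
  linear_combination (-e * ((2 * Complex.I + 2 * T) * a ^ 3 * (1 - T ^ 2) * Y
    - a ^ 3 * (1 - T ^ 2) ^ 2 * (k * X))) * Complex.I_sq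
    - e * Complex.I * a ^ 3 * (1 - T ^ 2) ^ 2 * hk

lemma solvesSzego_dilate_szegoProfile {N : ℕ} (hN : 1 ≤ N) (a : ℝ) :
    SolvesSzego (a ^ 2) fun t => dilate N (szegoProfile a t) := by
  intro n t
  by_cases h : N ∣ n
  · obtain ⟨k, rfl⟩ := h
    simp only [dilate_mul hN, cubic_dilate_mul hN]
    cases k with
    | zero => simpa [oneSeq, dilate] using hasDerivAt_szegoProfile_zero a t
    | succ k =>
      have : N * (k + 1) ≠ 0 := by positivity
      simpa [oneSeq, this] using hasDerivAt_szegoProfile_succ a t k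
  · have hn : n ≠ 0 := by
      rintro rfl
      exact h (dvd_zero N)
    simpa only [dilate_of_not_dvd _ h, cubic_dilate_of_not_dvd _ h, oneSeq, if_neg hn, mul_zero,
      add_zero] using hasDerivAt_const t (0 : ℂ)

lemma contDiff_szegoPole (a : ℝ) {n : WithTop ℕ∞} :
    ContDiff ℝ n fun t => (szegoPole a t : ℂ) := by
  refine Complex.ofRealCLM.contDiff.comp (f := fun t => Real.tanh (a ^ 2 * t)) ?_
  simp only [Real.tanh_eq_sinh_div_cosh]
  have hm : ContDiff ℝ n fun t : ℝ => a ^ 2 * t := contDiff_const.mul contDiff_id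
  exact hm.sinh.div hm.cosh fun t => (Real.cosh_pos _).ne'

lemma contDiff_szegoPhase (a : ℝ) {n : WithTop ℕ∞} : ContDiff ℝ n (szegoPhase a) := by
  refine ContDiff.cexp ?_
  exact (contDiff_const.mul Complex.ofRealCLM.contDiff).neg.mul contDiff_const

lemma contDiff_szegoProfile (a : ℝ) {n : WithTop ℕ∞} (k : ℕ) :
    ContDiff ℝ n fun t => szegoProfile a t k := by
  have hp := contDiff_szegoPole a (n := n)
  have he := contDiff_szegoPhase a (n := n)
  cases k with
  | zero =>
    exact he.mul (contDiff_const.mul (hp.add contDiff_const)).neg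
  | succ k =>
    exact (he.mul (contDiff_const.mul (contDiff_const.sub (hp.pow 2)))).mul (hp.pow k)

lemma smoothHsCurve_dilate_szegoProfile {N : ℕ} (hN : 1 ≤ N) (a s : ℝ) :
    SmoothHsCurve s fun t => dilate N (szegoProfile a t) := by
  refine ⟨fun t => memHs_dilate_rationalSeq hN s _ _ (abs_szegoPole_lt_one a t), fun n => ?_⟩
  by_cases h : N ∣ n
  · obtain ⟨k, rfl⟩ := h
    simpa only [dilate_mul hN] using contDiff_szegoProfile a k
  · simp only [dilate_of_not_dvd _ h]
    exact contDiff_const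

lemma hsNormSq_dilate_szegoProfile {N : ℕ} (hN : 1 ≤ N) (s a t : ℝ) :
    hsNormSq s (dilate N (szegoProfile a t)) = a ^ 2 * (1 + szegoPole a t ^ 2)
      + a ^ 2 * (1 - szegoPole a t ^ 2) ^ 2 * ∑' j, sobolevTerm N s (szegoPole a t ^ 2) j := by
  rw [szegoProfile, hsNormSq_dilate_rationalSeq hN s _ _ (abs_szegoPole_lt_one a t)]
  have h1 : ‖(szegoPole a t : ℂ) + Complex.I‖ ^ 2 = 1 + szegoPole a t ^ 2 := by
    rw [← Complex.normSq_eq_norm_sq, Complex.normSq_apply]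
    simp
    ring
  have h2 : ‖1 - (szegoPole a t : ℂ) ^ 2‖ ^ 2 = (1 - szegoPole a t ^ 2) ^ 2 := by
    rw [show 1 - (szegoPole a t : ℂ) ^ 2 = ((1 - szegoPole a t ^ 2 : ℝ) : ℂ) by push_cast; rfl,
      Complex.norm_real, Real.norm_eq_abs, sq_abs]
  simp only [norm_mul, norm_neg, norm_szegoPhase, Complex.norm_real, one_mul, mul_pow, h1, h2,
    Real.norm_eq_abs, sq_abs]

lemma exp_le_one_sub_tanh_sq (x : ℝ) : Real.exp (-2 * |x|) ≤ 1 - Real.tanh x ^ 2 := by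
  rw [one_sub_tanh_sq, ← Real.cosh_abs, show -2 * |x| = -(|x| + |x|) by ring, Real.exp_neg,
    Real.exp_add, ← sq]
  have h := Real.cosh_pos |x|
  gcongr
  rw [Real.cosh_eq]
  have : Real.exp (-|x|) ≤ Real.exp |x| := Real.exp_le_exp.2 (by linarith [abs_nonneg x])
  linarith

lemma one_sub_tanh_sq_le_exp (x : ℝ) : 1 - Real.tanh x ^ 2 ≤ 4 * Real.exp (-2 * |x|) := by
  rw [one_sub_tanh_sq, ← Real.cosh_abs, show -2 * |x| = -(|x| + |x|) by ring, Real.exp_neg,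
    Real.exp_add, ← sq, ← div_eq_mul_inv, ← inv_div]
  gcongr
  rw [Real.cosh_eq, div_pow]
  have := Real.exp_pos |x|
  have := Real.exp_pos (-|x|)
  rw [div_le_div_iff₀ (by norm_num) (by norm_num)]
  nlinarith

lemma exp_growth_eq (α s t : ℝ) (hα : 0 ≤ α) :
    Real.exp (-2 * |α * t|) ^ (1 - 2 * s) = Real.exp (α * (2 * s - 1) * |t|) ^ 2 := by
  rw [← Real.exp_mul, ← Real.exp_nat_mul, abs_mul, abs_of_nonneg hα]
  congr 1
  push_cast
  ring

lemma sq_mul_rpow_neg_sub_one {y : ℝ} (hy : 0 < y) (s : ℝ) :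
    y ^ 2 * y ^ (-(2 * s) - 1) = y ^ (1 - 2 * s) := by
  rw [← Real.rpow_natCast, ← Real.rpow_add hy]
  congr 1
  push_cast
  ring

lemma le_hsNormSq_dilate_szegoProfile {N : ℕ} (hN : 1 ≤ N) {s : ℝ} (hs : 1 / 2 ≤ s) (a t : ℝ) :
    a ^ 2 * 4 ^ (1 - 2 * s) * Real.exp (a ^ 2 * (2 * s - 1) * |t|) ^ 2
      ≤ hsNormSq s (dilate N (szegoProfile a t)) := by
  have hx1 : szegoPole a t ^ 2 < 1 := (sq_lt_one_iff_abs_lt_one _).2 (abs_szegoPole_lt_one a t)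
  have hy : 0 < 1 - szegoPole a t ^ 2 := sub_pos.2 hx1
  have h1 := Real.rpow_le_rpow_of_nonpos hy (one_sub_tanh_sq_le_exp (a ^ 2 * t))
    (show 1 - 2 * s ≤ 0 by linarith)
  rw [Real.mul_rpow (by norm_num) (Real.exp_pos _).le, exp_growth_eq _ _ _ (sq_nonneg a)] at h1
  have h2 := rpow_le_tsum_sobolevTerm hN hs (sq_nonneg (szegoPole a t)) hx1
  rw [hsNormSq_dilate_szegoProfile hN, mul_assoc]
  refine (mul_le_mul_of_nonneg_left h1 (sq_nonneg a)).trans ?_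
  change a ^ 2 * (1 - szegoPole a t ^ 2) ^ (1 - 2 * s) ≤ _
  rw [← sq_mul_rpow_neg_sub_one hy, ← mul_assoc]
  have := mul_le_mul_of_nonneg_left h2 (by positivity : 0 ≤ a ^ 2 * (1 - szegoPole a t ^ 2) ^ 2)
  have : 0 ≤ a ^ 2 * (1 + szegoPole a t ^ 2) := by positivity
  linarith

lemma exists_hsNormSq_dilate_szegoProfile_le {N : ℕ} (hN : 1 ≤ N) {s : ℝ} (hs : 1 / 2 ≤ s)
    (a : ℝ) : ∃ C : ℝ, ∀ t, hsNormSq s (dilate N (szegoProfile a t))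
      ≤ C * Real.exp (a ^ 2 * (2 * s - 1) * |t|) ^ 2 := by
  obtain ⟨m, hm⟩ := exists_nat_ge (2 * s)
  refine ⟨a ^ 2 * (2 + (1 + (N : ℝ) ^ 2) ^ s * (1 + m.factorial)), fun t => ?_⟩
  have hx1 : szegoPole a t ^ 2 < 1 := (sq_lt_one_iff_abs_lt_one _).2 (abs_szegoPole_lt_one a t)
  have hy : 0 < 1 - szegoPole a t ^ 2 := sub_pos.2 hx1
  have hs' : 1 - 2 * s ≤ 0 := by linarith
  have h1 := Real.rpow_le_rpow_of_nonpos (Real.exp_pos _) (exp_le_one_sub_tanh_sq (a ^ 2 * t)) hs'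
  rw [exp_growth_eq _ _ _ (sq_nonneg a)] at h1
  refine le_trans ?_ (mul_le_mul_of_nonneg_left h1 (by positivity))
  change _ ≤ _ * (1 - szegoPole a t ^ 2) ^ (1 - 2 * s)
  rw [hsNormSq_dilate_szegoProfile hN, mul_add (a ^ 2) 2, add_mul]
  have h2 := tsum_sobolevTerm_le N (show 0 ≤ s by linarith) (sq_nonneg (szegoPole a t)) hx1 hm
  have h3 : 1 ≤ (1 - szegoPole a t ^ 2) ^ (1 - 2 * s) :=
    Real.one_le_rpow_of_pos_of_le_one_of_nonpos hy (by linarith [sq_nonneg (szegoPole a t)]) hs'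
  refine add_le_add ?_ ?_
  · rw [mul_assoc]
    refine mul_le_mul_of_nonneg_left ?_ (sq_nonneg a)
    linarith
  · refine (mul_le_mul_of_nonneg_left h2 (by positivity)).trans_eq ?_
    rw [← sq_mul_rpow_neg_sub_one hy]
    ring

lemma szegoProfile_at_zero (a : ℝ) :
    szegoProfile a 0 = rationalSeq (-(a * Complex.I)) a 0 := by
  simp [szegoProfile, szegoPole, szegoPhase]

end ExplicitSolution

/-- For `α > 0` and any `N ≥ 1` there exist initial data `u₀ ∈ ℒ(N)`
and a constant `C_α > 0` such that the solution satisfies, for every `s ≥ 1/2`,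
`‖u(t)‖_{H^s} ≍ e^{C_α(2s−1)|t|}` for large `|t|`. -/
theorem alpha_positive_exponential_growth (α : ℝ) (hα : 0 < α) (N : ℕ) (hN : 1 ≤ N) :
    ∃ u₀ : ℕ → ℂ, InLN N u₀ ∧ (∀ s : ℝ, MemHs s u₀) ∧
      ∃ Cα : ℝ, 0 < Cα ∧
        ∃ u : ℝ → ℕ → ℂ, u 0 = u₀ ∧ (∀ s : ℝ, SmoothHsCurve s u) ∧ SolvesSzego α u ∧
          ∀ s : ℝ, 1/2 ≤ s → ∃ cs Cs Ts : ℝ, 0 < cs ∧ cs ≤ Cs ∧ 0 ≤ Ts ∧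
            ∀ t : ℝ, Ts ≤ |t| →
              cs * Real.exp (Cα * (2 * s - 1) * |t|) ≤ Real.sqrt (hsNormSq s (u t)) ∧
              Real.sqrt (hsNormSq s (u t)) ≤ Cs * Real.exp (Cα * (2 * s - 1) * |t|) := by
  have ha : 0 < Real.sqrt α := Real.sqrt_pos.2 hα
  have hsq : Real.sqrt α ^ 2 = α := Real.sq_sqrt hα.le
  set a := Real.sqrt α
  have hsmooth := smoothHsCurve_dilate_szegoProfile hN a
  refine ⟨dilate N (szegoProfile a 0), ⟨?_, ?_⟩, fun s => (hsmooth s).1 0, α, hα,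
    fun t => dilate N (szegoProfile a t), rfl, hsmooth,
    hsq ▸ solvesSzego_dilate_szegoProfile hN a, fun s hs => ?_⟩
  · refine memℓp_gen ?_
    simpa [MemHs] using (hsmooth 0).1 0
  · rw [szegoProfile_at_zero]
    exact kuRank_dilate_rationalSeq_zero_pole hN _ (Complex.ofReal_ne_zero.2 ha.ne')
  · obtain ⟨C, hC⟩ := exists_hsNormSq_dilate_szegoProfile_le hN hs a
    have hlow := le_hsNormSq_dilate_szegoProfile hN hs a
    rw [hsq] at hC hlow
    refine ⟨Real.sqrt (α * 4 ^ (1 - 2 * s)), Real.sqrt C, 0, Real.sqrt_pos.2 (by positivity),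
      Real.sqrt_le_sqrt ?_, le_rfl, fun t _ => ?_⟩
    · simpa using (hlow 0).trans (hC 0)
    · have hsqrt : ∀ A : ℝ, Real.sqrt A * Real.exp (α * (2 * s - 1) * |t|)
          = Real.sqrt (A * Real.exp (α * (2 * s - 1) * |t|) ^ 2) := fun A => by
        rw [Real.sqrt_mul' _ (sq_nonneg _), Real.sqrt_sq (Real.exp_pos _).le]
      rw [hsqrt, hsqrt]
      exact ⟨Real.sqrt_le_sqrt (hlow t), Real.sqrt_le_sqrt (hC t)⟩

end
end
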